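/- Banach algebra property of inhomogeneous Gevrey spaces (Lemma 4.1): Let d ≥ 1, 1 < p < ∞ and β > d/p. Then there exists a constant C, depending only on d, p, β but NOT on a, such that for every a ≥ 0 and all Schwartz functions f, g on ℝ^d whose Fourier transforms are compactly supported: ‖H_{a,β}(fg)‖_{L^p} ≤ C ‖H_{a,β} f‖_{L^p} ‖H_{a,β} g‖_{L^p}. -/

import Mathlib

open MeasureTheory SchwartzMap
open scoped ENNReal FourierTransform RealInnerProductSpace

/-- `H_{a,β} h (x) = ∫ e^{2πi⟨x,ξ⟩} e^{a‖ξ‖₁} (1+‖ξ‖)^β 𝓕h(ξ) dξ`, where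
`‖ξ‖₁ = ∑ᵢ |ξᵢ|` and `𝓕h(ξ) = ∫ e^{−2πi⟨x,ξ⟩} h(x) dx`. -/
noncomputable def gevH (d : ℕ) (a β : ℝ) (h : EuclideanSpace ℝ (Fin d) → ℂ) :
    EuclideanSpace ℝ (Fin d) → ℂ :=
  fun x => ∫ ξ : EuclideanSpace ℝ (Fin d),
    Complex.exp (((2 * Real.pi * ⟪x, ξ⟫) : ℝ) * Complex.I) *
      ((Real.exp (a * ∑ i, |ξ i|) * (1 + ‖ξ‖) ^ β : ℝ) : ℂ) * 𝓕 h ξ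

/-! ### Minkowski's integral inequality -/

theorem eLpNorm_integral_le_of_forall_le {X Ω : Type*} [MeasurableSpace X] [MeasurableSpace Ω]
    {ν : Measure X} [SFinite ν] {μ : Measure Ω} [SFinite μ] {p : ℝ} (hp : 1 < p)
    {h : Ω → X → ℂ} (hh : Measurable (Function.uncurry h)) {α : Ω → ℝ≥0∞} (hα : Measurable α)
    (hα0 : ∀ᵐ ω ∂μ, α ω ≠ 0) (hαi : ∫⁻ ω, α ω ∂μ ≠ ⊤) {K : ℝ≥0∞}
    (hK : ∀ᵐ ω ∂μ, eLpNorm (h ω) (ENNReal.ofReal p) ν ≤ α ω * K) :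
    eLpNorm (fun x => ∫ ω, h ω x ∂μ) (ENNReal.ofReal p) ν ≤ (∫⁻ ω, α ω ∂μ) * K := by
  have hp0 : 0 < p := by linarith
  have hpq : p.HolderConjugate (p.conjExponent) := Real.HolderConjugate.conjExponent hp
  set q := p.conjExponent with hq
  have hq0 : 0 < q := hpq.symm.pos
  have hpe : ENNReal.ofReal p ≠ 0 := by simpa using hp0
  have e0 : ∀ f : X → ℂ, eLpNorm f (ENNReal.ofReal p) ν = (∫⁻ x, ‖f x‖ₑ ^ p ∂ν) ^ (1 / p) := by
    intro f
    rw [eLpNorm_eq_lintegral_rpow_enorm_toReal hpe ENNReal.ofReal_ne_top,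
      ENNReal.toReal_ofReal hp0.le]
  have hαt : ∀ᵐ ω ∂μ, α ω < ⊤ := ae_lt_top hα hαi
  set A := ∫⁻ ω, α ω ∂μ
  have hpq' : p / q = p - 1 := by rw [hq, Real.conjExponent]; field_simp
  have hhe : Measurable (fun z : X × Ω => ‖h z.2 z.1‖ₑ) :=
    (hh.comp measurable_swap).enorm
  have key : ∀ x, ‖∫ ω, h ω x ∂μ‖ₑ ^ p ≤
      A ^ (p - 1) * ∫⁻ ω, ‖h ω x‖ₑ ^ p * (α ω) ^ (1 - p) ∂μ := by
    intro x
    have hm1 : Measurable (fun ω => ‖h ω x‖ₑ) := hhe.comp (measurable_prodMk_left)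
    have h1 : ‖∫ ω, h ω x ∂μ‖ₑ ≤ ∫⁻ ω, ((fun ω => ‖h ω x‖ₑ * (α ω) ^ (-(1 / q))) *
        (fun ω => (α ω) ^ (1 / q))) ω ∂μ := by
      refine (enorm_integral_le_lintegral_enorm _).trans (lintegral_mono_ae ?_)
      filter_upwards [hα0, hαt] with ω h0 ht
      simp only [Pi.mul_apply]
      rw [mul_assoc, ← ENNReal.rpow_add _ _ h0 ht.ne]
      simp
    have h2 := h1.trans (ENNReal.lintegral_mul_le_Lp_mul_Lq μ hpq
      (hm1.mul (hα.pow_const _)).aemeasurable (hα.pow_const _).aemeasurable)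
    calc ‖∫ ω, h ω x ∂μ‖ₑ ^ p ≤ _ := ENNReal.rpow_le_rpow h2 hp0.le
      _ = A ^ (p - 1) * ∫⁻ ω, ‖h ω x‖ₑ ^ p * (α ω) ^ (1 - p) ∂μ := by
        rw [ENNReal.mul_rpow_of_nonneg _ _ hp0.le, ← ENNReal.rpow_mul, ← ENNReal.rpow_mul,
          one_div_mul_cancel hp0.ne', ENNReal.rpow_one, mul_comm]
        congr 1
        · rw [show 1 / q * p = p - 1 by rw [← hpq']; ring]
          congr 1
          refine lintegral_congr fun ω => ?_
          rw [← ENNReal.rpow_mul, one_div_mul_cancel hq0.ne', ENNReal.rpow_one]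
        · refine lintegral_congr fun ω => ?_
          rw [ENNReal.mul_rpow_of_nonneg _ _ hp0.le, ← ENNReal.rpow_mul]
          congr 2
          rw [show -(1 / q) * p = -(p / q) by ring, hpq']; ring
  rw [e0]
  have h3 : ∫⁻ x, ‖∫ ω, h ω x ∂μ‖ₑ ^ p ∂ν ≤ (A * K) ^ p := by
    calc _ ≤ ∫⁻ x, A ^ (p - 1) * ∫⁻ ω, ‖h ω x‖ₑ ^ p * (α ω) ^ (1 - p) ∂μ ∂ν := lintegral_mono key
      _ = A ^ (p - 1) * ∫⁻ x, ∫⁻ ω, ‖h ω x‖ₑ ^ p * (α ω) ^ (1 - p) ∂μ ∂ν := by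
        refine lintegral_const_mul _ ?_
        exact Measurable.lintegral_prod_right'
          (f := fun z : X × Ω => ‖h z.2 z.1‖ₑ ^ p * (α z.2) ^ (1 - p))
          ((hhe.pow_const _).mul ((hα.comp measurable_snd).pow_const _))
      _ = A ^ (p - 1) * ∫⁻ ω, ∫⁻ x, ‖h ω x‖ₑ ^ p * (α ω) ^ (1 - p) ∂ν ∂μ := by
        congr 1
        refine lintegral_lintegral_swap ?_
        exact ((hhe.pow_const _).mul ((hα.comp measurable_snd).pow_const _)).aemeasurable
      _ ≤ A ^ (p - 1) * ∫⁻ ω, α ω * K ^ p ∂μ := by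
        gcongr 1
        refine lintegral_mono_ae ?_
        filter_upwards [hα0, hαt, hK] with ω h0 ht hk
        have hm : Measurable (fun x => ‖h ω x‖ₑ ^ p) :=
          (hh.comp measurable_prodMk_left).enorm.pow_const _
        rw [lintegral_mul_const _ hm]
        have : ∫⁻ x, ‖h ω x‖ₑ ^ p ∂ν ≤ (α ω * K) ^ p := by
          rw [e0] at hk
          have := ENNReal.rpow_le_rpow hk hp0.le
          rwa [← ENNReal.rpow_mul, one_div_mul_cancel hp0.ne', ENNReal.rpow_one] at this
        calc _ ≤ (α ω * K) ^ p * α ω ^ (1 - p) := by gcongr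
          _ = α ω ^ p * α ω ^ (1 - p) * K ^ p := by
            rw [ENNReal.mul_rpow_of_nonneg _ _ hp0.le]; ring
          _ = _ := by rw [← ENNReal.rpow_add _ _ h0 ht.ne]; simp
      _ = (A * K) ^ p := by
        rw [lintegral_mul_const _ hα, ENNReal.mul_rpow_of_nonneg _ _ hp0.le, ← mul_assoc]
        congr 1
        have : A ^ (p - 1) * A ^ (1 : ℝ) = A ^ p := by
          rw [← ENNReal.rpow_add_of_nonneg _ _ (by linarith) (by norm_num)]; simp
        simpa using this
  calc _ ≤ ((A * K) ^ p) ^ (1 / p) := ENNReal.rpow_le_rpow h3 (by positivity)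
    _ = A * K := by
      rw [← ENNReal.rpow_mul, mul_one_div_cancel hp0.ne', ENNReal.rpow_one]

/-! ### Plane waves and band-limited functions -/

section BandLimited

variable {V : Type*} [NormedAddCommGroup V]

variable [MeasurableSpace V]

/-- Bounded measurable functions with bounded support. -/
structure BandLimited (φ : V → ℂ) : Prop where
  meas : Measurable φ
  bdd : ∃ C, ∀ ξ, ‖φ ξ‖ ≤ C
  supp : ∃ R, ∀ ξ, R < ‖ξ‖ → φ ξ = 0

/-- `m` is bounded on bounded sets. -/
def LocBdd (m : V → ℂ) : Prop := ∀ R : ℝ, ∃ B : ℝ, ∀ ξ, ‖ξ‖ ≤ R → ‖m ξ‖ ≤ B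

/-- `σ` is bounded on bounded sets. -/
def LocBdd₂ (σ : V → V → ℂ) : Prop :=
  ∀ R : ℝ, ∃ B : ℝ, ∀ ξ η, ‖ξ‖ ≤ R → ‖η‖ ≤ R → ‖σ ξ η‖ ≤ B

theorem BandLimited.mul {φ m : V → ℂ} (hφ : BandLimited φ) (hm : Measurable m) (hb : LocBdd m) :
    BandLimited fun ξ => m ξ * φ ξ := by
  obtain ⟨C, hC⟩ := hφ.bdd
  obtain ⟨R, hR⟩ := hφ.supp
  obtain ⟨B, hB⟩ := hb R
  refine ⟨hm.mul hφ.meas, ⟨|B| * |C|, fun ξ => ?_⟩, R, fun ξ h => by simp [hR ξ h]⟩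
  rcases le_or_gt ‖ξ‖ R with h | h
  · rw [norm_mul]
    exact mul_le_mul ((hB ξ h).trans (le_abs_self _)) ((hC ξ).trans (le_abs_self _))
      (norm_nonneg _) (abs_nonneg _)
  · simp [hR ξ h]; positivity

end BandLimited

section PlaneWave

variable {V : Type*} [NormedAddCommGroup V] [InnerProductSpace ℝ V]

/-- The character `e^{2πi⟨x,ξ⟩}`. -/
noncomputable def planeWave (x ξ : V) : ℂ :=
  Complex.exp (((2 * Real.pi * ⟪x, ξ⟫) : ℝ) * Complex.I)

theorem norm_planeWave (x ξ : V) : ‖planeWave x ξ‖ = 1 :=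
  Complex.norm_exp_ofReal_mul_I _

theorem norm_one_sub_planeWave_le (y ξ : V) : ‖1 - planeWave y ξ‖ ≤ 2 := by
  refine (norm_sub_le _ _).trans ?_
  rw [norm_planeWave, norm_one]; norm_num

theorem planeWave_add_left (x y ξ : V) :
    planeWave (x + y) ξ = planeWave x ξ * planeWave y ξ := by
  rw [planeWave, planeWave, planeWave, ← Complex.exp_add, inner_add_left]
  push_cast; ring_nf

theorem planeWave_add_right (x ξ η : V) :
    planeWave x (ξ + η) = planeWave x ξ * planeWave x η := by
  rw [planeWave, planeWave, planeWave, ← Complex.exp_add, inner_add_right]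
  push_cast; ring_nf

@[fun_prop]
theorem Continuous.planeWave {X : Type*} [TopologicalSpace X] {f g : X → V} (hf : Continuous f)
    (hg : Continuous g) : Continuous fun x => planeWave (f x) (g x) := by
  unfold _root_.planeWave; fun_prop

end PlaneWave

section Multipliers

variable {V : Type*} [NormedAddCommGroup V] [InnerProductSpace ℝ V] [FiniteDimensional ℝ V]
  [MeasurableSpace V] [BorelSpace V]

@[fun_prop]
theorem Measurable.planeWave {X : Type*} [MeasurableSpace X] {f g : X → V} (hf : Measurable f)
    (hg : Measurable g) : Measurable fun x => planeWave (f x) (g x) := by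
  have : Continuous fun z : V × V => _root_.planeWave z.1 z.2 := by fun_prop
  exact this.measurable.comp (hf.prodMk hg)

theorem BandLimited.integrable {φ : V → ℂ} (hφ : BandLimited φ) : Integrable φ := by
  obtain ⟨C, hC⟩ := hφ.bdd
  obtain ⟨R, hR⟩ := hφ.supp
  have : IntegrableOn φ (Metric.closedBall 0 R) :=
    IntegrableOn.of_bound measure_closedBall_lt_top hφ.meas.aestronglyMeasurable C
      (Filter.Eventually.of_forall hC)
  refine (integrableOn_iff_integrable_of_support_subset ?_).1 this
  intro ξ hξ
  by_contra h
  exact hξ (hR ξ (by simpa using h))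

/-- The inverse Fourier integral of `φ`. -/
noncomputable def synth (φ : V → ℂ) (x : V) : ℂ :=
  ∫ ξ, planeWave x ξ * φ ξ

/-- The bilinear Fourier multiplier operator with symbol `σ`, acting on frequency profiles. -/
noncomputable def bisynth (σ : V → V → ℂ) (φ ψ : V → ℂ) (x : V) : ℂ :=
  ∫ z : V × V, planeWave x (z.1 + z.2) * (σ z.1 z.2 * (φ z.1 * ψ z.2))

theorem integrable_bisynth {σ : V → V → ℂ} (hσ : Measurable (Function.uncurry σ))
    (hb : LocBdd₂ σ) {φ ψ : V → ℂ} (hφ : BandLimited φ) (hψ : BandLimited ψ) (x : V) :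
    Integrable fun z : V × V => planeWave x (z.1 + z.2) * (σ z.1 z.2 * (φ z.1 * ψ z.2)) := by
  obtain ⟨R₁, hR₁⟩ := hφ.supp
  obtain ⟨R₂, hR₂⟩ := hψ.supp
  obtain ⟨B, hB⟩ := hb (max R₁ R₂)
  have hm := hφ.meas
  have hm' := hψ.meas
  have hs : Measurable fun z : V × V => σ z.1 z.2 := hσ
  have hi : Integrable fun z : V × V => φ z.1 * ψ z.2 := hφ.integrable.mul_prod hψ.integrable
  refine (hi.norm.const_mul B).mono' (by fun_prop) (Filter.Eventually.of_forall fun z => ?_)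
  rw [norm_mul, norm_planeWave, one_mul, norm_mul]
  rcases le_or_gt ‖z.1‖ R₁ with h | h
  · rcases le_or_gt ‖z.2‖ R₂ with h' | h'
    · gcongr; exact hB _ _ (h.trans (le_max_left _ _)) (h'.trans (le_max_right _ _))
    · simp [hR₂ _ h']
  · simp [hR₁ _ h]

theorem integrable_synth {φ : V → ℂ} (hφ : Integrable φ) (x : V) :
    Integrable fun ξ => planeWave x ξ * φ ξ := by
  refine hφ.mono ?_ (Filter.Eventually.of_forall fun ξ => by simp [norm_planeWave])
  exact (show Measurable fun ξ : V => planeWave x ξ by fun_prop).aestronglyMeasurable.mul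
    hφ.aestronglyMeasurable

theorem measurable_synth {φ : V → ℂ} (hφ : Measurable φ) : Measurable (synth φ) := by
  refine (StronglyMeasurable.integral_prod_right
    (f := fun x ξ : V => planeWave x ξ * φ ξ) ?_).measurable
  exact Measurable.stronglyMeasurable (by unfold Function.uncurry; fun_prop)

theorem measurable_bisynth {σ : V → V → ℂ} (hσ : Measurable (Function.uncurry σ)) {φ ψ : V → ℂ}
    (hφ : Measurable φ) (hψ : Measurable ψ) : Measurable (bisynth σ φ ψ) := by
  have hs : Measurable fun z : V × V × V => σ z.2.1 z.2.2 := hσ.comp measurable_snd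
  refine (StronglyMeasurable.integral_prod_right
    (f := fun (x : V) (z : V × V) =>
      planeWave x (z.1 + z.2) * (σ z.1 z.2 * (φ z.1 * ψ z.2))) ?_).measurable
  exact Measurable.stronglyMeasurable (by unfold Function.uncurry; fun_prop)

/-- The frequency profile of a bilinear multiplier operator. -/
theorem bisynth_eq_synth {σ : V → V → ℂ} (hσ : Measurable (Function.uncurry σ))
    (hσb : LocBdd₂ σ) {φ ψ m : V → ℂ} (hφ : BandLimited φ) (hψ : BandLimited ψ)
    (hm : Measurable m) (hb : LocBdd m) :
    bisynth (fun ξ η => m (ξ + η) * σ ξ η) φ ψ =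
      synth fun ζ => m ζ * ∫ ξ, σ ξ (ζ - ξ) * (φ ξ * ψ (ζ - ξ)) := by
  have hbi := integrable_bisynth (σ := fun ξ η => m (ξ + η) * σ ξ η)
    ((by fun_prop : Measurable fun z : V × V => m (z.1 + z.2)).mul hσ) (by
      intro R
      obtain ⟨a, ha⟩ := hσb R
      obtain ⟨b, hb⟩ := hb (R + R)
      refine ⟨b * a, fun ξ η hξ hη => ?_⟩
      have := hb (ξ + η) ((norm_add_le _ _).trans (add_le_add hξ hη))
      rw [norm_mul]
      exact mul_le_mul this (ha ξ η hξ hη) (norm_nonneg _) ((norm_nonneg _).trans this)) hφ hψ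
  ext x
  have hbx := hbi x
  let G : V × V → ℂ := fun z =>
    planeWave x z.2 * (m z.2 * σ z.1 (z.2 - z.1) * (φ z.1 * ψ (z.2 - z.1)))
  have hmp : MeasurePreserving (MeasurableEquiv.shearAddRight V)
      ((volume : Measure V).prod volume) (volume.prod volume) :=
    measurePreserving_prod_add volume volume
  have hG : ∀ z : V × V, planeWave x (z.1 + z.2) * (m (z.1 + z.2) * σ z.1 z.2 * (φ z.1 * ψ z.2)) =
      G (MeasurableEquiv.shearAddRight V z) := fun z => by
    simp [G, MeasurableEquiv.shearAddRight]
  have hGi : Integrable G ((volume : Measure V).prod volume) := by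
    rw [← hmp.integrable_comp_emb (MeasurableEquiv.measurableEmbedding _)]
    exact hbx.congr (Filter.Eventually.of_forall hG)
  rw [bisynth, integral_congr_ae (Filter.Eventually.of_forall hG), Measure.volume_eq_prod,
    hmp.integral_comp' G, integral_prod_symm _ hGi, synth]
  congr 1; ext ζ
  rw [← integral_const_mul, ← integral_const_mul]
  congr 1; ext ξ
  simp only [G]; ring

theorem bandLimited_profile {σ : V → V → ℂ} (hσ : Measurable (Function.uncurry σ))
    (hσb : LocBdd₂ σ) {φ ψ : V → ℂ} (hφ : BandLimited φ) (hψ : BandLimited ψ) :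
    BandLimited fun ζ => ∫ ξ, σ ξ (ζ - ξ) * (φ ξ * ψ (ζ - ξ)) := by
  obtain ⟨R₁, hR₁⟩ := hφ.supp
  obtain ⟨R₂, hR₂⟩ := hψ.supp
  obtain ⟨a, ha⟩ := hσb (max R₁ R₂)
  obtain ⟨c, hc⟩ := hψ.bdd
  refine ⟨?_, ⟨∫ ξ, |a| * (‖φ ξ‖ * |c|), fun ζ => norm_integral_le_of_norm_le ?_
    (Filter.Eventually.of_forall fun ξ => ?_)⟩, R₁ + R₂, fun ζ hζ => ?_⟩
  · have hm := hφ.meas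
    have hm' := hψ.meas
    have hs : Measurable fun z : V × V => σ z.2 (z.1 - z.2) :=
      hσ.comp (measurable_snd.prodMk (measurable_fst.sub measurable_snd))
    refine (StronglyMeasurable.integral_prod_right
      (f := fun ζ ξ : V => σ ξ (ζ - ξ) * (φ ξ * ψ (ζ - ξ))) ?_).measurable
    exact (hs.mul (by fun_prop : Measurable fun z : V × V =>
      φ z.2 * ψ (z.1 - z.2))).stronglyMeasurable
  · exact (hφ.integrable.norm.mul_const _).const_mul _
  · rw [norm_mul, norm_mul]
    rcases le_or_gt ‖ξ‖ R₁ with h1 | h1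
    · rcases le_or_gt ‖ζ - ξ‖ R₂ with h2 | h2
      · gcongr
        · exact (ha _ _ (h1.trans (le_max_left _ _)) (h2.trans (le_max_right _ _))).trans
            (le_abs_self _)
        · exact (hc _).trans (le_abs_self _)
      · simp only [hR₂ _ h2, norm_zero, mul_zero]; positivity
    · simp [hR₁ _ h1]
  · refine (integral_congr_ae (Filter.Eventually.of_forall fun ξ => ?_)).trans
      (integral_zero _ _)
    rcases le_or_gt ‖ξ‖ R₁ with h1 | h1
    · have : R₂ < ‖ζ - ξ‖ := by
        have := norm_sub_norm_le ζ ξ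
        linarith
      simp [hR₂ _ this]
    · simp [hR₁ _ h1]

/-- `m` is a Fourier multiplier of `L^p` (tested on band-limited functions) of norm at most `A`. -/
structure LpMultiplier (p : ℝ) (A : ℝ≥0∞) (m : V → ℂ) : Prop where
  meas : Measurable m
  bdd : LocBdd m
  bound : ∀ φ, BandLimited φ → eLpNorm (synth fun ξ => m ξ * φ ξ) (ENNReal.ofReal p) volume ≤
    A * eLpNorm (synth φ) (ENNReal.ofReal p) volume

/-- `σ` is a bilinear Fourier multiplier `L^p × L^p → L^p` (tested on band-limited functions) of
norm at most `A`. -/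
structure BilinMultiplier (p : ℝ) (A : ℝ≥0∞) (σ : V → V → ℂ) : Prop where
  meas : Measurable (Function.uncurry σ)
  bdd : LocBdd₂ σ
  bound : ∀ φ ψ, BandLimited φ → BandLimited ψ →
    eLpNorm (bisynth σ φ ψ) (ENNReal.ofReal p) volume ≤
    A * (eLpNorm (synth φ) (ENNReal.ofReal p) volume * eLpNorm (synth ψ) (ENNReal.ofReal p) volume)

theorem eLpNorm_parametric_integral_le {Z Ω : Type*} [MeasurableSpace Z] [MeasurableSpace Ω]
    {ζ : Measure Z} [SFinite ζ] {μ : Measure Ω} [SFinite μ] {p : ℝ} (hp : 1 < p)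
    {e : V → Z → ℂ} (he : Measurable (Function.uncurry e)) (he1 : ∀ x z, ‖e x z‖ = 1)
    {Φ : Ω → Z → ℂ} (hΦ : Measurable (Function.uncurry Φ)) {g : Ω → ℝ} (hg : Integrable g μ)
    {b : Z → ℝ} (hb : Integrable b ζ) (hgb : ∀ᵐ ω ∂μ, ∀ z, ‖Φ ω z‖ ≤ g ω * b z)
    {α : Ω → ℝ≥0∞} (hα : Measurable α)
    (hα0 : ∀ᵐ ω ∂μ, α ω ≠ 0) (hαi : ∫⁻ ω, α ω ∂μ ≠ ⊤) {K : ℝ≥0∞}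
    (hK : ∀ᵐ ω ∂μ, eLpNorm (fun x => ∫ z, e x z * Φ ω z ∂ζ) (ENNReal.ofReal p) volume ≤ α ω * K) :
    eLpNorm (fun x => ∫ z, e x z * ∫ ω, Φ ω z ∂μ ∂ζ) (ENNReal.ofReal p) volume ≤
      (∫⁻ ω, α ω ∂μ) * K := by
  have hsw : ∀ x, ∫ z, e x z * ∫ ω, Φ ω z ∂μ ∂ζ = ∫ ω, ∫ z, e x z * Φ ω z ∂ζ ∂μ := by
    intro x
    simp_rw [← integral_const_mul]
    symm
    apply integral_integral_swap
    refine (hg.mul_prod hb).mono' ?_ ?_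
    · exact ((he.comp (by fun_prop : Measurable fun z : Ω × Z => (x, z.2))).mul
        hΦ).aestronglyMeasurable
    · filter_upwards [(Measure.quasiMeasurePreserving_fst (μ := μ) (ν := ζ)).ae hgb] with z h
      simpa [he1, Function.uncurry] using h z.2
  simp_rw [hsw]
  refine eLpNorm_integral_le_of_forall_le hp ?_ hα hα0 hαi hK
  refine (StronglyMeasurable.integral_prod_right
    (f := fun (y : Ω × V) (z : Z) => e y.2 z * Φ y.1 z) ?_).measurable
  refine Measurable.stronglyMeasurable ?_
  exact (he.comp (by fun_prop : Measurable fun z : (Ω × V) × Z => (z.1.2, z.2))).mul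
    (hΦ.comp (by fun_prop : Measurable fun z : (Ω × V) × Z => (z.1.1, z.2)))

namespace LpMultiplier

variable {p : ℝ} {A B : ℝ≥0∞} {m n : V → ℂ}

theorem mono (h : LpMultiplier p A m) (hAB : A ≤ B) : LpMultiplier p B m :=
  ⟨h.meas, h.bdd, fun φ hφ => (h.bound φ hφ).trans (by gcongr)⟩

theorem mul (h : LpMultiplier p A m) (h' : LpMultiplier p B n) :
    LpMultiplier p (A * B) (fun ξ => m ξ * n ξ) where
  meas := h.meas.mul h'.meas
  bdd R := by
    obtain ⟨a, ha⟩ := h.bdd R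
    obtain ⟨b, hb⟩ := h'.bdd R
    refine ⟨a * b, fun ξ hξ => ?_⟩
    rw [norm_mul]
    exact mul_le_mul (ha ξ hξ) (hb ξ hξ) (norm_nonneg _) ((norm_nonneg _).trans (ha ξ hξ))
  bound φ hφ := by
    have := h.bound _ (hφ.mul h'.meas h'.bdd)
    simp_rw [← mul_assoc] at this
    refine this.trans ?_
    rw [mul_assoc]
    gcongr
    exact h'.bound φ hφ

theorem add (hp : 1 < p) (h : LpMultiplier p A m) (h' : LpMultiplier p B n) :
    LpMultiplier p (A + B) (fun ξ => m ξ + n ξ) where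
  meas := h.meas.add h'.meas
  bdd R := by
    obtain ⟨a, ha⟩ := h.bdd R
    obtain ⟨b, hb⟩ := h'.bdd R
    exact ⟨a + b, fun ξ hξ => (norm_add_le _ _).trans (add_le_add (ha ξ hξ) (hb ξ hξ))⟩
  bound φ hφ := by
    have e : synth (fun ξ => (m ξ + n ξ) * φ ξ) =
        synth (fun ξ => m ξ * φ ξ) + synth (fun ξ => n ξ * φ ξ) := by
      ext x
      simp only [synth, Pi.add_apply, add_mul, mul_add]
      exact integral_add (integrable_synth (hφ.mul h.meas h.bdd).integrable x)
        (integrable_synth (hφ.mul h'.meas h'.bdd).integrable x)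
    have hp1 : 1 ≤ ENNReal.ofReal p := by simpa using hp.le
    rw [e, add_mul]
    refine (eLpNorm_add_le (measurable_synth (h.meas.mul hφ.meas)).aestronglyMeasurable
      (measurable_synth (h'.meas.mul hφ.meas)).aestronglyMeasurable hp1).trans ?_
    gcongr
    · exact h.bound φ hφ
    · exact h'.bound φ hφ

theorem const_mul (c : ℂ) (h : LpMultiplier p A m) :
    LpMultiplier p (‖c‖ₑ * A) (fun ξ => c * m ξ) where
  meas := h.meas.const_mul c
  bdd R := by
    obtain ⟨a, ha⟩ := h.bdd R
    exact ⟨‖c‖ * a, fun ξ hξ => by rw [norm_mul]; gcongr; exact ha ξ hξ⟩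
  bound φ hφ := by
    have e : synth (fun ξ => c * m ξ * φ ξ) = c • synth (fun ξ => m ξ * φ ξ) := by
      ext x
      simp only [synth, Pi.smul_apply, smul_eq_mul, ← integral_const_mul]
      congr 1; ext ξ; ring
    rw [e, eLpNorm_const_smul, mul_assoc]
    gcongr
    exact h.bound φ hφ

theorem planeWave (p : ℝ) (y : V) : LpMultiplier p 1 (fun ξ => planeWave y ξ) where
  meas := by fun_prop
  bdd R := ⟨1, fun ξ _ => (norm_planeWave _ _).le⟩
  bound φ hφ := by
    have e : synth (fun ξ => _root_.planeWave y ξ * φ ξ) = synth φ ∘ (· + y) := by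
      ext x
      simp only [synth, Function.comp, planeWave_add_left, mul_assoc]
    rw [e, one_mul, eLpNorm_comp_measurePreserving
      (measurable_synth hφ.meas).aestronglyMeasurable (measurePreserving_add_right _ _)]

theorem one (p : ℝ) : LpMultiplier p 1 (fun _ : V => 1) := by
  simpa [_root_.planeWave] using planeWave p (0 : V)

theorem integral (hp : 1 < p) {Ω : Type*} [MeasurableSpace Ω] {μ : Measure Ω} [SFinite μ]
    {m : Ω → V → ℂ} (hm : Measurable (Function.uncurry m)) {g : Ω → ℝ} (hg : Integrable g μ)
    (hmg : ∀ᵐ ω ∂μ, ∀ ξ, ‖m ω ξ‖ ≤ g ω) {α : Ω → ℝ≥0∞} (hα : Measurable α)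
    (hα0 : ∀ᵐ ω ∂μ, α ω ≠ 0) (hαi : ∫⁻ ω, α ω ∂μ ≠ ⊤)
    (h : ∀ᵐ ω ∂μ, LpMultiplier p (α ω) (m ω)) :
    LpMultiplier p (∫⁻ ω, α ω ∂μ) (fun ξ => ∫ ω, m ω ξ ∂μ) where
  meas := by
    refine (StronglyMeasurable.integral_prod_right (f := fun (ξ : V) (ω : Ω) => m ω ξ) ?_).measurable
    exact (hm.comp measurable_swap).stronglyMeasurable
  bdd R := by
    refine ⟨∫ ω, g ω ∂μ, fun ξ _ => norm_integral_le_of_norm_le hg ?_⟩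
    filter_upwards [hmg] with ω h using h ξ
  bound φ hφ := by
    have := eLpNorm_parametric_integral_le (V := V) (ζ := (volume : Measure V)) hp
      (e := fun x ξ => _root_.planeWave x ξ) (by unfold Function.uncurry; fun_prop) norm_planeWave
      (Φ := fun ω ξ => m ω ξ * φ ξ) (hm.mul (hφ.meas.comp measurable_snd)) hg
      hφ.integrable.norm (K := eLpNorm (synth φ) (ENNReal.ofReal p) volume) ?_ hα hα0 hαi ?_
    · simp only [integral_mul_const] at this
      exact this
    · filter_upwards [hmg] with ω h ξ
      rw [norm_mul]; gcongr; exact h ξ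
    · filter_upwards [h] with ω h using h.bound φ hφ

end LpMultiplier

namespace BilinMultiplier

variable {p : ℝ} {A B : ℝ≥0∞} {σ τ : V → V → ℂ} {m : V → ℂ}

theorem mono (h : BilinMultiplier p A σ) (hAB : A ≤ B) : BilinMultiplier p B σ :=
  ⟨h.meas, h.bdd, fun φ ψ hφ hψ => (h.bound φ ψ hφ hψ).trans (by gcongr)⟩

theorem swap (h : BilinMultiplier p A σ) : BilinMultiplier p A (fun ξ η => σ η ξ) where
  meas := h.meas.comp measurable_swap
  bdd R := by
    obtain ⟨B, hB⟩ := h.bdd R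
    exact ⟨B, fun ξ η h1 h2 => hB η ξ h2 h1⟩
  bound φ ψ hφ hψ := by
    have e : bisynth (fun ξ η => σ η ξ) φ ψ = bisynth σ ψ φ := by
      ext x
      rw [bisynth, bisynth, Measure.volume_eq_prod, ← integral_prod_swap]
      refine integral_congr_ae (Filter.Eventually.of_forall fun z => ?_)
      simp only [Prod.fst_swap, Prod.snd_swap]
      rw [add_comm, mul_comm (φ _)]
    rw [e, mul_comm (eLpNorm _ _ _)]
    exact h.bound ψ φ hψ hφ

theorem mul_left (h : BilinMultiplier p A σ) (h' : LpMultiplier p B m) :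
    BilinMultiplier p (B * A) (fun ξ η => m ξ * σ ξ η) where
  meas := (h'.meas.comp measurable_fst).mul h.meas
  bdd R := by
    obtain ⟨a, ha⟩ := h.bdd R
    obtain ⟨b, hb⟩ := h'.bdd R
    refine ⟨b * a, fun ξ η hξ hη => ?_⟩
    rw [norm_mul]
    exact mul_le_mul (hb ξ hξ) (ha ξ η hξ hη) (norm_nonneg _) ((norm_nonneg _).trans (hb ξ hξ))
  bound φ ψ hφ hψ := by
    have e : bisynth (fun ξ η => m ξ * σ ξ η) φ ψ = bisynth σ (fun ξ => m ξ * φ ξ) ψ := by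
      ext x
      rw [bisynth, bisynth]
      congr 1; ext z; ring
    rw [e]
    refine (h.bound _ ψ (hφ.mul h'.meas h'.bdd) hψ).trans ?_
    rw [mul_comm B A, mul_assoc, ← mul_assoc B]
    gcongr
    exact h'.bound φ hφ

theorem mul_right (h : BilinMultiplier p A σ) (h' : LpMultiplier p B m) :
    BilinMultiplier p (B * A) (fun ξ η => m η * σ ξ η) :=
  (h.swap.mul_left h').swap

theorem add (hp : 1 < p) (h : BilinMultiplier p A σ) (h' : BilinMultiplier p B τ) :
    BilinMultiplier p (A + B) (fun ξ η => σ ξ η + τ ξ η) where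
  meas := h.meas.add h'.meas
  bdd R := by
    obtain ⟨a, ha⟩ := h.bdd R
    obtain ⟨b, hb⟩ := h'.bdd R
    exact ⟨a + b, fun ξ η hξ hη =>
      (norm_add_le _ _).trans (add_le_add (ha ξ η hξ hη) (hb ξ η hξ hη))⟩
  bound φ ψ hφ hψ := by
    have e : bisynth (fun ξ η => σ ξ η + τ ξ η) φ ψ = bisynth σ φ ψ + bisynth τ φ ψ := by
      ext x
      simp only [bisynth, Pi.add_apply, add_mul, mul_add]
      exact integral_add (integrable_bisynth h.meas h.bdd hφ hψ x)
        (integrable_bisynth h'.meas h'.bdd hφ hψ x)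
    have hp1 : 1 ≤ ENNReal.ofReal p := by simpa using hp.le
    rw [e, add_mul]
    refine (eLpNorm_add_le (measurable_bisynth h.meas hφ.meas hψ.meas).aestronglyMeasurable
      (measurable_bisynth h'.meas hφ.meas hψ.meas).aestronglyMeasurable hp1).trans ?_
    gcongr
    · exact h.bound φ ψ hφ hψ
    · exact h'.bound φ ψ hφ hψ

theorem const_mul (c : ℂ) (h : BilinMultiplier p A σ) :
    BilinMultiplier p (‖c‖ₑ * A) (fun ξ η => c * σ ξ η) where
  meas := h.meas.const_mul c
  bdd R := by
    obtain ⟨a, ha⟩ := h.bdd R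
    exact ⟨‖c‖ * a, fun ξ η hξ hη => by rw [norm_mul]; gcongr; exact ha ξ η hξ hη⟩
  bound φ ψ hφ hψ := by
    have e : bisynth (fun ξ η => c * σ ξ η) φ ψ = c • bisynth σ φ ψ := by
      ext x
      simp only [bisynth, Pi.smul_apply, smul_eq_mul, ← integral_const_mul]
      congr 1; ext ξ; ring
    rw [e, eLpNorm_const_smul, mul_assoc]
    gcongr
    exact h.bound φ ψ hφ hψ

theorem integral (hp : 1 < p) {Ω : Type*} [MeasurableSpace Ω] {μ : Measure Ω} [SFinite μ]
    {σ : Ω → V → V → ℂ} (hσ : Measurable fun z : Ω × V × V => σ z.1 z.2.1 z.2.2)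
    (hσg : ∀ R : ℝ, ∃ g : Ω → ℝ, Integrable g μ ∧
      ∀ᵐ ω ∂μ, ∀ ξ η, ‖ξ‖ ≤ R → ‖η‖ ≤ R → ‖σ ω ξ η‖ ≤ g ω)
    {α : Ω → ℝ≥0∞} (hα : Measurable α)
    (hα0 : ∀ᵐ ω ∂μ, α ω ≠ 0) (hαi : ∫⁻ ω, α ω ∂μ ≠ ⊤)
    (h : ∀ᵐ ω ∂μ, BilinMultiplier p (α ω) (σ ω)) :
    BilinMultiplier p (∫⁻ ω, α ω ∂μ) (fun ξ η => ∫ ω, σ ω ξ η ∂μ) where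
  meas := by
    refine (StronglyMeasurable.integral_prod_right
      (f := fun (z : V × V) (ω : Ω) => σ ω z.1 z.2) ?_).measurable
    exact (hσ.comp measurable_swap).stronglyMeasurable
  bdd R := by
    obtain ⟨g, hg, hb⟩ := hσg R
    refine ⟨∫ ω, g ω ∂μ, fun ξ η h1 h2 => norm_integral_le_of_norm_le hg ?_⟩
    filter_upwards [hb] with ω h using h ξ η h1 h2
  bound φ ψ hφ hψ := by
    obtain ⟨R₁, hR₁⟩ := hφ.supp
    obtain ⟨R₂, hR₂⟩ := hψ.supp
    obtain ⟨g, hg, hb⟩ := hσg (max R₁ R₂)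
    have hm := hφ.meas
    have hm' := hψ.meas
    have := eLpNorm_parametric_integral_le (V := V) (ζ := (volume : Measure (V × V))) hp
      (e := fun x z => planeWave x (z.1 + z.2)) (by unfold Function.uncurry; fun_prop)
      (fun _ _ => norm_planeWave _ _)
      (Φ := fun ω z => σ ω z.1 z.2 * (φ z.1 * ψ z.2))
      (hσ.mul (by fun_prop : Measurable fun z : Ω × V × V => φ z.2.1 * ψ z.2.2)) hg
      (hφ.integrable.mul_prod hψ.integrable).norm
      (K := eLpNorm (synth φ) (ENNReal.ofReal p) volume *
        eLpNorm (synth ψ) (ENNReal.ofReal p) volume) ?_ hα hα0 hαi ?_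
    · simp only [integral_mul_const] at this
      exact this
    · filter_upwards [hb] with ω h z
      rw [norm_mul]
      rcases le_or_gt ‖z.1‖ R₁ with h1 | h1
      · rcases le_or_gt ‖z.2‖ R₂ with h2 | h2
        · gcongr; exact h _ _ (h1.trans (le_max_left _ _)) (h2.trans (le_max_right _ _))
        · simp [hR₂ _ h2]
      · simp [hR₁ _ h1]
    · filter_upwards [h] with ω h using h.bound φ ψ hφ hψ

theorem mul_outer (h : BilinMultiplier p A σ) (h' : LpMultiplier p B m) :
    BilinMultiplier p (B * A) (fun ξ η => m (ξ + η) * σ ξ η) where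
  meas := (h'.meas.comp (measurable_fst.add measurable_snd)).mul h.meas
  bdd R := by
    obtain ⟨a, ha⟩ := h.bdd R
    obtain ⟨b, hb⟩ := h'.bdd (R + R)
    refine ⟨b * a, fun ξ η hξ hη => ?_⟩
    have := hb (ξ + η) ((norm_add_le _ _).trans (add_le_add hξ hη))
    rw [norm_mul]
    exact mul_le_mul this (ha ξ η hξ hη) (norm_nonneg _) ((norm_nonneg _).trans this)
  bound φ ψ hφ hψ := by
    have e1 := bisynth_eq_synth h.meas h.bdd hφ hψ (m := m) h'.meas h'.bdd
    have e2 := bisynth_eq_synth h.meas h.bdd hφ hψ (m := fun _ => 1) measurable_const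
      (LpMultiplier.one p).bdd
    simp only [one_mul] at e2
    have hbl := bandLimited_profile h.meas h.bdd hφ hψ
    rw [e1]
    refine (h'.bound _ hbl).trans ?_
    rw [← e2, mul_assoc]
    gcongr
    exact h.bound φ ψ hφ hψ

end BilinMultiplier

end Multipliers

/-! ### Subordination -/

theorem integrable_and_integral_exp_neg_sq_sub_div {c : ℝ} (hc : 0 < c) :
    IntegrableOn (fun v : ℝ => Real.exp (-(v - c / v) ^ 2)) (Set.Ioi 0) ∧
      ∫ v in Set.Ioi (0 : ℝ), Real.exp (-(v - c / v) ^ 2) = √Real.pi / 2 := by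
  set g : ℝ → ℝ := fun v => Real.exp (-(v - c / v) ^ 2) with hg
  have hder : ∀ x ∈ Set.Ioi (0 : ℝ), HasDerivWithinAt (fun v : ℝ => v - c / v) (1 + c / x ^ 2)
      (Set.Ioi 0) x := fun x hx => by
    have hx' : x ≠ 0 := (Set.mem_Ioi.1 hx).ne'
    have := ((hasDerivAt_id x).sub ((hasDerivAt_inv hx').const_mul c)).hasDerivWithinAt
      (s := Set.Ioi 0)
    refine this.congr_deriv ?_
    ring
  have hinj : Set.InjOn (fun v : ℝ => v - c / v) (Set.Ioi 0) := by
    refine StrictMonoOn.injOn fun x hx y hy hxy => ?_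
    have : c / y < c / x := div_lt_div_of_pos_left hc hx hxy
    linarith
  have himg : (fun v : ℝ => v - c / v) '' Set.Ioi 0 = Set.univ := by
    refine Set.eq_univ_of_forall fun w => ?_
    have hs : |w| < √(w ^ 2 + 4 * c) := by
      rw [← Real.sqrt_sq_eq_abs]; exact Real.sqrt_lt_sqrt (sq_nonneg _) (by linarith)
    have hs2 : √(w ^ 2 + 4 * c) ^ 2 = w ^ 2 + 4 * c := Real.sq_sqrt (by positivity)
    have hpos : 0 < w + √(w ^ 2 + 4 * c) := by linarith [neg_abs_le w]
    refine ⟨(w + √(w ^ 2 + 4 * c)) / 2, by simpa using hpos, ?_⟩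
    simp only
    field_simp
    nlinarith
  have hder2 : ∀ x ∈ Set.Ioi (0 : ℝ), HasDerivWithinAt (fun v : ℝ => c / v) (-(c / x ^ 2))
      (Set.Ioi 0) x := fun x hx => by
    have hx' : x ≠ 0 := (Set.mem_Ioi.1 hx).ne'
    have := ((hasDerivAt_inv hx').const_mul c).hasDerivWithinAt (s := Set.Ioi 0)
    refine this.congr_deriv ?_
    ring
  have hinj2 : Set.InjOn (fun v : ℝ => c / v) (Set.Ioi 0) := by
    refine StrictAntiOn.injOn fun x hx y hy hxy => ?_
    exact div_lt_div_of_pos_left hc hx hxy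
  have himg2 : (fun v : ℝ => c / v) '' Set.Ioi 0 = Set.Ioi 0 := by
    ext w
    constructor
    · rintro ⟨v, hv, rfl⟩; exact div_pos hc hv
    · intro hw
      have hw' : (0 : ℝ) < w := hw
      exact ⟨c / w, div_pos hc hw, by field_simp⟩
  have habs : ∀ x : ℝ, |1 + c / x ^ 2| = 1 + c / x ^ 2 := fun x => abs_of_pos (by positivity)
  have habs2 : ∀ x : ℝ, |-(c / x ^ 2)| = c / x ^ 2 := fun x => by
    rw [abs_neg, abs_of_nonneg (by positivity)]
  have i1 : IntegrableOn (fun x => (1 + c / x ^ 2) * g x) (Set.Ioi 0) := by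
    have := (integrableOn_image_iff_integrableOn_abs_deriv_smul measurableSet_Ioi hder hinj
      (fun w : ℝ => Real.exp (-1 * w ^ 2))).1 (by
        rw [himg, integrableOn_univ]; exact integrable_exp_neg_mul_sq one_pos)
    simpa [habs, hg] using this
  have e1 : ∫ x in Set.Ioi (0 : ℝ), (1 + c / x ^ 2) * g x = √Real.pi := by
    have := integral_image_eq_integral_abs_deriv_smul measurableSet_Ioi hder hinj
      (fun w : ℝ => Real.exp (-1 * w ^ 2))
    rw [himg, setIntegral_univ, integral_gaussian] at this
    simpa [habs, hg] using this.symm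
  have i2 : IntegrableOn g (Set.Ioi 0) := by
    refine i1.mono' ?_ ?_
    · exact (by fun_prop : Measurable g).aestronglyMeasurable
    · refine Filter.Eventually.of_forall fun x => ?_
      rw [Real.norm_of_nonneg (Real.exp_nonneg _)]
      have : 0 ≤ c / x ^ 2 * g x := by positivity
      linarith
  have e2 : ∫ x in Set.Ioi (0 : ℝ), g x = ∫ x in Set.Ioi (0 : ℝ), c / x ^ 2 * g x := by
    have := integral_image_eq_integral_abs_deriv_smul measurableSet_Ioi hder2 hinj2 g
    rw [himg2] at this
    rw [this]
    refine setIntegral_congr_fun measurableSet_Ioi fun x hx => ?_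
    have hx' : x ≠ 0 := (Set.mem_Ioi.1 hx).ne'
    simp only [habs2, smul_eq_mul, hg]
    congr 3
    rw [div_div_cancel₀ hc.ne']; ring
  have i3 : IntegrableOn (fun x => c / x ^ 2 * g x) (Set.Ioi 0) := by
    refine (i1.sub i2).congr (Filter.Eventually.of_forall fun x => ?_)
    simp; ring
  have e3 : ∫ x in Set.Ioi (0 : ℝ), (1 + c / x ^ 2) * g x =
      (∫ x in Set.Ioi (0 : ℝ), g x) + ∫ x in Set.Ioi (0 : ℝ), c / x ^ 2 * g x := by
    rw [← integral_add i2 i3]; congr 1; ext x; ring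
  exact ⟨i2, by linarith⟩

/-- Subordination of the Poisson semigroup to the heat semigroup. -/
theorem integral_subordination {c : ℝ} (hc : 0 ≤ c) :
    ∫ v in Set.Ioi (0 : ℝ), 2 / √Real.pi * Real.exp (-v ^ 2) * Real.exp (-(c / v) ^ 2) =
      Real.exp (-(2 * c)) := by
  have hpi : 0 < √Real.pi := Real.sqrt_pos.2 Real.pi_pos
  rcases hc.eq_or_lt with rfl | hc
  · have := integral_gaussian_Ioi 1
    simp only [zero_div, mul_one, neg_mul, one_mul, ne_eq, OfNat.ofNat_ne_zero, not_false_eq_true,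
      zero_pow, neg_zero, Real.exp_zero, mul_zero, integral_const_mul] at this ⊢
    rw [this, div_one]; field_simp
  · have := (integrable_and_integral_exp_neg_sq_sub_div hc).2
    calc _ = ∫ v in Set.Ioi (0 : ℝ), 2 / √Real.pi * Real.exp (-(2 * c)) *
          Real.exp (-(v - c / v) ^ 2) := by
          refine setIntegral_congr_fun measurableSet_Ioi fun v hv => ?_
          have hv' : v ≠ 0 := (Set.mem_Ioi.1 hv).ne'
          rw [mul_assoc, mul_assoc, ← Real.exp_add, ← Real.exp_add]
          congr 2
          field_simp
          ring
      _ = _ := by rw [integral_const_mul, this]; field_simp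

section Gauss

variable {V : Type*} [NormedAddCommGroup V]

/-- The self-dual Gaussian. -/
noncomputable def gauss (x : V) : ℝ := Real.exp (-Real.pi * ‖x‖ ^ 2)

theorem gauss_pos (x : V) : 0 < gauss x := Real.exp_pos _

@[fun_prop]
theorem continuous_gauss : Continuous (gauss : V → ℝ) := by unfold gauss; fun_prop

theorem one_add_norm_mul_gauss_le (x : V) :
    (1 + ‖x‖) * gauss x ≤ 2 * Real.exp (-1 * ‖x‖ ^ 2) := by
  have h1 : gauss x ≤ Real.exp (-2 * ‖x‖ ^ 2) := by
    unfold gauss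
    gcongr
    linarith [Real.pi_gt_three]
  have h2 : (1 + ‖x‖) ≤ 2 * Real.exp (‖x‖ ^ 2) := by
    have := Real.add_one_le_exp (‖x‖ ^ 2)
    nlinarith [sq_nonneg (‖x‖ - 1)]
  calc (1 + ‖x‖) * gauss x ≤ 2 * Real.exp (‖x‖ ^ 2) * Real.exp (-2 * ‖x‖ ^ 2) := by
        gcongr
        exact (gauss_pos x).le
    _ = _ := by rw [mul_assoc, ← Real.exp_add]; ring_nf

variable [InnerProductSpace ℝ V] [FiniteDimensional ℝ V] [MeasurableSpace V] [BorelSpace V]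

theorem integrable_exp_neg_mul_norm_sq {b : ℝ} (hb : 0 < b) :
    Integrable fun x : V => Real.exp (-b * ‖x‖ ^ 2) := by
  have := (GaussianFourier.integrable_cexp_neg_mul_sq_norm_add (V := V) (b := b) (by simpa) 0 0).norm
  refine this.congr (Filter.Eventually.of_forall fun x => ?_)
  simp only [zero_mul, add_zero, Complex.norm_exp]
  norm_cast

theorem integrable_one_add_norm_mul_gauss : Integrable fun x : V => (1 + ‖x‖) * gauss x := by
  refine ((integrable_exp_neg_mul_norm_sq (V := V) one_pos).const_mul 2).mono' ?_ ?_
  · exact (by fun_prop : Continuous fun x : V => (1 + ‖x‖) * gauss x).aestronglyMeasurable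
  · refine Filter.Eventually.of_forall fun x => ?_
    have := gauss_pos x
    rw [Real.norm_of_nonneg (by positivity)]
    exact one_add_norm_mul_gauss_le x

theorem integrable_gauss : Integrable (gauss : V → ℝ) :=
  integrable_exp_neg_mul_norm_sq Real.pi_pos

theorem integral_gauss_mul_planeWave (τ : ℝ) (ξ : V) :
    ∫ y : V, (gauss y : ℂ) * planeWave (τ • y) ξ = Real.exp (-(Real.pi * (τ * ‖ξ‖) ^ 2)) := by
  have := GaussianFourier.integral_cexp_neg_mul_sq_norm_add (V := V) (b := Real.pi)
    (by simpa using Real.pi_pos) (2 * Real.pi * τ * Complex.I) ξ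
  have hpi : (Real.pi : ℂ) ≠ 0 := by exact_mod_cast Real.pi_ne_zero
  rw [div_self hpi, Complex.one_cpow, one_mul] at this
  convert this using 1
  · congr 1; ext y
    rw [gauss, planeWave, inner_smul_left, real_inner_comm]
    push_cast
    rw [← Complex.exp_add]
    congr 1
    simp only [conj_trivial]
    ring
  · push_cast
    congr 1
    field_simp
    ring_nf
    rw [Complex.I_sq]; ring

theorem integral_gauss : ∫ y : V, gauss y = 1 := by
  have := integral_gauss_mul_planeWave 0 (0 : V)
  simp [planeWave] at this
  rw [integral_complex_ofReal] at this
  exact_mod_cast this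

theorem LpMultiplier.of_kernel {p : ℝ} (hp : 1 < p) {Ω : Type*} [MeasurableSpace Ω]
    {μ : Measure Ω} [SFinite μ] {Y : Ω → V} (hY : Measurable Y) {k : Ω → ℂ} (hk : Measurable k)
    {a : Ω → ℝ} (ha : Measurable a) (hai : Integrable a μ) (ha0 : ∀ᵐ ω ∂μ, 0 < a ω)
    (hka : ∀ᵐ ω ∂μ, ‖k ω‖ ≤ a ω) :
    LpMultiplier p (ENNReal.ofReal (∫ ω, a ω ∂μ)) fun ξ => ∫ ω, k ω * _root_.planeWave (Y ω) ξ ∂μ := by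
  have e : ENNReal.ofReal (∫ ω, a ω ∂μ) = ∫⁻ ω, ENNReal.ofReal (a ω) ∂μ :=
    ofReal_integral_eq_lintegral_ofReal hai (ha0.mono fun _ h => h.le)
  rw [e]
  refine LpMultiplier.integral hp (g := a) ?_ hai ?_ ha.ennreal_ofReal ?_ ?_ ?_
  · unfold Function.uncurry; fun_prop
  · filter_upwards [hka] with ω h ξ
    simpa [norm_planeWave] using h
  · filter_upwards [ha0] with ω h
    simpa using h
  · rw [← e]; exact ENNReal.ofReal_ne_top
  · filter_upwards [hka] with ω h
    refine ((LpMultiplier.planeWave p (Y ω)).const_mul (k ω)).mono ?_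
    rw [mul_one, ← ofReal_norm]
    exact ENNReal.ofReal_le_ofReal h

end Gauss

theorem abs_exp_neg_sub_exp_neg_le (a b : ℝ) :
    |Real.exp (-a) - Real.exp (-b)| ≤ |a - b| * (Real.exp (-a) + Real.exp (-b)) := by
  wlog h : a ≤ b generalizing a b
  · rw [abs_sub_comm, abs_sub_comm a b, add_comm]
    exact this b a (le_of_not_ge h)
  have h1 : Real.exp (-b) ≤ Real.exp (-a) := Real.exp_le_exp.2 (by linarith)
  rw [abs_of_nonneg (by linarith), abs_sub_comm, abs_of_nonneg (by linarith)]
  have h2 : Real.exp (-b) = Real.exp (-a) * Real.exp (-(b - a)) := by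
    rw [← Real.exp_add]; ring_nf
  have h3 := Real.add_one_le_exp (-(b - a))
  have h4 := Real.exp_pos (-a)
  have h5 := Real.exp_pos (-b)
  nlinarith [mul_le_mul_of_nonneg_left h3 h4.le, mul_nonneg (sub_nonneg.2 h) h5.le]

section Heat

variable {V : Type*} [NormedAddCommGroup V]

theorem abs_gauss_sub_gauss_le (x h : V) {γ : ℝ} (hγ : 0 ≤ γ) (hγ1 : γ ≤ 1) :
    |gauss x - gauss (x - h)| ≤ 2 * Real.pi * ‖h‖ ^ γ *
      ((1 + ‖x‖) * gauss x + (1 + ‖x - h‖) * gauss (x - h)) := by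
  have hG := gauss_pos x
  have hG' := gauss_pos (x - h)
  have hx := norm_nonneg x
  have hx' := norm_nonneg (x - h)
  have hh := norm_nonneg h
  have hpi := Real.pi_gt_three
  set D := (1 + ‖x‖) * gauss x + (1 + ‖x - h‖) * gauss (x - h) with hD
  have hD0 : gauss x + gauss (x - h) ≤ D := by
    rw [hD]; nlinarith [mul_nonneg hx hG.le, mul_nonneg hx' hG'.le]
  rcases le_total 1 ‖h‖ with h1 | h1
  · have h2 : 1 ≤ ‖h‖ ^ γ := Real.one_le_rpow h1 hγ
    have h3 : |gauss x - gauss (x - h)| ≤ gauss x + gauss (x - h) := by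
      rw [abs_le]; constructor <;> linarith
    have h4 : 1 ≤ 2 * Real.pi * ‖h‖ ^ γ := by nlinarith
    nlinarith
  · have h2 : ‖h‖ ≤ ‖h‖ ^ γ := by
      rcases hh.eq_or_lt with h0 | h0
      · rw [← h0]; exact Real.zero_rpow_nonneg _
      · simpa using Real.rpow_le_rpow_of_exponent_ge h0 h1 hγ1
    have h3 := abs_exp_neg_sub_exp_neg_le (Real.pi * ‖x‖ ^ 2) (Real.pi * ‖x - h‖ ^ 2)
    rw [← neg_mul, ← neg_mul] at h3
    change |gauss x - gauss (x - h)| ≤ _ * (gauss x + gauss (x - h)) at h3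
    have h4 : |Real.pi * ‖x‖ ^ 2 - Real.pi * ‖x - h‖ ^ 2| ≤
        Real.pi * (‖h‖ * (‖x‖ + ‖x - h‖)) := by
      rw [← mul_sub, abs_mul, abs_of_pos Real.pi_pos, sq_sub_sq, abs_mul, mul_comm ‖h‖,
        abs_of_nonneg (by positivity)]
      gcongr
      have := abs_norm_sub_norm_le x (x - h)
      simpa using this
    have h5 : ‖x‖ ≤ ‖x - h‖ + 1 := by
      have := norm_add_le (x - h) h
      simp at this; linarith
    have h6 : ‖x - h‖ ≤ ‖x‖ + 1 := (norm_sub_le _ _).trans (by linarith)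
    have h7 : (‖x‖ + ‖x - h‖) * (gauss x + gauss (x - h)) ≤ 2 * D := by
      rw [hD]
      nlinarith [mul_nonneg (sub_nonneg.2 h5) hG'.le, mul_nonneg (sub_nonneg.2 h6) hG.le]
    calc _ ≤ Real.pi * (‖h‖ * (‖x‖ + ‖x - h‖)) * (gauss x + gauss (x - h)) :=
          h3.trans (by gcongr)
      _ = Real.pi * ‖h‖ * ((‖x‖ + ‖x - h‖) * (gauss x + gauss (x - h))) := by ring
      _ ≤ Real.pi * ‖h‖ ^ γ * (2 * D) := by gcongr
      _ = _ := by ring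

/-- The heat symbol. -/
noncomputable def heat (τ : ℝ) (ξ : V) : ℂ := (Real.exp (-(Real.pi * (τ * ‖ξ‖) ^ 2)) : ℝ)

@[fun_prop]
theorem Continuous.heat {X : Type*} [TopologicalSpace X] {f : X → ℝ} {g : X → V}
    (hf : Continuous f) (hg : Continuous g) : Continuous fun x => heat (f x) (g x) := by
  unfold _root_.heat; fun_prop

@[fun_prop]
theorem Measurable.heat [MeasurableSpace V] [BorelSpace V] {X : Type*} [MeasurableSpace X] {f : X → ℝ} {g : X → V}
    (hf : Measurable f) (hg : Measurable g) : Measurable fun x => heat (f x) (g x) := by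
  unfold _root_.heat; fun_prop

theorem norm_heat_le (τ : ℝ) (ξ : V) : ‖heat τ ξ‖ ≤ 1 := by
  rw [heat, Complex.norm_real, Real.norm_of_nonneg (Real.exp_nonneg _)]
  exact Real.exp_le_one_iff.2 (by have := Real.pi_pos; simp; positivity)

variable [InnerProductSpace ℝ V] [FiniteDimensional ℝ V] [MeasurableSpace V] [BorelSpace V]

theorem LpMultiplier.heat {p : ℝ} (hp : 1 < p) (τ : ℝ) :
    LpMultiplier p 1 (fun ξ : V => heat τ ξ) := by
  have := LpMultiplier.of_kernel (V := V) hp (μ := volume) (Y := fun y : V => τ • y) (by fun_prop)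
    (k := fun y => (gauss y : ℂ)) (by fun_prop) (a := gauss) (by fun_prop) integrable_gauss
    (Filter.Eventually.of_forall gauss_pos)
    (Filter.Eventually.of_forall fun y => by simp [abs_of_pos (gauss_pos y)])
  rw [integral_gauss, ENNReal.ofReal_one] at this
  simp only [integral_gauss_mul_planeWave] at this
  exact this

theorem LpMultiplier.zero (p : ℝ) : LpMultiplier p 0 (fun _ : V => 0) := by
  simpa using (LpMultiplier.one (V := V) p).const_mul 0

/-- Differences of the heat semigroup. -/
theorem LpMultiplier.sub_planeWave_mul_heat {p : ℝ} (hp : 1 < p) {τ : ℝ} (hτ : 0 < τ) (y : V)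
    {γ : ℝ} (hγ : 0 ≤ γ) (hγ1 : γ ≤ 1) :
    LpMultiplier p (ENNReal.ofReal (4 * Real.pi * (∫ x : V, (1 + ‖x‖) * gauss x) * (‖y‖ / τ) ^ γ))
      (fun ξ : V => (1 - _root_.planeWave y ξ) * _root_.heat τ ξ) := by
  rcases eq_or_ne y 0 with rfl | hy
  · have : (fun ξ : V => (1 - _root_.planeWave 0 ξ) * _root_.heat τ ξ) = fun _ => 0 := by
      ext ξ; simp [_root_.planeWave]
    rw [this]
    exact (LpMultiplier.zero p).mono zero_le
  set h : V := τ⁻¹ • y with hh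
  have hn : ‖h‖ = ‖y‖ / τ := by
    rw [hh, norm_smul, norm_inv, Real.norm_of_nonneg hτ.le]; field_simp
  have hn0 : 0 < ‖h‖ := norm_pos_iff.2 (smul_ne_zero (inv_ne_zero hτ.ne') hy)
  set a : V → ℝ := fun x => 2 * Real.pi * ‖h‖ ^ γ *
      ((1 + ‖x‖) * gauss x + (1 + ‖x - h‖) * gauss (x - h)) with ha
  have hi := integrable_one_add_norm_mul_gauss (V := V)
  have hi' := hi.comp_sub_right h
  have hpi := Real.pi_pos
  have key := LpMultiplier.of_kernel (V := V) hp (μ := volume) (Y := fun y : V => τ • y)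
    (by fun_prop) (k := fun y => ((gauss y - gauss (y - h) : ℝ) : ℂ)) (by fun_prop) (a := a)
    (by fun_prop) ((hi.add hi').const_mul _)
    (Filter.Eventually.of_forall fun x => by
      have := gauss_pos x
      have := gauss_pos (x - h)
      positivity)
    (Filter.Eventually.of_forall fun x => by
      rw [Complex.norm_real]
      exact abs_gauss_sub_gauss_le x h hγ hγ1)
  have e : ∫ x, a x = 4 * Real.pi * (∫ x : V, (1 + ‖x‖) * gauss x) * (‖y‖ / τ) ^ γ := by
    rw [integral_const_mul, integral_add hi hi',
      integral_sub_right_eq_self (fun x : V => (1 + ‖x‖) * gauss x), hn]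
    ring
  rw [e] at key
  convert key using 2 with ξ
  have h1 := integral_gauss_mul_planeWave τ ξ
  have i1 : Integrable fun x : V => (gauss x : ℂ) * _root_.planeWave (τ • x) ξ := by
    refine integrable_gauss.mono' ?_ ?_
    · exact (by fun_prop : Measurable fun x : V =>
        (gauss x : ℂ) * _root_.planeWave (τ • x) ξ).aestronglyMeasurable
    · exact Filter.Eventually.of_forall fun x => by
        simp [norm_planeWave, abs_of_pos (gauss_pos x)]
  have e2 : ∀ x : V, (gauss (x - h) : ℂ) * _root_.planeWave (τ • x) ξ = _root_.planeWave y ξ *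
      ((gauss (x - h) : ℂ) * _root_.planeWave (τ • (x - h)) ξ) := by
    intro x
    have : τ • x = y + τ • (x - h) := by
      rw [smul_sub, hh, smul_inv_smul₀ hτ.ne']; abel
    rw [this, planeWave_add_left]; ring
  have i2 : Integrable fun x : V => (gauss (x - h) : ℂ) * _root_.planeWave (τ • x) ξ := by
    simp_rw [e2]
    exact (i1.comp_sub_right h).const_mul _
  simp only [Complex.ofReal_sub, sub_mul]
  rw [integral_sub i1 i2]
  simp_rw [e2]
  rw [integral_const_mul, integral_sub_right_eq_self
    (fun x : V => (gauss x : ℂ) * _root_.planeWave (τ • x) ξ), h1]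
  simp only [_root_.heat, one_mul]

theorem enorm_synth_heat_le {p q : ℝ} (hpq : p.HolderConjugate q) {τ : ℝ} (hτ : 0 < τ) {ψ : V → ℂ}
    (hψ : BandLimited ψ) (x : V) :
    ‖synth (fun ξ => heat τ ξ * ψ ξ) x‖ₑ ≤
      (∫⁻ y : V, ‖gauss y‖ₑ ^ q) ^ (1 / q) *
        (ENNReal.ofReal (τ ^ (-(Module.finrank ℝ V / p : ℝ))) *
          eLpNorm (synth ψ) (ENNReal.ofReal p) volume) := by
  have hp0 : 0 < p := hpq.pos
  have hm := hψ.meas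
  have hms := measurable_synth hm
  have e1 : synth (fun ξ => heat τ ξ * ψ ξ) x = ∫ y : V, (gauss y : ℂ) * synth ψ (x + τ • y) := by
    have : ∀ ξ : V, planeWave x ξ * (heat τ ξ * ψ ξ) =
        ∫ y : V, (gauss y : ℂ) * (planeWave (x + τ • y) ξ * ψ ξ) := by
      intro ξ
      rw [heat, ← integral_gauss_mul_planeWave, ← integral_mul_const, ← integral_const_mul]
      congr 1; ext y
      rw [planeWave_add_left]; ring
    rw [synth]
    simp_rw [this]
    rw [integral_integral_swap]
    · simp_rw [integral_const_mul, synth]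
    · have := (hψ.integrable.norm.mul_prod (integrable_gauss (V := V)))
      refine this.mono' ?_ (Filter.Eventually.of_forall fun z => ?_)
      · exact Measurable.aestronglyMeasurable (by unfold Function.uncurry; fun_prop)
      · simp [Function.uncurry, norm_planeWave, abs_of_pos (gauss_pos _), mul_comm]
  have e2 : (∫⁻ y : V, ‖synth ψ (x + τ • y)‖ₑ ^ p) ^ (1 / p) =
      ENNReal.ofReal (τ ^ (-(Module.finrank ℝ V / p : ℝ))) *
          eLpNorm (synth ψ) (ENNReal.ofReal p) volume := by
    rw [eLpNorm_eq_lintegral_rpow_enorm_toReal (by simpa using hp0) ENNReal.ofReal_ne_top,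
      ENNReal.toReal_ofReal hp0.le]
    have s1 : ∫⁻ y : V, ‖synth ψ (x + τ • y)‖ₑ ^ p =
        ENNReal.ofReal (τ ^ (-(Module.finrank ℝ V : ℝ))) * ∫⁻ y : V, ‖synth ψ (x + y)‖ₑ ^ p := by
      have hmm : Measurable fun y : V => ‖synth ψ (x + y)‖ₑ ^ p := by fun_prop
      rw [← lintegral_map (f := fun y : V => ‖synth ψ (x + y)‖ₑ ^ p) (g := fun y => τ • y) hmm
        (by fun_prop), Measure.map_addHaar_smul _ hτ.ne', lintegral_smul_measure, smul_eq_mul,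
        abs_of_pos (by positivity), Real.rpow_neg hτ.le, Real.rpow_natCast]
    rw [s1, lintegral_add_left_eq_self (fun y : V => ‖synth ψ y‖ₑ ^ p),
      ENNReal.mul_rpow_of_nonneg _ _ (by positivity), ENNReal.ofReal_rpow_of_pos (by positivity),
      ← Real.rpow_mul hτ.le]
    congr 4
    ring
  rw [e1, ← e2]
  refine (enorm_integral_le_lintegral_enorm _).trans ?_
  have := ENNReal.lintegral_mul_le_Lp_mul_Lq (volume : Measure V) hpq.symm
    (f := fun y => ‖gauss y‖ₑ) (g := fun y => ‖synth ψ (x + τ • y)‖ₑ)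
    (by fun_prop : Measurable fun y : V => ‖gauss y‖ₑ).aemeasurable
    (by fun_prop : Measurable fun y : V => ‖synth ψ (x + τ • y)‖ₑ).aemeasurable
  refine le_trans (le_of_eq ?_) this
  refine lintegral_congr fun y => ?_
  simp only [Pi.mul_apply, enorm_mul]
  congr 1
  simp [enorm, nnnorm]

end Heat

/-- The subordination density. -/
noncomputable def subDensity (v : ℝ) : ℝ := 2 / √Real.pi * Real.exp (-v ^ 2)

@[fun_prop]
theorem continuous_subDensity : Continuous subDensity := by unfold subDensity; fun_prop

theorem subDensity_pos (v : ℝ) : 0 < subDensity v := by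
  have := Real.pi_pos
  unfold subDensity; positivity

theorem integrable_subDensity : Integrable subDensity := by
  have := integrable_exp_neg_mul_sq one_pos
  refine (this.const_mul (2 / √Real.pi)).congr (Filter.Eventually.of_forall fun x => ?_)
  simp [subDensity]

theorem integral_subDensity : ∫ v in Set.Ioi (0 : ℝ), subDensity v = 1 := by
  simpa [subDensity] using integral_subordination le_rfl

theorem integrableOn_subDensity_mul_rpow {δ : ℝ} (hδ : -1 < δ) :
    IntegrableOn (fun v => subDensity v * v ^ δ) (Set.Ioi 0) := by
  have := (integrableOn_rpow_mul_exp_neg_mul_sq one_pos hδ).const_mul (2 / √Real.pi)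
  refine this.congr (Filter.Eventually.of_forall fun x => ?_)
  simp [subDensity]; ring

/-- The heat time corresponding to the subordination variable `v` and the Poisson time `s`. -/
noncomputable def heatTime (s v : ℝ) : ℝ := s / (2 * √Real.pi * v)

@[fun_prop]
theorem Measurable.heatTime {X : Type*} [MeasurableSpace X] {f g : X → ℝ}
    (hf : Measurable f) (hg : Measurable g) : Measurable fun x => heatTime (f x) (g x) := by
  unfold _root_.heatTime; fun_prop

theorem heatTime_pos {s v : ℝ} (hs : 0 < s) (hv : 0 < v) : 0 < heatTime s v := by
  have := Real.pi_pos
  unfold heatTime; positivity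

theorem heatTime_rpow {s v : ℝ} (hs : 0 < s) (hv : 0 < v) (δ : ℝ) :
    (heatTime s v) ^ δ = (s / (2 * √Real.pi)) ^ δ * v ^ (-δ) := by
  have := Real.pi_pos
  rw [heatTime, ← div_div, Real.div_rpow (by positivity) hv.le, Real.rpow_neg hv.le, div_eq_mul_inv]

section Poisson

variable {V : Type*} [NormedAddCommGroup V]

/-- The Poisson symbol. -/
noncomputable def poisson (s : ℝ) (ξ : V) : ℂ := (Real.exp (-(s * ‖ξ‖)) : ℝ)

@[fun_prop]
theorem Continuous.poisson {X : Type*} [TopologicalSpace X] {f : X → ℝ} {g : X → V}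
    (hf : Continuous f) (hg : Continuous g) : Continuous fun x => poisson (f x) (g x) := by
  unfold _root_.poisson; fun_prop

@[fun_prop]
theorem Measurable.poisson [MeasurableSpace V] [BorelSpace V] {X : Type*} [MeasurableSpace X]
    {f : X → ℝ} {g : X → V} (hf : Measurable f) (hg : Measurable g) :
    Measurable fun x => poisson (f x) (g x) := by
  unfold _root_.poisson; fun_prop

theorem norm_poisson_le {s : ℝ} (hs : 0 ≤ s) (ξ : V) : ‖poisson s ξ‖ ≤ 1 := by
  rw [poisson, Complex.norm_real, Real.norm_of_nonneg (Real.exp_nonneg _)]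
  exact Real.exp_le_one_iff.2 (by simp; positivity)

theorem poisson_eq_integral {s : ℝ} (hs : 0 ≤ s) (ξ : V) :
    poisson s ξ = ∫ v in Set.Ioi (0 : ℝ), (subDensity v : ℂ) * heat (heatTime s v) ξ := by
  have h := integral_subordination (c := s * ‖ξ‖ / 2) (by positivity)
  rw [mul_div_cancel₀ _ two_ne_zero] at h
  rw [poisson, ← h, ← integral_complex_ofReal]
  refine setIntegral_congr_fun measurableSet_Ioi fun v hv => ?_
  have hv' : v ≠ 0 := (Set.mem_Ioi.1 hv).ne'
  have hpi := Real.pi_pos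
  simp only [heat, ← Complex.ofReal_mul, subDensity]
  congr 4
  rw [heatTime]
  field_simp
  rw [Real.sq_sqrt hpi.le]

variable [InnerProductSpace ℝ V] [FiniteDimensional ℝ V] [MeasurableSpace V] [BorelSpace V]

/-- The Poisson semigroup consists of averages of translations. -/
theorem exists_poisson_law : ∃ P : Measure V, IsProbabilityMeasure P ∧
    (∀ s, 0 ≤ s → ∀ ξ, ∫ y, planeWave (s • y) ξ ∂P = poisson s ξ) ∧
    ∀ γ : ℝ, 0 ≤ γ → γ < 1 → Integrable (fun y => ‖y‖ ^ γ) P := by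
  set μ : Measure ℝ := (volume.restrict (Set.Ioi 0)).withDensity
    fun v => ENNReal.ofReal (subDensity v) with hμ
  set ν : Measure V := volume.withDensity fun y => ENNReal.ofReal (gauss y) with hν
  have hpi := Real.pi_pos
  have hmd : Measurable subDensity := continuous_subDensity.measurable
  have hmg : Measurable (gauss : V → ℝ) := continuous_gauss.measurable
  have hμi : ∀ (f : ℝ → ℝ), Integrable f μ ↔ IntegrableOn (fun v => subDensity v * f v) (Set.Ioi 0) := by
    intro f
    rw [hμ, integrable_withDensity_iff_integrable_smul₀' hmd.ennreal_ofReal.aemeasurable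
      (Filter.Eventually.of_forall fun _ => ENNReal.ofReal_lt_top)]
    simp only [ENNReal.toReal_ofReal (subDensity_pos _).le, smul_eq_mul]
    rfl
  have hμI : ∀ (f : ℝ → ℂ), ∫ v, f v ∂μ = ∫ v in Set.Ioi (0 : ℝ), (subDensity v : ℂ) * f v := by
    intro f
    rw [hμ, integral_withDensity_eq_integral_toReal_smul₀ hmd.ennreal_ofReal.aemeasurable
      (Filter.Eventually.of_forall fun _ => ENNReal.ofReal_lt_top)]
    simp [ENNReal.toReal_ofReal (subDensity_pos _).le]
  have hνi : ∀ (f : V → ℝ), Integrable f ν ↔ Integrable (fun v => gauss v * f v) := by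
    intro f
    rw [hν, integrable_withDensity_iff_integrable_smul₀' hmg.ennreal_ofReal.aemeasurable
      (Filter.Eventually.of_forall fun _ => ENNReal.ofReal_lt_top)]
    simp only [ENNReal.toReal_ofReal (gauss_pos _).le, smul_eq_mul]
  have hνI : ∀ (f : V → ℂ), ∫ v, f v ∂ν = ∫ v, (gauss v : ℂ) * f v := by
    intro f
    rw [hν, integral_withDensity_eq_integral_toReal_smul₀ hmg.ennreal_ofReal.aemeasurable
      (Filter.Eventually.of_forall fun _ => ENNReal.ofReal_lt_top)]
    simp [ENNReal.toReal_ofReal (gauss_pos _).le]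
  have : IsProbabilityMeasure μ := ⟨by
    rw [hμ, withDensity_apply _ MeasurableSet.univ, Measure.restrict_univ,
      ← ofReal_integral_eq_lintegral_ofReal integrable_subDensity.integrableOn
      (Filter.Eventually.of_forall fun v => (subDensity_pos v).le), integral_subDensity,
      ENNReal.ofReal_one]⟩
  have : IsProbabilityMeasure ν := ⟨by
    rw [hν, withDensity_apply _ MeasurableSet.univ, Measure.restrict_univ,
      ← ofReal_integral_eq_lintegral_ofReal integrable_gauss
      (Filter.Eventually.of_forall fun v => (gauss_pos v).le), integral_gauss,
      ENNReal.ofReal_one]⟩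
  have hY : Measurable fun z : ℝ × V => heatTime 1 z.1 • z.2 := by fun_prop
  refine ⟨(μ.prod ν).map fun z => heatTime 1 z.1 • z.2,
    Measure.isProbabilityMeasure_map hY.aemeasurable, fun s hs ξ => ?_, fun γ h0 h1 => ?_⟩
  · rw [integral_map hY.aemeasurable (by fun_prop : Measurable fun y : V =>
      planeWave (s • y) ξ).aestronglyMeasurable, integral_prod]
    · rw [hμI, poisson_eq_integral hs]
      congr 1; ext v
      congr 1
      rw [hνI]
      simp_rw [smul_smul]
      rw [integral_gauss_mul_planeWave, heat]
      congr 4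
      simp only [heatTime]; ring
    · refine (integrable_const (1 : ℝ)).mono' ?_ (Filter.Eventually.of_forall fun z => ?_)
      · exact Measurable.aestronglyMeasurable (by fun_prop)
      · rw [norm_planeWave]
  · rw [integrable_map_measure (by fun_prop : Measurable fun y : V =>
      ‖y‖ ^ γ).aestronglyMeasurable hY.aemeasurable]
    have i1 : Integrable (fun v : ℝ => |heatTime 1 v| ^ γ) μ := by
      rw [hμi]
      have i0 : IntegrableOn (fun v => (1 / (2 * √Real.pi)) ^ γ * (subDensity v * v ^ (-γ)))
          (Set.Ioi 0) :=
        (integrableOn_subDensity_mul_rpow (δ := -γ) (by linarith)).const_mul _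
      refine i0.congr_fun (fun v hv => ?_) measurableSet_Ioi
      simp only
      rw [abs_of_pos (heatTime_pos one_pos hv), heatTime_rpow one_pos hv]
      ring
    have i2 : Integrable (fun y : V => ‖y‖ ^ γ) ν := by
      rw [hνi]
      refine (integrable_one_add_norm_mul_gauss (V := V)).mono'
        (by fun_prop : Measurable fun y : V => gauss y * ‖y‖ ^ γ).aestronglyMeasurable
        (Filter.Eventually.of_forall fun y => ?_)
      have := gauss_pos y
      have hy := norm_nonneg y
      rw [Real.norm_of_nonneg (by positivity), mul_comm]
      gcongr
      rcases le_total ‖y‖ 1 with h | h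
      · exact (Real.rpow_le_one hy h h0).trans (by linarith)
      · exact (Real.rpow_le_rpow_of_exponent_le h h1.le).trans (by simp)
    refine (i1.mul_prod i2).congr (Filter.Eventually.of_forall fun z => ?_)
    simp only [Function.comp, norm_smul, Real.norm_eq_abs]
    rw [Real.mul_rpow (abs_nonneg _) (norm_nonneg _)]

theorem LpMultiplier.poisson {p : ℝ} (hp : 1 < p) {s : ℝ} (hs : 0 ≤ s) :
    LpMultiplier p 1 (fun ξ : V => poisson s ξ) := by
  obtain ⟨P, hP, hP1, -⟩ := exists_poisson_law (V := V)
  have := LpMultiplier.of_kernel (V := V) hp (μ := P) (Y := fun y : V => s • y) (by fun_prop)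
    (k := fun _ => 1) measurable_const (a := fun _ => 1) measurable_const (integrable_const 1)
    (by simp) (by simp)
  simpa [hP1 s hs] using this

theorem LpMultiplier.exp_neg_mul_abs_inner {p : ℝ} (hp : 1 < p) {s : ℝ} (hs : 0 ≤ s) (v : V) :
    LpMultiplier p 1 (fun ξ : V => (Real.exp (-(s * |⟪v, ξ⟫|)) : ℂ)) := by
  obtain ⟨P, hP, hP1, -⟩ := exists_poisson_law (V := ℝ)
  have := LpMultiplier.of_kernel (V := V) hp (μ := P) (Y := fun y : ℝ => (s * y) • v) (by fun_prop)
    (k := fun _ => 1) measurable_const (a := fun _ => 1) measurable_const (integrable_const 1)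
    (by simp) (by simp)
  have e : ∀ ξ : V, ∫ y, 1 * _root_.planeWave ((s * y) • v) ξ ∂P = (Real.exp (-(s * |⟪v, ξ⟫|)) : ℂ) := by
    intro ξ
    have h := hP1 s hs ⟪v, ξ⟫
    simp only [_root_.poisson, Real.norm_eq_abs] at h
    rw [← h]
    congr 1; ext y
    rw [one_mul, _root_.planeWave, _root_.planeWave, inner_smul_left]
    simp [mul_comm]
  simp only [e] at this
  simpa using this

end Poisson

section Bessel

variable {V : Type*} [NormedAddCommGroup V]

/-- The symbol `(1 + ‖ξ‖)^(-γ)`. -/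
noncomputable def bessel (γ : ℝ) (ξ : V) : ℂ := ((1 + ‖ξ‖) ^ (-γ) : ℝ)

theorem bessel_add (γ δ : ℝ) (ξ : V) : bessel (γ + δ) ξ = bessel γ ξ * bessel δ ξ := by
  rw [bessel, bessel, bessel, ← Complex.ofReal_mul, ← Real.rpow_add (by positivity), neg_add]

theorem bessel_zero (ξ : V) : bessel 0 ξ = 1 := by simp [bessel]

/-- The Gamma density. -/
noncomputable def gammaDensity (γ s : ℝ) : ℝ := (Real.Gamma γ)⁻¹ * (s ^ (γ - 1) * Real.exp (-s))

@[fun_prop]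
theorem measurable_gammaDensity (γ : ℝ) : Measurable (gammaDensity γ) := by
  unfold gammaDensity; fun_prop

theorem gammaDensity_pos {γ s : ℝ} (hγ : 0 < γ) (hs : 0 < s) : 0 < gammaDensity γ s := by
  have := Real.Gamma_pos_of_pos hγ
  unfold gammaDensity; positivity

theorem integrableOn_gammaDensity_mul_rpow {γ δ : ℝ} (hδ : 0 < γ + δ) :
    IntegrableOn (fun s => gammaDensity γ s * s ^ δ) (Set.Ioi 0) := by
  have h : IntegrableOn (fun s => (Real.Gamma γ)⁻¹ * (Real.exp (-s) * s ^ (γ + δ - 1)))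
      (Set.Ioi 0) := (Real.GammaIntegral_convergent hδ).const_mul _
  refine h.congr_fun (fun s hs => ?_) measurableSet_Ioi
  have hs' : 0 < s := hs
  simp only [gammaDensity]
  rw [show γ + δ - 1 = (γ - 1) + δ by ring, Real.rpow_add hs']
  ring

theorem integrableOn_gammaDensity {γ : ℝ} (hγ : 0 < γ) :
    IntegrableOn (gammaDensity γ) (Set.Ioi 0) := by
  simpa using integrableOn_gammaDensity_mul_rpow (γ := γ) (δ := 0) (by simpa)

theorem integral_gammaDensity {γ : ℝ} (hγ : 0 < γ) :
    ∫ s in Set.Ioi (0 : ℝ), gammaDensity γ s = 1 := by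
  have := Real.integral_rpow_mul_exp_neg_mul_Ioi hγ one_pos
  simp only [one_mul, div_one, Real.one_rpow] at this
  simp only [gammaDensity]
  rw [integral_const_mul, this, inv_mul_cancel₀ (Real.Gamma_pos_of_pos hγ).ne']

theorem bessel_eq_integral {γ : ℝ} (hγ : 0 < γ) (ξ : V) :
    bessel γ ξ = ∫ s in Set.Ioi (0 : ℝ), (gammaDensity γ s : ℂ) * poisson s ξ := by
  have hr : 0 < 1 + ‖ξ‖ := by positivity
  have := Real.integral_rpow_mul_exp_neg_mul_Ioi hγ hr
  have hG := Real.Gamma_pos_of_pos hγ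
  rw [bessel, show (1 + ‖ξ‖) ^ (-γ) = (Real.Gamma γ)⁻¹ * ((1 / (1 + ‖ξ‖)) ^ γ * Real.Gamma γ) by
    rw [one_div, Real.inv_rpow hr.le, Real.rpow_neg hr.le]; field_simp]
  rw [← this, ← integral_const_mul, ← integral_complex_ofReal]
  congr 1; ext s
  rw [gammaDensity, poisson, ← Complex.ofReal_mul]
  congr 1
  rw [mul_assoc, mul_assoc, ← Real.exp_add]
  congr 3
  ring_nf

variable [InnerProductSpace ℝ V] [FiniteDimensional ℝ V] [MeasurableSpace V] [BorelSpace V]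

theorem LpMultiplier.integral_ofReal {p : ℝ} (hp : 1 < p) {Ω : Type*} [MeasurableSpace Ω]
    {μ : Measure Ω} [SFinite μ] {m : Ω → V → ℂ} (hm : Measurable (Function.uncurry m)) {g : Ω → ℝ}
    (hg : Integrable g μ) (hmg : ∀ᵐ ω ∂μ, ∀ ξ, ‖m ω ξ‖ ≤ g ω) {a : Ω → ℝ} (ha : Measurable a)
    (hai : Integrable a μ) (ha0 : ∀ᵐ ω ∂μ, 0 < a ω)
    (h : ∀ᵐ ω ∂μ, LpMultiplier p (ENNReal.ofReal (a ω)) (m ω)) :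
    LpMultiplier p (ENNReal.ofReal (∫ ω, a ω ∂μ)) (fun ξ => ∫ ω, m ω ξ ∂μ) := by
  have e : ENNReal.ofReal (∫ ω, a ω ∂μ) = ∫⁻ ω, ENNReal.ofReal (a ω) ∂μ :=
    ofReal_integral_eq_lintegral_ofReal hai (ha0.mono fun _ h => h.le)
  rw [e]
  refine LpMultiplier.integral hp hm hg hmg ha.ennreal_ofReal ?_ ?_ h
  · filter_upwards [ha0] with ω h
    simpa using h
  · rw [← e]; exact ENNReal.ofReal_ne_top

theorem BilinMultiplier.integral_ofReal {p : ℝ} (hp : 1 < p) {Ω : Type*} [MeasurableSpace Ω]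
    {μ : Measure Ω} [SFinite μ] {σ : Ω → V → V → ℂ}
    (hσ : Measurable fun z : Ω × V × V => σ z.1 z.2.1 z.2.2)
    (hσg : ∀ R : ℝ, ∃ g : Ω → ℝ, Integrable g μ ∧
      ∀ᵐ ω ∂μ, ∀ ξ η, ‖ξ‖ ≤ R → ‖η‖ ≤ R → ‖σ ω ξ η‖ ≤ g ω)
    {a : Ω → ℝ} (ha : Measurable a) (hai : Integrable a μ) (ha0 : ∀ᵐ ω ∂μ, 0 < a ω)
    (h : ∀ᵐ ω ∂μ, BilinMultiplier p (ENNReal.ofReal (a ω)) (σ ω)) :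
    BilinMultiplier p (ENNReal.ofReal (∫ ω, a ω ∂μ)) (fun ξ η => ∫ ω, σ ω ξ η ∂μ) := by
  have e : ENNReal.ofReal (∫ ω, a ω ∂μ) = ∫⁻ ω, ENNReal.ofReal (a ω) ∂μ :=
    ofReal_integral_eq_lintegral_ofReal hai (ha0.mono fun _ h => h.le)
  rw [e]
  refine BilinMultiplier.integral hp hσ hσg ha.ennreal_ofReal ?_ ?_ h
  · filter_upwards [ha0] with ω h
    simpa using h
  · rw [← e]; exact ENNReal.ofReal_ne_top

/-- `m` is a Fourier multiplier `L^p → L^∞` (tested on band-limited functions) of norm at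
most `A`. -/
structure SupMultiplier (p A : ℝ) (m : V → ℂ) : Prop where
  meas : Measurable m
  bdd : LocBdd m
  bound : ∀ φ, BandLimited φ → ∀ x, ‖synth (fun ξ => m ξ * φ ξ) x‖ₑ ≤
    ENNReal.ofReal A * eLpNorm (synth φ) (ENNReal.ofReal p) volume

theorem SupMultiplier.const_mul {p A c : ℝ} {m : V → ℂ} (hc : 0 ≤ c) (h : SupMultiplier p A m) :
    SupMultiplier p (c * A) (fun ξ => c * m ξ) where
  meas := h.meas.const_mul _
  bdd R := by
    obtain ⟨a, ha⟩ := h.bdd R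
    refine ⟨c * a, fun ξ hξ => ?_⟩
    rw [norm_mul, Complex.norm_real, Real.norm_of_nonneg hc]
    gcongr; exact ha ξ hξ
  bound φ hφ x := by
    have e : synth (fun ξ => c * m ξ * φ ξ) x = c * synth (fun ξ => m ξ * φ ξ) x := by
      simp only [synth, ← integral_const_mul]
      congr 1; ext ξ; ring
    rw [e, enorm_mul, ENNReal.ofReal_mul hc, mul_assoc]
    gcongr
    · rw [← ofReal_norm, Complex.norm_real, Real.norm_of_nonneg hc]
    · exact h.bound φ hφ x

theorem SupMultiplier.integral {p : ℝ} {Ω : Type*} [MeasurableSpace Ω]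
    {μ : Measure Ω} [SFinite μ] {m : Ω → V → ℂ} (hm : Measurable (Function.uncurry m)) {g : Ω → ℝ}
    (hg : Integrable g μ) (hmg : ∀ᵐ ω ∂μ, ∀ ξ, ‖m ω ξ‖ ≤ g ω) {a : Ω → ℝ} (ha : Measurable a)
    (hai : Integrable a μ) (ha0 : ∀ᵐ ω ∂μ, 0 ≤ a ω)
    (h : ∀ᵐ ω ∂μ, SupMultiplier p (a ω) (m ω)) :
    SupMultiplier p (∫ ω, a ω ∂μ) (fun ξ => ∫ ω, m ω ξ ∂μ) where
  meas := by
    refine (StronglyMeasurable.integral_prod_right (f := fun (ξ : V) (ω : Ω) => m ω ξ) ?_).measurable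
    exact (hm.comp measurable_swap).stronglyMeasurable
  bdd R := by
    refine ⟨∫ ω, g ω ∂μ, fun ξ _ => norm_integral_le_of_norm_le hg ?_⟩
    filter_upwards [hmg] with ω h using h ξ
  bound φ hφ x := by
    have hmφ := hφ.meas
    have e : synth (fun ξ => (∫ ω, m ω ξ ∂μ) * φ ξ) x =
        ∫ ω, synth (fun ξ => m ω ξ * φ ξ) x ∂μ := by
      simp only [synth]
      rw [integral_integral_swap]
      · congr 1; ext ξ
        rw [← integral_mul_const, ← integral_const_mul]
      · refine (hg.mul_prod hφ.integrable.norm).mono' ?_ ?_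
        · exact (Measurable.mul (by fun_prop : Measurable fun z : Ω × V => planeWave x z.2)
            (hm.mul (by fun_prop : Measurable fun z : Ω × V => φ z.2))).aestronglyMeasurable
        · filter_upwards [(Measure.quasiMeasurePreserving_fst (μ := μ)
            (ν := (volume : Measure V))).ae hmg] with z h
          simp only [Function.uncurry, norm_mul, norm_planeWave, one_mul]
          gcongr; exact h z.2
    rw [e, ofReal_integral_eq_lintegral_ofReal hai ha0,
      ← lintegral_mul_const _ ha.ennreal_ofReal]
    refine (enorm_integral_le_lintegral_enorm _).trans (lintegral_mono_ae ?_)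
    filter_upwards [h] with ω h using h.bound φ hφ x

theorem SupMultiplier.exists_heat {p : ℝ} (hp : 1 < p) : ∃ C : ℝ, 0 ≤ C ∧ ∀ τ, 0 < τ →
    SupMultiplier p (C * τ ^ (-(Module.finrank ℝ V / p : ℝ))) (fun ξ : V => heat τ ξ) := by
  have hpq : p.HolderConjugate (p.conjExponent) := Real.HolderConjugate.conjExponent hp
  set q := p.conjExponent
  have hq : 1 ≤ q := hpq.symm.lt.le
  set K := (∫⁻ y : V, ‖gauss y‖ₑ ^ q) ^ (1 / q) with hK
  have hKt : K ≠ ⊤ := by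
    refine ENNReal.rpow_ne_top_of_nonneg (by positivity) (ne_top_of_le_ne_top ?_
      (lintegral_mono (g := fun y : V => ‖gauss y‖ₑ) fun y => ?_))
    · exact (integrable_gauss (V := V)).2.ne
    · refine (ENNReal.rpow_le_rpow_of_exponent_ge ?_ hq).trans_eq (ENNReal.rpow_one _)
      rw [← ofReal_norm, Real.norm_of_nonneg (gauss_pos y).le]
      refine ENNReal.ofReal_le_one.2 (Real.exp_le_one_iff.2 ?_)
      have := Real.pi_pos
      simp; positivity
  refine ⟨K.toReal, ENNReal.toReal_nonneg, fun τ hτ => ⟨by fun_prop,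
    fun R => ⟨1, fun ξ _ => norm_heat_le _ _⟩, fun φ hφ x => ?_⟩⟩
  rw [ENNReal.ofReal_mul ENNReal.toReal_nonneg, ENNReal.ofReal_toReal hKt, mul_assoc]
  exact enorm_synth_heat_le hpq hτ hφ x

theorem SupMultiplier.exists_poisson {p : ℝ} (hp : 1 < p) : ∃ C : ℝ, 0 ≤ C ∧ ∀ s, 0 < s →
    SupMultiplier p (C * s ^ (-(Module.finrank ℝ V / p : ℝ))) (fun ξ : V => poisson s ξ) := by
  obtain ⟨C, hC, h⟩ := SupMultiplier.exists_heat (V := V) hp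
  set δ : ℝ := Module.finrank ℝ V / p with hδ
  have hδ0 : 0 ≤ δ := by positivity
  have hpi := Real.pi_pos
  refine ⟨C * (1 / (2 * √Real.pi)) ^ (-δ) * ∫ v in Set.Ioi (0 : ℝ), subDensity v * v ^ δ,
    mul_nonneg (by positivity) (setIntegral_nonneg measurableSet_Ioi fun v hv =>
      mul_nonneg (subDensity_pos v).le (Real.rpow_nonneg (Set.mem_Ioi.1 hv).le _)), fun s hs => ?_⟩
  simp_rw [poisson_eq_integral hs.le]
  have hi := integrableOn_subDensity_mul_rpow (δ := δ) (by linarith)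
  have := SupMultiplier.integral (V := V) (p := p) (μ := volume.restrict (Set.Ioi (0 : ℝ)))
    (m := fun v ξ => (subDensity v : ℂ) * heat (heatTime s v) ξ)
    (by unfold Function.uncurry; fun_prop) (g := subDensity)
    integrable_subDensity.integrableOn
    (Filter.Eventually.of_forall fun v ξ => by
      rw [norm_mul, Complex.norm_real, Real.norm_of_nonneg (subDensity_pos v).le]
      exact mul_le_of_le_one_right (subDensity_pos v).le (norm_heat_le _ _))
    (a := fun v => C * (s / (2 * √Real.pi)) ^ (-δ) * (subDensity v * v ^ δ))
    (by fun_prop) (hi.const_mul _)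
    ((ae_restrict_mem measurableSet_Ioi).mono fun v hv => by
      have hv' : (0 : ℝ) < v := hv
      have := subDensity_pos v
      positivity)
    ((ae_restrict_mem measurableSet_Ioi).mono fun v hv => by
      have hv' : (0 : ℝ) < v := hv
      have := (h _ (heatTime_pos hs hv')).const_mul (subDensity_pos v).le
      rw [heatTime_rpow hs hv', neg_neg] at this
      convert this using 1
      ring)
  convert this using 1
  rw [integral_const_mul, div_eq_mul_one_div s, Real.mul_rpow hs.le (by positivity)]
  ring

theorem SupMultiplier.exists_bessel {p γ : ℝ} (hp : 1 < p) (hγ : Module.finrank ℝ V / p < γ) :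
    ∃ C : ℝ, 0 ≤ C ∧ SupMultiplier p C (fun ξ : V => bessel γ ξ) := by
  obtain ⟨C, hC, h⟩ := SupMultiplier.exists_poisson (V := V) hp
  set δ : ℝ := Module.finrank ℝ V / p with hδ
  have hδ0 : 0 ≤ δ := by positivity
  have hγ0 : 0 < γ := by linarith
  have hi := integrableOn_gammaDensity_mul_rpow (γ := γ) (δ := -δ) (by linarith)
  simp_rw [bessel_eq_integral hγ0]
  have := SupMultiplier.integral (V := V) (p := p) (μ := volume.restrict (Set.Ioi (0 : ℝ)))
    (m := fun s ξ => (gammaDensity γ s : ℂ) * poisson s ξ)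
    (by unfold Function.uncurry; fun_prop) (g := gammaDensity γ)
    (integrableOn_gammaDensity hγ0)
    ((ae_restrict_mem measurableSet_Ioi).mono fun v hv ξ => by
      have hg := gammaDensity_pos hγ0 hv
      rw [norm_mul, Complex.norm_real, Real.norm_of_nonneg hg.le]
      exact mul_le_of_le_one_right hg.le (norm_poisson_le (Set.mem_Ioi.1 hv).le _))
    (a := fun s => C * (gammaDensity γ s * s ^ (-δ)))
    (by fun_prop) (hi.const_mul _)
    ((ae_restrict_mem measurableSet_Ioi).mono fun v hv => by
      have hv' : (0 : ℝ) < v := hv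
      have := gammaDensity_pos hγ0 hv
      positivity)
    ((ae_restrict_mem measurableSet_Ioi).mono fun v hv => by
      have hv' : (0 : ℝ) < v := hv
      have := (h _ hv').const_mul (gammaDensity_pos hγ0 hv).le
      convert this using 1
      ring)
  refine ⟨_, ?_, this⟩
  exact setIntegral_nonneg measurableSet_Ioi fun v hv =>
    mul_nonneg hC (mul_nonneg (gammaDensity_pos hγ0 hv).le (Real.rpow_nonneg (Set.mem_Ioi.1 hv).le _))

theorem LpMultiplier.bessel {p γ : ℝ} (hp : 1 < p) (hγ : 0 ≤ γ) :
    LpMultiplier p 1 (fun ξ : V => bessel γ ξ) := by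
  rcases hγ.eq_or_lt with rfl | hγ
  · simpa only [bessel_zero] using LpMultiplier.one p
  simp_rw [bessel_eq_integral hγ]
  rw [← ENNReal.ofReal_one, ← integral_gammaDensity hγ]
  have hb : ∀ᵐ s ∂(volume.restrict (Set.Ioi (0 : ℝ))), 0 < s := ae_restrict_mem measurableSet_Ioi
  refine LpMultiplier.integral_ofReal hp (by unfold Function.uncurry; fun_prop)
    (integrableOn_gammaDensity hγ) (hb.mono fun s hs ξ => ?_) (by fun_prop)
    (integrableOn_gammaDensity hγ) (hb.mono fun s hs => gammaDensity_pos hγ hs)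
    (hb.mono fun s hs => ?_)
  · have hg := gammaDensity_pos hγ hs
    rw [norm_mul, Complex.norm_real, Real.norm_of_nonneg hg.le]
    exact mul_le_of_le_one_right hg.le (norm_poisson_le hs.le _)
  · refine ((LpMultiplier.poisson hp hs.le).const_mul _).mono ?_
    rw [mul_one, ← ofReal_norm, Complex.norm_real, Real.norm_of_nonneg (gammaDensity_pos hγ hs).le]

theorem LpMultiplier.sub_planeWave_zero_mul (p : ℝ) (A : ℝ≥0∞) (m : V → ℂ) :
    LpMultiplier p A (fun ξ : V => (1 - _root_.planeWave 0 ξ) * m ξ) := by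
  have : (fun ξ : V => (1 - _root_.planeWave 0 ξ) * m ξ) = fun _ => 0 := by
    ext ξ; simp [_root_.planeWave]
  rw [this]
  exact (LpMultiplier.zero p).mono zero_le

theorem LpMultiplier.exists_sub_planeWave_mul_poisson (V : Type*) [NormedAddCommGroup V]
    [InnerProductSpace ℝ V] [FiniteDimensional ℝ V] [MeasurableSpace V] [BorelSpace V] {p : ℝ}
    (hp : 1 < p) {γ : ℝ} (hγ : 0 ≤ γ) (hγ1 : γ ≤ 1) :
    ∃ C : ℝ, 0 < C ∧ ∀ s, 0 < s → ∀ y : V,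
      LpMultiplier p (ENNReal.ofReal (C * (‖y‖ / s) ^ γ))
        (fun ξ : V => (1 - _root_.planeWave y ξ) * _root_.poisson s ξ) := by
  have hpi := Real.pi_pos
  set C := 4 * Real.pi * (∫ x : V, (1 + ‖x‖) * gauss x) with hCdef
  have hC : 0 < C := by
    have : (1 : ℝ) ≤ ∫ x : V, (1 + ‖x‖) * gauss x := by
      refine integral_gauss.symm.le.trans
        (integral_mono integrable_gauss integrable_one_add_norm_mul_gauss fun x => ?_)
      have := gauss_pos x
      have := norm_nonneg x
      simp only
      nlinarith
    positivity
  have hi := integrableOn_subDensity_mul_rpow (δ := γ) (by linarith)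
  have hI : 0 < ∫ v in Set.Ioi (0 : ℝ), subDensity v * v ^ γ := by
    rw [setIntegral_pos_iff_support_of_nonneg_ae _ hi]
    · have : Function.support (fun v => subDensity v * v ^ γ) ∩ Set.Ioi 0 = Set.Ioi 0 := by
        refine Set.inter_eq_right.2 fun v hv => ?_
        have hv' : (0 : ℝ) < v := hv
        have := subDensity_pos v
        exact ne_of_gt (by positivity : 0 < subDensity v * v ^ γ)
      rw [this]; simp
    · filter_upwards [ae_restrict_mem measurableSet_Ioi] with v hv
      exact mul_nonneg (subDensity_pos v).le (Real.rpow_nonneg (Set.mem_Ioi.1 hv).le _)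
  refine ⟨C * (2 * √Real.pi) ^ γ * ∫ v in Set.Ioi (0 : ℝ), subDensity v * v ^ γ, by positivity,
    fun s hs y => ?_⟩
  rcases eq_or_ne y 0 with rfl | hy
  · exact LpMultiplier.sub_planeWave_zero_mul _ _ _
  have hy' := norm_pos_iff.2 hy
  have hb : ∀ᵐ s ∂(volume.restrict (Set.Ioi (0 : ℝ))), 0 < s := ae_restrict_mem measurableSet_Ioi
  have := LpMultiplier.integral_ofReal (V := V) hp (μ := volume.restrict (Set.Ioi (0 : ℝ)))
    (m := fun v ξ => (1 - _root_.planeWave y ξ) *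
      ((subDensity v : ℂ) * _root_.heat (heatTime s v) ξ))
    (by unfold Function.uncurry; fun_prop) (g := fun v => 2 * subDensity v)
    (integrable_subDensity.integrableOn.const_mul 2)
    (Filter.Eventually.of_forall fun v ξ => by
      have := subDensity_pos v
      rw [norm_mul, norm_mul, Complex.norm_real, Real.norm_of_nonneg this.le]
      gcongr
      · exact norm_one_sub_planeWave_le _ _
      · exact mul_le_of_le_one_right this.le (norm_heat_le _ _))
    (a := fun v => C * (2 * √Real.pi) ^ γ * (‖y‖ / s) ^ γ * (subDensity v * v ^ γ))
    (by fun_prop) (hi.const_mul _)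
    (hb.mono fun v hv => by
      have := subDensity_pos v
      positivity)
    (hb.mono fun v hv => by
      have hv0 := subDensity_pos v
      have := (LpMultiplier.sub_planeWave_mul_heat hp (heatTime_pos hs hv) y hγ hγ1).const_mul
        (subDensity v : ℂ)
      have e : ‖(subDensity v : ℂ)‖ₑ * ENNReal.ofReal (C * (‖y‖ / heatTime s v) ^ γ) =
          ENNReal.ofReal (C * (2 * √Real.pi) ^ γ * (‖y‖ / s) ^ γ * (subDensity v * v ^ γ)) := by
        rw [← ofReal_norm, Complex.norm_real, Real.norm_of_nonneg hv0.le,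
          ← ENNReal.ofReal_mul hv0.le]
        congr 1
        rw [show ‖y‖ / heatTime s v = 2 * √Real.pi * (‖y‖ / s) * v by
          unfold heatTime; field_simp, Real.mul_rpow (by positivity) hv.le,
          Real.mul_rpow (by positivity) (by positivity)]
        ring
      rw [e] at this
      convert this using 2
      ring)
  rw [integral_const_mul] at this
  convert this using 2 with ξ
  · ring
  · rw [poisson_eq_integral hs.le, integral_const_mul]

theorem LpMultiplier.exists_sub_planeWave_mul_bessel (V : Type*) [NormedAddCommGroup V]
    [InnerProductSpace ℝ V] [FiniteDimensional ℝ V] [MeasurableSpace V] [BorelSpace V] {p : ℝ}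
    (hp : 1 < p) {γ γ' : ℝ} (hγ : 0 ≤ γ') (hγ1 : γ' ≤ 1) (hγγ : γ' < γ) :
    ∃ C : ℝ, 0 < C ∧ ∀ y : V, LpMultiplier p (ENNReal.ofReal (C * ‖y‖ ^ γ'))
        (fun ξ : V => (1 - _root_.planeWave y ξ) * _root_.bessel γ ξ) := by
  obtain ⟨C, hC, h⟩ := LpMultiplier.exists_sub_planeWave_mul_poisson V hp hγ hγ1
  have hγ0 : 0 < γ := by linarith
  have hi := integrableOn_gammaDensity_mul_rpow (γ := γ) (δ := -γ') (by linarith)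
  have hb : ∀ᵐ s ∂(volume.restrict (Set.Ioi (0 : ℝ))), 0 < s := ae_restrict_mem measurableSet_Ioi
  have hI : 0 < ∫ v in Set.Ioi (0 : ℝ), gammaDensity γ v * v ^ (-γ') := by
    rw [setIntegral_pos_iff_support_of_nonneg_ae _ hi]
    · have : Function.support (fun v => gammaDensity γ v * v ^ (-γ')) ∩ Set.Ioi 0 = Set.Ioi 0 := by
        refine Set.inter_eq_right.2 fun v hv => ?_
        have hv' : (0 : ℝ) < v := hv
        have := gammaDensity_pos hγ0 hv'
        exact ne_of_gt (by positivity : 0 < gammaDensity γ v * v ^ (-γ'))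
      rw [this]; simp
    · filter_upwards [hb] with v hv
      exact mul_nonneg (gammaDensity_pos hγ0 hv).le (Real.rpow_nonneg hv.le _)
  refine ⟨C * ∫ v in Set.Ioi (0 : ℝ), gammaDensity γ v * v ^ (-γ'), by positivity, fun y => ?_⟩
  rcases eq_or_ne y 0 with rfl | hy
  · exact LpMultiplier.sub_planeWave_zero_mul _ _ _
  have hy' := norm_pos_iff.2 hy
  have := LpMultiplier.integral_ofReal (V := V) hp (μ := volume.restrict (Set.Ioi (0 : ℝ)))
    (m := fun s ξ => (1 - _root_.planeWave y ξ) * ((gammaDensity γ s : ℂ) * _root_.poisson s ξ))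
    (by unfold Function.uncurry; fun_prop) (g := fun s => 2 * gammaDensity γ s)
    ((integrableOn_gammaDensity hγ0).const_mul 2)
    (hb.mono fun v hv ξ => by
      have := gammaDensity_pos hγ0 hv
      rw [norm_mul, norm_mul, Complex.norm_real, Real.norm_of_nonneg this.le]
      gcongr
      · exact norm_one_sub_planeWave_le _ _
      · exact mul_le_of_le_one_right this.le (norm_poisson_le hv.le _))
    (a := fun v => C * ‖y‖ ^ γ' * (gammaDensity γ v * v ^ (-γ')))
    (by fun_prop) (hi.const_mul _)
    (hb.mono fun v hv => by
      have := gammaDensity_pos hγ0 hv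
      positivity)
    (hb.mono fun v hv => by
      have hv0 := gammaDensity_pos hγ0 hv
      have := (h v hv y).const_mul (gammaDensity γ v : ℂ)
      have e : ‖(gammaDensity γ v : ℂ)‖ₑ * ENNReal.ofReal (C * (‖y‖ / v) ^ γ') =
          ENNReal.ofReal (C * ‖y‖ ^ γ' * (gammaDensity γ v * v ^ (-γ'))) := by
        rw [← ofReal_norm, Complex.norm_real, Real.norm_of_nonneg hv0.le,
          ← ENNReal.ofReal_mul hv0.le]
        congr 1
        rw [Real.div_rpow hy'.le hv.le, Real.rpow_neg hv.le]
        field_simp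
      rw [e] at this
      convert this using 2
      ring)
  rw [integral_const_mul] at this
  convert this using 2 with ξ
  · ring
  · rw [bessel_eq_integral hγ0, integral_const_mul]

end Bessel

section Sobolev

variable {V : Type*} [NormedAddCommGroup V] [InnerProductSpace ℝ V] [FiniteDimensional ℝ V]
  [MeasurableSpace V] [BorelSpace V]

theorem SupMultiplier.bilinMultiplier {p A : ℝ} {m : V → ℂ} (h : SupMultiplier p A m) :
    BilinMultiplier p (ENNReal.ofReal A) (fun _ η => m η) where
  meas := h.meas.comp measurable_snd
  bdd R := by
    obtain ⟨a, ha⟩ := h.bdd R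
    exact ⟨a, fun ξ η _ hη => ha η hη⟩
  bound φ ψ hφ hψ := by
    have e : bisynth (fun _ η => m η) φ ψ = fun x => synth φ x * synth (fun η => m η * ψ η) x := by
      ext x
      rw [bisynth, synth, synth, ← integral_prod_mul]
      congr 1; ext z
      rw [planeWave_add_right]; ring
    rw [e]
    set K := ENNReal.ofReal A * eLpNorm (synth ψ) (ENNReal.ofReal p) volume
    have : eLpNorm (fun x => synth φ x * synth (fun η => m η * ψ η) x) (ENNReal.ofReal p) volume ≤
        eLpNorm (synth φ) (ENNReal.ofReal p) volume * K := by
      by_cases hK : K = ⊤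
      · rcases eq_or_ne (eLpNorm (synth φ) (ENNReal.ofReal p) volume) 0 with h0 | h0
        · rcases eq_or_ne (ENNReal.ofReal p) 0 with hp | hp
          · simp [hp]
          have h1 := (eLpNorm_eq_zero_iff (measurable_synth hφ.meas).aestronglyMeasurable hp).1 h0
          rw [eLpNorm_congr_ae (g := fun _ => (0 : ℂ))]
          · simp
          · filter_upwards [h1] with x hx
            simp [hx]
        · simp [hK, h0]
      · lift K to NNReal using hK with k hk
        have := eLpNorm_le_nnreal_smul_eLpNorm_of_ae_le_mul (μ := (volume : Measure V)) (c := k)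
          (f := fun x => synth φ x * synth (fun η => m η * ψ η) x) (g := synth φ)
          (Filter.Eventually.of_forall fun x => by
            rw [nnnorm_mul, mul_comm]
            gcongr
            have := h.bound ψ hψ x
            change _ ≤ K at this
            rw [← hk] at this
            exact_mod_cast this) (ENNReal.ofReal p)
        rw [mul_comm]
        simpa [ENNReal.smul_def] using this
    refine this.trans (le_of_eq ?_)
    simp only [K]; ring

/-- Symbols of bilinear Fourier multipliers `L^p × L^p → L^p`. -/
def IsBilinMultiplier (p : ℝ) (σ : V → V → ℂ) : Prop :=
  ∃ C : ℝ≥0∞, C ≠ ⊤ ∧ BilinMultiplier p C σ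

theorem IsBilinMultiplier.bessel_mul_bessel {p u v : ℝ} (hp : 1 < p) (hu : 0 ≤ u) (hv : 0 ≤ v)
    (huv : Module.finrank ℝ V / p < u + v) :
    IsBilinMultiplier p (fun ξ η : V => bessel u ξ * bessel v η) := by
  set δ : ℝ := Module.finrank ℝ V / p with hδ
  have hδ0 : 0 ≤ δ := by positivity
  rcases hu.eq_or_lt with rfl | hu
  · obtain ⟨C, hC, h⟩ := SupMultiplier.exists_bessel (V := V) hp (by simpa using huv)
    exact ⟨_, ENNReal.ofReal_ne_top (r := C), by simpa [bessel_zero] using h.bilinMultiplier⟩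
  rcases hv.eq_or_lt with rfl | hv
  · obtain ⟨C, hC, h⟩ := SupMultiplier.exists_bessel (V := V) hp (by simpa using huv)
    exact ⟨_, ENNReal.ofReal_ne_top (r := C), by simpa [bessel_zero] using h.bilinMultiplier.swap⟩
  obtain ⟨C, hC, h⟩ := SupMultiplier.exists_poisson (V := V) hp
  set θ := u / (u + v) with hθ
  have hθ' : 1 - θ = v / (u + v) := by rw [hθ]; field_simp; ring
  have hθ0 : 0 ≤ θ := by positivity
  have hθ1 : 0 ≤ 1 - θ := by rw [hθ']; positivity
  have h1 : 0 < u + -(δ * θ) := by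
    have : δ * θ < u := by
      rw [hθ, mul_div_assoc', div_lt_iff₀ (by positivity)]; nlinarith
    linarith
  have h2 : 0 < v + -(δ * (1 - θ)) := by
    have : δ * (1 - θ) < v := by
      rw [hθ', mul_div_assoc', div_lt_iff₀ (by positivity)]; nlinarith
    linarith
  have hb : ∀ᵐ z ∂((volume.restrict (Set.Ioi (0 : ℝ))).prod (volume.restrict (Set.Ioi (0 : ℝ)))),
      0 < z.1 ∧ 0 < z.2 := by
    rw [Measure.prod_restrict]
    filter_upwards [ae_restrict_mem (measurableSet_Ioi.prod measurableSet_Ioi)] with z hz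
    exact hz
  have hC' : 0 < C + 1 := by linarith
  have key := BilinMultiplier.integral_ofReal (V := V) hp
    (μ := (volume.restrict (Set.Ioi (0 : ℝ))).prod (volume.restrict (Set.Ioi (0 : ℝ))))
    (σ := fun z ξ η => ((gammaDensity u z.1 : ℂ) * poisson z.1 ξ) *
      ((gammaDensity v z.2 : ℂ) * poisson z.2 η)) (by fun_prop)
    (fun R => ⟨fun z => gammaDensity u z.1 * gammaDensity v z.2,
      (integrableOn_gammaDensity hu).mul_prod (integrableOn_gammaDensity hv), by
        filter_upwards [hb] with z hz ξ η _ _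
        have h1 := gammaDensity_pos hu hz.1
        have h2 := gammaDensity_pos hv hz.2
        rw [norm_mul, norm_mul, norm_mul, Complex.norm_real, Complex.norm_real,
          Real.norm_of_nonneg h1.le, Real.norm_of_nonneg h2.le]
        gcongr
        · exact mul_le_of_le_one_right h1.le (norm_poisson_le hz.1.le _)
        · exact mul_le_of_le_one_right h2.le (norm_poisson_le hz.2.le _)⟩)
    (a := fun z => (C + 1) * ((gammaDensity u z.1 * z.1 ^ (-(δ * θ))) *
      (gammaDensity v z.2 * z.2 ^ (-(δ * (1 - θ)))))) (by fun_prop)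
    (((integrableOn_gammaDensity_mul_rpow h1).mul_prod
      (integrableOn_gammaDensity_mul_rpow h2)).const_mul _)
    (by
      filter_upwards [hb] with z ⟨hz1, hz2⟩
      have h1 := gammaDensity_pos hu hz1
      have h2 := gammaDensity_pos hv hz2
      positivity)
    (by
      filter_upwards [hb] with z ⟨hz1, hz2⟩
      have h1 := gammaDensity_pos hu hz1
      have h2 := gammaDensity_pos hv hz2
      have key : BilinMultiplier p (ENNReal.ofReal ((C + 1) * (z.1 ^ (-(δ * θ)) *
          z.2 ^ (-(δ * (1 - θ)))))) fun ξ η : V => poisson z.1 ξ * poisson z.2 η := by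
        have hr : min (z.1 ^ (-δ)) (z.2 ^ (-δ)) ≤ z.1 ^ (-(δ * θ)) * z.2 ^ (-(δ * (1 - θ))) := by
          rw [show -(δ * θ) = (-δ) * θ by ring, show -(δ * (1 - θ)) = (-δ) * (1 - θ) by ring,
            Real.rpow_mul hz1.le, Real.rpow_mul hz2.le]
          set x := z.1 ^ (-δ)
          set y := z.2 ^ (-δ)
          have hx : 0 < x := by positivity
          have hy : 0 < y := by positivity
          have hm : 0 < min x y := lt_min hx hy
          calc min x y = min x y ^ θ * min x y ^ (1 - θ) := by
                rw [← Real.rpow_add hm]; simp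
            _ ≤ _ := by gcongr <;> simp
        rcases le_total (z.1 ^ (-δ)) (z.2 ^ (-δ)) with hle | hle
        · rw [min_eq_left hle] at hr
          have := ((h z.1 hz1).bilinMultiplier.swap).mul_right (LpMultiplier.poisson hp hz2.le)
          simp only [mul_comm (poisson z.1 _)]
          refine this.mono ?_
          rw [one_mul]
          refine ENNReal.ofReal_le_ofReal ?_
          gcongr
          linarith
        · rw [min_eq_right hle] at hr
          have := ((h z.2 hz2).bilinMultiplier).mul_left (LpMultiplier.poisson hp hz1.le)
          refine this.mono ?_
          rw [one_mul]
          refine ENNReal.ofReal_le_ofReal ?_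
          gcongr
          linarith
      have e : (fun ξ η : V => ((gammaDensity u z.1 : ℂ) * poisson z.1 ξ) *
          ((gammaDensity v z.2 : ℂ) * poisson z.2 η)) = fun ξ η =>
          ((gammaDensity u z.1 * gammaDensity v z.2 : ℝ) : ℂ) * (poisson z.1 ξ * poisson z.2 η) := by
        ext; push_cast; ring
      rw [e]
      refine (key.const_mul _).mono (le_of_eq ?_)
      rw [← ofReal_norm, Complex.norm_real, Real.norm_of_nonneg (by positivity),
        ← ENNReal.ofReal_mul (by positivity)]
      congr 1
      ring)
  simp only [bessel_eq_integral hu, bessel_eq_integral hv, ← integral_prod_mul]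
  exact ⟨_, ENNReal.ofReal_ne_top, key⟩

namespace IsBilinMultiplier

variable {p : ℝ} {σ τ : V → V → ℂ} {m : V → ℂ} {A : ℝ≥0∞}

theorem add (hp : 1 < p) (h : IsBilinMultiplier p σ) (h' : IsBilinMultiplier p τ) :
    IsBilinMultiplier p (fun ξ η => σ ξ η + τ ξ η) := by
  obtain ⟨B, hB, h⟩ := h
  obtain ⟨C, hC, h'⟩ := h'
  exact ⟨B + C, ENNReal.add_ne_top.2 ⟨hB, hC⟩, h.add hp h'⟩

theorem congr (h : IsBilinMultiplier p σ) (e : ∀ ξ η, σ ξ η = τ ξ η) : IsBilinMultiplier p τ := by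
  rwa [show τ = σ by ext ξ η; exact (e ξ η).symm]

theorem const_mul (c : ℂ) (h : IsBilinMultiplier p σ) :
    IsBilinMultiplier p (fun ξ η => c * σ ξ η) := by
  obtain ⟨B, hB, h⟩ := h
  exact ⟨_, ENNReal.mul_ne_top enorm_ne_top hB, h.const_mul c⟩

theorem mul_left (h : IsBilinMultiplier p σ) (hA : A ≠ ⊤) (h' : LpMultiplier p A m) :
    IsBilinMultiplier p (fun ξ η => m ξ * σ ξ η) := by
  obtain ⟨B, hB, h⟩ := h
  exact ⟨_, ENNReal.mul_ne_top hA hB, h.mul_left h'⟩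

theorem mul_right (h : IsBilinMultiplier p σ) (hA : A ≠ ⊤) (h' : LpMultiplier p A m) :
    IsBilinMultiplier p (fun ξ η => m η * σ ξ η) := by
  obtain ⟨B, hB, h⟩ := h
  exact ⟨_, ENNReal.mul_ne_top hA hB, h.mul_right h'⟩

end IsBilinMultiplier

end Sobolev

section Leibniz

theorem integrableOn_rpow_mul_one_sub_exp {γ r : ℝ} (h0 : 0 < γ) (h1 : γ < 1) (hr : 0 < r) :
    IntegrableOn (fun t => t ^ (-(1 + γ)) * (1 - Real.exp (-(t * r)))) (Set.Ioi 0) := by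
  rw [← Set.Ioc_union_Ioi_eq_Ioi (zero_le_one (α := ℝ))]
  have hm : AEStronglyMeasurable (fun t : ℝ => t ^ (-(1 + γ)) * (1 - Real.exp (-(t * r)))) :=
    Measurable.aestronglyMeasurable (by fun_prop)
  refine IntegrableOn.union ?_ ?_
  · have hi : IntegrableOn (fun t : ℝ => r * t ^ (-γ)) (Set.Ioc 0 1) := by
      have := (intervalIntegral.intervalIntegrable_rpow' (a := 0) (b := 1) (r := -γ) (by linarith))
      exact ((intervalIntegrable_iff_integrableOn_Ioc_of_le zero_le_one).1 this).const_mul _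
    refine hi.mono' hm.restrict ?_
    filter_upwards [ae_restrict_mem measurableSet_Ioc] with t ht
    have h2 : Real.exp (-(t * r)) ≤ 1 := Real.exp_le_one_iff.2 (by nlinarith [ht.1])
    have h3 : 1 - Real.exp (-(t * r)) ≤ t * r := by linarith [Real.add_one_le_exp (-(t * r))]
    have h4 : 0 < t ^ (-(1 + γ)) := Real.rpow_pos_of_pos ht.1 _
    rw [Real.norm_of_nonneg (by nlinarith)]
    calc _ ≤ t ^ (-(1 + γ)) * (t * r) := by gcongr
      _ = r * (t ^ (-(1 + γ)) * t ^ (1 : ℝ)) := by rw [Real.rpow_one]; ring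
      _ = _ := by rw [← Real.rpow_add ht.1]; ring_nf
  · have hi : IntegrableOn (fun t : ℝ => t ^ (-(1 + γ))) (Set.Ioi 1) :=
      integrableOn_Ioi_rpow_of_lt (by linarith) one_pos
    refine hi.mono' hm.restrict ?_
    filter_upwards [ae_restrict_mem measurableSet_Ioi] with t ht
    have ht0 : 0 < t := one_pos.trans ht
    have h2 : Real.exp (-(t * r)) ≤ 1 := Real.exp_le_one_iff.2 (by nlinarith)
    have h4 : 0 < t ^ (-(1 + γ)) := Real.rpow_pos_of_pos ht0 _
    rw [Real.norm_of_nonneg (by nlinarith)]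
    exact mul_le_of_le_one_right h4.le (by linarith [Real.exp_pos (-(t * r))])

theorem integral_rpow_mul_one_sub_exp {γ r : ℝ} (hr : 0 < r) :
    ∫ t in Set.Ioi (0 : ℝ), t ^ (-(1 + γ)) * (1 - Real.exp (-(t * r))) =
      r ^ γ * ∫ t in Set.Ioi (0 : ℝ), t ^ (-(1 + γ)) * (1 - Real.exp (-t)) := by
  have := integral_comp_mul_right_Ioi (fun t => t ^ (-(1 + γ)) * (1 - Real.exp (-t))) 0 hr
  rw [zero_mul, smul_eq_mul] at this
  rw [← mul_inv_cancel_left₀ hr.ne' (∫ t in Set.Ioi (0 : ℝ), t ^ (-(1 + γ)) * (1 - Real.exp (-t))),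
    ← this, ← integral_const_mul, ← integral_const_mul]
  refine setIntegral_congr_fun measurableSet_Ioi fun t ht => ?_
  have ht' : (0 : ℝ) < t := ht
  rw [Real.mul_rpow ht'.le hr.le, show -(1 + γ) = -1 + -γ by ring, Real.rpow_add hr,
    Real.rpow_neg hr.le γ, Real.rpow_neg_one]
  field_simp

theorem integral_rpow_mul_one_sub_exp_pos {γ : ℝ} (h0 : 0 < γ) (h1 : γ < 1) :
    0 < ∫ t in Set.Ioi (0 : ℝ), t ^ (-(1 + γ)) * (1 - Real.exp (-t)) := by
  have hi := integrableOn_rpow_mul_one_sub_exp h0 h1 one_pos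
  simp only [mul_one] at hi
  have hp : ∀ t : ℝ, 0 < t → 0 < t ^ (-(1 + γ)) * (1 - Real.exp (-t)) := fun t ht => by
    have : Real.exp (-t) < 1 := Real.exp_lt_one_iff.2 (by linarith)
    have := sub_pos.2 this
    positivity
  rw [setIntegral_pos_iff_support_of_nonneg_ae _ hi]
  · have : Function.support (fun t : ℝ => t ^ (-(1 + γ)) * (1 - Real.exp (-t))) ∩ Set.Ioi 0 =
        Set.Ioi 0 := Set.inter_eq_right.2 fun t ht => (hp t ht).ne'
    rw [this]; simp
  · filter_upwards [ae_restrict_mem measurableSet_Ioi] with t ht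
    exact (hp t ht).le

variable {V : Type*} [NormedAddCommGroup V]

/-- The defect of additivity of the symbol `(1 + ‖ξ‖)^γ`. -/
noncomputable def besselDefect (γ : ℝ) (ξ η : V) : ℂ :=
  bessel (-γ) (ξ + η) - bessel (-γ) ξ - bessel (-γ) η

theorem integral_rpow_mul_exp_mul_poisson {γ : ℝ} (h0 : 0 < γ) (h1 : γ < 1) (ξ η : V) :
    ∫ t in Set.Ioi (0 : ℝ), ((t ^ (-(1 + γ)) * Real.exp (-t) : ℝ) : ℂ) *
      (1 - poisson t ξ - poisson t η + poisson t (ξ + η)) =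
    -((∫ t in Set.Ioi (0 : ℝ), t ^ (-(1 + γ)) * (1 - Real.exp (-t)) : ℝ) : ℂ) *
      (besselDefect γ ξ η + 1) := by
  have hi : ∀ ξ : V, IntegrableOn (fun t => t ^ (-(1 + γ)) * (1 - Real.exp (-(t * (1 + ‖ξ‖)))))
    (Set.Ioi 0) := fun ξ => integrableOn_rpow_mul_one_sub_exp h0 h1 (by positivity)
  have hI : ∀ ξ : V, ∫ t in Set.Ioi (0 : ℝ), t ^ (-(1 + γ)) * (1 - Real.exp (-(t * (1 + ‖ξ‖)))) = _ :=
    fun ξ => integral_rpow_mul_one_sub_exp (γ := γ) (by positivity)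
  have hi0 := integrableOn_rpow_mul_one_sub_exp h0 h1 one_pos
  simp only [mul_one] at hi0
  simp only [poisson, besselDefect, bessel, neg_neg]
  norm_cast
  have e : ∀ t : ℝ, t ^ (-(1 + γ)) * Real.exp (-t) * (1 - Real.exp (-(t * ‖ξ‖)) -
      Real.exp (-(t * ‖η‖)) + Real.exp (-(t * ‖ξ + η‖))) =
      t ^ (-(1 + γ)) * (1 - Real.exp (-(t * (1 + ‖ξ‖)))) +
      t ^ (-(1 + γ)) * (1 - Real.exp (-(t * (1 + ‖η‖)))) -
      t ^ (-(1 + γ)) * (1 - Real.exp (-(t * (1 + ‖ξ + η‖)))) -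
      t ^ (-(1 + γ)) * (1 - Real.exp (-t)) := fun t => by
    simp only [mul_add, mul_one, neg_add, Real.exp_add]; ring
  simp_rw [e]
  have i1 := (hi ξ).add (hi η)
  have i2 := i1.sub (hi (ξ + η))
  simp only [Pi.add_def, Pi.sub_def] at i1 i2
  rw [integral_sub i2 hi0, integral_sub i1 (hi (ξ + η)), integral_add (hi ξ) (hi η), hI, hI, hI]
  ring

variable [InnerProductSpace ℝ V]

theorem norm_one_sub_planeWave_le_rpow {y ξ : V} {R θ : ℝ} (hξ : ‖ξ‖ ≤ R) (h0 : 0 ≤ θ)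
    (h1 : θ ≤ 1) : ‖1 - planeWave y ξ‖ ≤ 2 * (2 * Real.pi * R * ‖y‖) ^ θ := by
  have hpi := Real.pi_pos
  have hR : 0 ≤ R := (norm_nonneg _).trans hξ
  have h : ‖1 - planeWave y ξ‖ ≤ 2 * Real.pi * R * ‖y‖ := by
    rw [norm_sub_rev, planeWave, mul_comm _ Complex.I]
    refine (Real.norm_exp_I_mul_ofReal_sub_one_le).trans ?_
    rw [norm_mul, Real.norm_of_nonneg (by positivity), mul_assoc _ R]
    gcongr
    calc _ ≤ ‖y‖ * ‖ξ‖ := norm_inner_le_norm _ _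
      _ ≤ _ := by rw [mul_comm]; gcongr
  set x := 2 * Real.pi * R * ‖y‖
  have hx : 0 ≤ x := by positivity
  have h2 := norm_one_sub_planeWave_le y ξ
  rcases le_total x 1 with hx1 | hx1
  · have : x ≤ x ^ θ := by
      rcases hx.eq_or_lt with h' | h'
      · rw [← h']; positivity
      · simpa using Real.rpow_le_rpow_of_exponent_ge h' hx1 h1
    linarith
  · have := Real.one_le_rpow hx1 h0
    linarith

variable [FiniteDimensional ℝ V] [MeasurableSpace V] [BorelSpace V]

theorem integral_one_sub_planeWave_mul {P : Measure V} [IsProbabilityMeasure P]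
    (hP : ∀ s, 0 ≤ s → ∀ ξ : V, ∫ y, planeWave (s • y) ξ ∂P = poisson s ξ) {t : ℝ} (ht : 0 ≤ t)
    (ξ η : V) : ∫ y, (1 - planeWave (t • y) ξ) * (1 - planeWave (t • y) η) ∂P =
      1 - poisson t ξ - poisson t η + poisson t (ξ + η) := by
  have hi : ∀ ξ : V, Integrable (fun y => planeWave (t • y) ξ) P := fun ξ =>
    Integrable.of_bound (Measurable.aestronglyMeasurable (by fun_prop)) 1
      (Filter.Eventually.of_forall fun y => (norm_planeWave _ _).le)
  have e : ∀ y, (1 - planeWave (t • y) ξ) * (1 - planeWave (t • y) η) =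
      1 - planeWave (t • y) ξ - planeWave (t • y) η + planeWave (t • y) (ξ + η) := fun y => by
    rw [planeWave_add_right]; ring
  simp_rw [e]
  have i1 : Integrable (fun y => 1 - planeWave (t • y) ξ) P := (integrable_const _).sub (hi _)
  have i2 : Integrable (fun y => 1 - planeWave (t • y) ξ - planeWave (t • y) η) P := i1.sub (hi _)
  rw [integral_add i2 (hi _), integral_sub i1 (hi _), integral_sub (integrable_const _) (hi _),
    hP t ht, hP t ht, hP t ht]
  simp

theorem IsBilinMultiplier.besselDefect_mul {p : ℝ} (hp : 1 < p) {σ : V → V → ℂ}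
    (hσ : IsBilinMultiplier p σ) {γ μ : ℝ} (h0 : 0 < γ) (h1 : γ < 1) (hμ : γ / 2 < μ) :
    IsBilinMultiplier p (fun ξ η => besselDefect γ ξ η * (bessel μ ξ * (bessel μ η * σ ξ η))) := by
  obtain ⟨P, hP, hP1, hP2⟩ := exists_poisson_law (V := V)
  obtain ⟨θ, hθ, hθ'⟩ := exists_between (show γ / 2 < min (1 / 2) μ from lt_min (by linarith) hμ)
  have hθ2 : θ < 1 / 2 := hθ'.trans_le (min_le_left _ _)
  have hθμ : θ < μ := hθ'.trans_le (min_le_right _ _)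
  have hθ0 : 0 < θ := by linarith
  obtain ⟨C, hC, hK⟩ := LpMultiplier.exists_sub_planeWave_mul_bessel V hp hθ0.le (by linarith) hθμ
  obtain ⟨A, hA, hσ⟩ := hσ
  have hyi := hP2 (2 * θ) (by linarith) (by linarith)
  have hti : IntegrableOn (fun t : ℝ => t ^ (-(1 + γ) + 2 * θ) * Real.exp (-t)) (Set.Ioi 0) := by
    have := Real.GammaIntegral_convergent (s := 2 * θ - γ) (by linarith)
    refine this.congr_fun (fun t _ => ?_) measurableSet_Ioi
    simp only
    rw [mul_comm]; congr 2; ring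
  set M := (volume.restrict (Set.Ioi (0 : ℝ))).prod P with hM
  have hb : ∀ᵐ z ∂M, 0 < z.1 := by
    have : ∀ᵐ t ∂(volume.restrict (Set.Ioi (0 : ℝ))), 0 < t := ae_restrict_mem measurableSet_Ioi
    exact (Measure.quasiMeasurePreserving_fst).ae this
  set k : ℝ × V → V → V → ℂ := fun z ξ η => ((z.1 ^ (-(1 + γ)) * Real.exp (-z.1) : ℝ) : ℂ) *
    ((1 - planeWave (z.1 • z.2) ξ) * (1 - planeWave (z.1 • z.2) η)) with hk
  have hkm : Measurable fun z : (ℝ × V) × V × V => k z.1 z.2.1 z.2.2 := by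
    simp only [hk]; fun_prop
  have hpi := Real.pi_pos
  have hkb : ∀ R : ℝ, ∃ B : ℝ, ∀ᵐ z ∂M, ∀ ξ η, ‖ξ‖ ≤ R → ‖η‖ ≤ R → ‖k z ξ η‖ ≤
      B * (z.1 ^ (-(1 + γ) + 2 * θ) * Real.exp (-z.1) * ‖z.2‖ ^ (2 * θ)) := fun R => by
    refine ⟨4 * (2 * Real.pi * |R|) ^ (2 * θ), ?_⟩
    filter_upwards [hb] with z hz ξ η hξ hη
    have hξ' := norm_one_sub_planeWave_le_rpow (y := z.1 • z.2) (hξ.trans (le_abs_self R)) hθ0.le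
      (by linarith)
    have hη' := norm_one_sub_planeWave_le_rpow (y := z.1 • z.2) (hη.trans (le_abs_self R)) hθ0.le
      (by linarith)
    rw [hk]
    simp only
    rw [norm_mul, norm_mul, Complex.norm_real, Real.norm_of_nonneg (by positivity)]
    refine (mul_le_mul_of_nonneg_left (mul_le_mul hξ' hη' (by positivity) (by positivity))
      (by positivity)).trans (le_of_eq ?_)
    rw [norm_smul, Real.norm_of_nonneg hz.le,
      show 2 * Real.pi * |R| * (z.1 * ‖z.2‖) = (2 * Real.pi * |R|) * (z.1 * ‖z.2‖) by ring,
      Real.mul_rpow (by positivity) (by positivity), Real.mul_rpow hz.le (by positivity),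
      Real.rpow_add hz, two_mul θ, Real.rpow_add hz, Real.rpow_add_of_nonneg (by positivity) hθ0.le hθ0.le,
      Real.rpow_add_of_nonneg (by positivity) hθ0.le hθ0.le]
    ring
  have hki : ∀ ξ η, Integrable (fun z => k z ξ η) M := fun ξ η => by
    obtain ⟨B, hB⟩ := hkb (max ‖ξ‖ ‖η‖)
    refine ((hti.mul_prod hyi).const_mul B).mono' (Measurable.aestronglyMeasurable ?_) ?_
    · simp only [hk]; fun_prop
    · filter_upwards [hB] with z hz using hz ξ η (le_max_left _ _) (le_max_right _ _)
  have hintegral : ∀ ξ η, ∫ z, k z ξ η ∂M =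
      -((∫ t in Set.Ioi (0 : ℝ), t ^ (-(1 + γ)) * (1 - Real.exp (-t)) : ℝ) : ℂ) *
      (besselDefect γ ξ η + 1) := fun ξ η => by
    rw [hM, integral_prod _ (hki ξ η), ← integral_rpow_mul_exp_mul_poisson h0 h1]
    refine setIntegral_congr_fun measurableSet_Ioi fun t ht => ?_
    simp only [hk]
    rw [integral_const_mul, integral_one_sub_planeWave_mul hP1 (Set.mem_Ioi.1 ht).le]
  have hc := integral_rpow_mul_one_sub_exp_pos h0 h1
  set c := ∫ t in Set.Ioi (0 : ℝ), t ^ (-(1 + γ)) * (1 - Real.exp (-t))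
  set τ : V → V → ℂ := fun ξ η => bessel μ ξ * (bessel μ η * σ ξ η) with hτ
  have hbm := LpMultiplier.bessel (V := V) hp (show 0 ≤ μ by linarith)
  have hτB := (hσ.mul_right hbm).mul_left hbm
  set D := A.toReal + 1 with hD
  have hAD : A ≤ ENNReal.ofReal D := by
    rw [hD, ENNReal.ofReal_add ENNReal.toReal_nonneg zero_le_one, ENNReal.ofReal_toReal hA]
    exact le_self_add
  have hD0 : 0 < D := by positivity
  have key := BilinMultiplier.integral_ofReal (V := V) hp (μ := M)
    (σ := fun z ξ η => k z ξ η * τ ξ η) (hkm.mul (hτB.meas.comp measurable_snd))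
    (fun R => by
      obtain ⟨B, hB⟩ := hkb R
      obtain ⟨B', hB'⟩ := hτB.bdd R
      refine ⟨fun z => B * (z.1 ^ (-(1 + γ) + 2 * θ) * Real.exp (-z.1) * ‖z.2‖ ^ (2 * θ)) * B',
        ((hti.mul_prod hyi).const_mul B).mul_const B', ?_⟩
      filter_upwards [hB] with z hz ξ η hξ hη
      rw [norm_mul]
      exact mul_le_mul (hz ξ η hξ hη) (hB' ξ η hξ hη) (norm_nonneg _)
        ((norm_nonneg _).trans (hz ξ η hξ hη)))
    (a := fun z => C ^ 2 * D * (z.1 ^ (-(1 + γ) + 2 * θ) * Real.exp (-z.1) *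
      (‖z.2‖ ^ (2 * θ) + 1))) (by fun_prop)
    ((hti.mul_prod (hyi.add (integrable_const 1))).const_mul _)
    (by
      filter_upwards [hb] with z hz
      positivity)
    (by
      filter_upwards [hb] with z hz
      have h := (((hσ.mul_right (hK (z.1 • z.2))).mul_left (hK (z.1 • z.2))).const_mul
        ((z.1 ^ (-(1 + γ)) * Real.exp (-z.1) : ℝ) : ℂ))
      have e : (fun ξ η => k z ξ η * τ ξ η) = fun ξ η =>
          ((z.1 ^ (-(1 + γ)) * Real.exp (-z.1) : ℝ) : ℂ) *
          ((1 - planeWave (z.1 • z.2) ξ) * bessel μ ξ *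
            ((1 - planeWave (z.1 • z.2) η) * bessel μ η * σ ξ η)) := by
        ext; simp only [hk, hτ]; ring
      rw [e]
      refine h.mono ?_
      rw [← ofReal_norm, Complex.norm_real, Real.norm_of_nonneg (by positivity)]
      calc _ ≤ ENNReal.ofReal (z.1 ^ (-(1 + γ)) * Real.exp (-z.1)) *
            (ENNReal.ofReal (C * ‖z.1 • z.2‖ ^ θ) *
            (ENNReal.ofReal (C * ‖z.1 • z.2‖ ^ θ) * ENNReal.ofReal D)) := by gcongr
        _ = ENNReal.ofReal (C ^ 2 * D * (z.1 ^ (-(1 + γ) + 2 * θ) * Real.exp (-z.1) *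
            (‖z.2‖ ^ (2 * θ)))) := by
          rw [← ENNReal.ofReal_mul (by positivity), ← ENNReal.ofReal_mul (by positivity),
            ← ENNReal.ofReal_mul (by positivity)]
          congr 1
          rw [norm_smul, Real.norm_of_nonneg hz.le, Real.mul_rpow hz.le (by positivity),
            Real.rpow_add hz, two_mul θ, Real.rpow_add hz,
            Real.rpow_add_of_nonneg (by positivity) hθ0.le hθ0.le]
          ring
        _ ≤ _ := by
          refine ENNReal.ofReal_le_ofReal ?_
          gcongr
          linarith)
  refine ((IsBilinMultiplier.const_mul (-(c : ℂ)⁻¹) ⟨_, ENNReal.ofReal_ne_top, key⟩).add hp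
    (IsBilinMultiplier.const_mul (-1) ⟨_, ?_, hτB⟩)).congr fun ξ η => ?_
  · simpa using hA
  · rw [integral_mul_const, hintegral]
    have : (c : ℂ) ≠ 0 := by exact_mod_cast hc.ne'
    field_simp
    ring

end Leibniz

section Algebra

variable {V : Type*} [NormedAddCommGroup V] [InnerProductSpace ℝ V] [FiniteDimensional ℝ V]
  [MeasurableSpace V] [BorelSpace V]

theorem IsBilinMultiplier.bessel_add_mul {p γ : ℝ} (hp : 1 < p) (h0 : 0 < γ) (h1 : γ < 1) (k : ℕ) :
    ∀ u v : ℝ, k * γ ≤ u → k * γ ≤ v → Module.finrank ℝ V / p + k * γ < u + v →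
      IsBilinMultiplier p (fun ξ η : V =>
        bessel (-(k * γ)) (ξ + η) * (bessel u ξ * bessel v η)) := by
  induction k with
  | zero =>
    intro u v hu hv huv
    simp only [Nat.cast_zero, zero_mul, add_zero] at hu hv huv
    simpa [bessel_zero] using IsBilinMultiplier.bessel_mul_bessel hp hu hv huv
  | succ k ih =>
    intro u v hu hv huv
    push_cast at hu hv huv ⊢
    obtain ⟨ε, hε0, hε⟩ := exists_between (show 0 < min γ
      (u + v - γ - (Module.finrank ℝ V / p + k * γ)) from lt_min h0 (by linarith))
    have hε1 := hε.trans_le (min_le_left _ _)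
    have hε2 := hε.trans_le (min_le_right _ _)
    set μ := (γ + ε) / 2 with hμ
    have t1 := ih (u - γ) v (by linarith) (by linarith) (by linarith)
    have t2 := ih u (v - γ) (by linarith) (by linarith) (by linarith)
    have t3 := (ih (u - μ) (v - μ) (by linarith) (by linarith) (by linarith)).besselDefect_mul hp h0
      h1 (show γ / 2 < μ by linarith)
    refine ((t1.add hp t2).add hp t3).congr fun ξ η => ?_
    have e1 : bessel u ξ = bessel μ ξ * bessel (u - μ) ξ := by rw [← bessel_add]; ring_nf
    have e2 : bessel v η = bessel μ η * bessel (v - μ) η := by rw [← bessel_add]; ring_nf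
    have e3 : bessel (u - γ) ξ = bessel (-γ) ξ * bessel u ξ := by rw [← bessel_add]; ring_nf
    have e4 : bessel (v - γ) η = bessel (-γ) η * bessel v η := by rw [← bessel_add]; ring_nf
    have e5 : bessel (-((k + 1) * γ)) (ξ + η) =
      bessel (-γ) (ξ + η) * bessel (-(k * γ)) (ξ + η) := by rw [← bessel_add]; ring_nf
    rw [e3, e4, e5, besselDefect, e1, e2]
    ring

/-- The algebra property of Bessel potential spaces, in multiplier form. -/
theorem IsBilinMultiplier.bessel_add_mul_bessel {p β : ℝ} (hp : 1 < p)
    (hβ : Module.finrank ℝ V / p < β) :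
    IsBilinMultiplier p (fun ξ η : V => bessel (-β) (ξ + η) * (bessel β ξ * bessel β η)) := by
  have hβ0 : 0 < β := lt_of_le_of_lt (by positivity) hβ
  obtain ⟨k, hk⟩ := exists_nat_gt β
  have hk0 : (0 : ℝ) < k := hβ0.trans hk
  have e : k * (β / k) = β := by field_simp
  have := IsBilinMultiplier.bessel_add_mul (V := V) hp (show 0 < β / k by positivity)
    ((div_lt_one hk0).2 hk) k β β
  rw [e] at this
  exact this le_rfl le_rfl (by linarith)

end Algebra

/-! ### Plancherel for band-limited functions -/

section Plancherel

variable {V : Type*} [NormedAddCommGroup V] [InnerProductSpace ℝ V] [FiniteDimensional ℝ V]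
  [MeasurableSpace V] [BorelSpace V]

theorem continuous_synth {φ : V → ℂ} (hφ : Integrable φ) : Continuous (synth φ) := by
  refine continuous_of_dominated (bound := fun ξ => ‖φ ξ‖) (fun x => ?_) (fun x => ?_) hφ.norm ?_
  · exact (integrable_synth hφ x).aestronglyMeasurable
  · filter_upwards with ξ
    rw [norm_mul, norm_planeWave, one_mul]
  · filter_upwards with ξ
    exact (continuous_id.planeWave continuous_const).mul continuous_const

theorem BandLimited.memLp {φ : V → ℂ} (hφ : BandLimited φ) (p : ℝ≥0∞) : MemLp φ p := by
  obtain ⟨C, hC⟩ := hφ.bdd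
  obtain ⟨R, hR⟩ := hφ.supp
  have h : MemLp ((Metric.closedBall (0 : V) R).indicator φ) p := by
    rw [memLp_indicator_iff_restrict measurableSet_closedBall]
    have : IsFiniteMeasure ((volume : Measure V).restrict (Metric.closedBall 0 R)) :=
      ⟨by simpa using measure_closedBall_lt_top⟩
    exact MemLp.of_bound hφ.meas.aestronglyMeasurable C (ae_of_all _ hC)
  convert h using 1
  ext ξ
  by_cases hξ : ξ ∈ Metric.closedBall (0 : V) R
  · rw [Set.indicator_of_mem hξ]
  · rw [Set.indicator_of_notMem hξ]
    exact hR ξ (by simpa using hξ)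

theorem integral_mul_synth {φ s : V → ℂ} (hφ : Integrable φ) (hs : Integrable s) :
    ∫ x, s x * synth φ x = ∫ ξ, synth s ξ * φ ξ := by
  simp_rw [synth, ← integral_const_mul, ← integral_mul_const]
  rw [integral_integral_swap]
  · refine integral_congr_ae (ae_of_all _ fun ξ => integral_congr_ae (ae_of_all _ fun x => ?_))
    simp only [_root_.planeWave, real_inner_comm]
    ring
  · refine ((hs.mul_prod hφ).bdd_mul (c := 1) (f := fun z : V × V => planeWave z.1 z.2)
      ?_ ?_).congr ?_
    · exact (continuous_fst.planeWave continuous_snd).aestronglyMeasurable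
    · exact ae_of_all _ fun z => (norm_planeWave _ _).le
    · exact ae_of_all _ fun z => by simp only [Function.uncurry]; ring

theorem fourierInv_eq_synth (φ : V → ℂ) : 𝓕⁻ φ = synth φ := by
  ext x
  rw [Real.fourierInv_eq', synth]
  refine integral_congr_ae (ae_of_all _ fun ξ => ?_)
  simp only [planeWave, smul_eq_mul, real_inner_comm]

/-- Plancherel's theorem for the inverse Fourier transform of a band-limited function. -/
theorem BandLimited.eLpNorm_synth_two {φ : V → ℂ} (hφ : BandLimited φ) :
    eLpNorm (synth φ) 2 volume = eLpNorm φ 2 volume := by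
  set F := (hφ.memLp 2).toLp φ
  have h1 : ∀ᵐ x, (𝓕⁻ F : Lp ℂ 2 (volume : Measure V)) x = synth φ x := by
    refine ae_eq_of_integral_contDiff_smul_eq ?_
      (continuous_synth hφ.integrable).locallyIntegrable fun g hg hgc => ?_
    · exact (Lp.memLp _).locallyIntegrable (by norm_num)
    · have hg' : ContDiff ℝ (⊤ : ℕ∞) (fun x => (g x : ℂ)) := Complex.ofRealCLM.contDiff.comp hg
      have hgc' : HasCompactSupport (fun x => (g x : ℂ)) := hgc.comp_left (g := Complex.ofReal) rfl
      have hsg := Lp.toTemperedDistribution_apply (𝓕⁻ F) (hgc'.toSchwartzMap hg')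
      rw [← Lp.fourierInv_toTemperedDistribution_eq, TemperedDistribution.fourierInv_apply,
        Lp.toTemperedDistribution_apply] at hsg
      simp only [HasCompactSupport.toSchwartzMap_toFun, SchwartzMap.fourierInv_coe] at hsg
      calc ∫ x, g x • (𝓕⁻ F : Lp ℂ 2 (volume : Measure V)) x = _ := hsg.symm
        _ = ∫ ξ, synth (fun x => (g x : ℂ)) ξ * φ ξ := by
          refine integral_congr_ae ?_
          filter_upwards [(hφ.memLp 2).coeFn_toLp] with ξ hξ
          rw [hξ, smul_eq_mul, ← fourierInv_eq_synth]
          rfl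
        _ = ∫ x, (g x : ℂ) * synth φ x := by
          rw [integral_mul_synth hφ.integrable (hg'.continuous.integrable_of_hasCompactSupport hgc')]
  rw [← eLpNorm_congr_ae h1, ← Lp.enorm_def, ← Lp.enorm_toLp (hφ.memLp 2)]
  rw [enorm_eq_iff_norm_eq, ← Lp.norm_fourier_eq, FourierTransform.fourier_fourierInv_eq]

end Plancherel

/-! ### Holomorphic extension of band-limited functions in one direction -/

section Extension

variable {V : Type*} [NormedAddCommGroup V] [InnerProductSpace ℝ V]

/-- The symbol of differentiation in the direction `v`. -/
noncomputable def dirFreq (v ξ : V) : ℂ := (2 * Real.pi * ⟪v, ξ⟫ : ℝ) * Complex.I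

theorem norm_dirFreq (v ξ : V) : ‖dirFreq v ξ‖ = 2 * Real.pi * |⟪v, ξ⟫| := by
  rw [dirFreq, norm_mul, Complex.norm_I, mul_one, Complex.norm_real, Real.norm_eq_abs, abs_mul,
    abs_of_pos Real.two_pi_pos]

theorem exp_dirFreq_ofReal (v ξ : V) (t : ℝ) :
    Complex.exp (dirFreq v ξ * t) = planeWave (t • v) ξ := by
  rw [dirFreq, planeWave, real_inner_smul_left]
  congr 1
  push_cast
  ring

theorem norm_exp_dirFreq_mul_I (v ξ : V) (y : ℝ) :
    ‖Complex.exp (dirFreq v ξ * (y * Complex.I))‖ = Real.exp (-(2 * Real.pi * ⟪v, ξ⟫ * y)) := by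
  rw [Complex.norm_exp]
  congr 1
  simp [dirFreq]

/-- The symbol of the `j`-th derivative of the extension at the complex time `z`. -/
noncomputable def halfSymbol (v : V) (χ : V → ℂ) (j : ℕ) (z : ℂ) (ξ : V) : ℂ :=
  dirFreq v ξ ^ j * Complex.exp (dirFreq v ξ * z) * χ ξ

variable [MeasurableSpace V] {v : V} {χ : V → ℂ}

/-- If `χ` lives in a half space and vanishes to second order at its boundary, the extension
decays in the upper half plane. -/
theorem exists_norm_halfSymbol_le (hχ : BandLimited χ) (h0 : ∀ ξ, ⟪v, ξ⟫ ≤ 0 → χ ξ = 0) {C : ℝ}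
    (h2 : ∀ ξ, ‖χ ξ‖ ≤ C * ⟪v, ξ⟫ ^ 2) (j : ℕ) : ∃ A R, 0 ≤ A ∧ ∀ y : ℝ, 0 ≤ y → ∀ ξ,
      ‖halfSymbol v χ j (y * Complex.I) ξ‖ ≤
        (Metric.closedBall (0 : V) R).indicator (fun _ => A * ((1 + y) ^ 2)⁻¹) ξ := by
  obtain ⟨R, hR⟩ := hχ.supp
  set S := ‖v‖ * R
  refine ⟨(2 * Real.pi * |S|) ^ j * (|C| * (2 * (S ^ 2 + 1))), R, by positivity,
    fun y hy ξ => ?_⟩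
  by_cases hξ : ‖ξ‖ ≤ R
  swap
  · rw [Set.indicator_of_notMem (by simpa using hξ)]
    simp [halfSymbol, hR ξ (not_le.1 hξ)]
  rw [Set.indicator_of_mem (by simpa using hξ)]
  rcases le_or_gt ⟪v, ξ⟫ 0 with hs | hs
  · rw [halfSymbol, h0 ξ hs]
    simp only [mul_zero, norm_zero]
    positivity
  set s := ⟪v, ξ⟫
  have hsS : s ≤ S := (real_inner_le_norm _ _).trans
    (mul_le_mul_of_nonneg_left hξ (norm_nonneg _))
  have e1 : Real.exp (-(2 * Real.pi * s * y)) * (s * (1 + y)) ^ 2 ≤ 2 * (S ^ 2 + 1) := by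
    set u := s * y
    have hu : 0 ≤ u := by positivity
    have h3 : Real.exp (-(2 * Real.pi * s * y)) * u ^ 2 ≤ 1 := by
      have h4 : Real.exp (-(2 * Real.pi * s * y)) ≤ Real.exp (-u) ^ 2 := by
        rw [← Real.exp_nat_mul]
        refine Real.exp_le_exp.2 ?_
        push_cast
        nlinarith [Real.pi_gt_three]
      have h5 : Real.exp (-u) * u ≤ 1 := by
        rw [Real.exp_neg, inv_mul_le_iff₀ (Real.exp_pos _)]
        linarith [Real.add_one_le_exp u]
      calc _ ≤ Real.exp (-u) ^ 2 * u ^ 2 := by gcongr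
        _ = (Real.exp (-u) * u) ^ 2 := by ring
        _ ≤ 1 := pow_le_one₀ (by positivity) h5
    have h6 : Real.exp (-(2 * Real.pi * s * y)) ≤ 1 := by
      rw [Real.exp_le_one_iff]
      have := Real.pi_pos
      simp only [Left.neg_nonpos_iff]
      positivity
    have h7 : (s * (1 + y)) ^ 2 ≤ 2 * (S ^ 2 + u ^ 2) := by
      have : s * (1 + y) = s + u := by ring
      rw [this]
      nlinarith [sq_nonneg (s - u)]
    calc _ ≤ Real.exp (-(2 * Real.pi * s * y)) * (2 * (S ^ 2 + u ^ 2)) := by gcongr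
      _ = 2 * (Real.exp (-(2 * Real.pi * s * y)) * S ^ 2 +
          Real.exp (-(2 * Real.pi * s * y)) * u ^ 2) := by ring
      _ ≤ 2 * (1 * S ^ 2 + 1) := by gcongr
      _ = _ := by ring
  rw [halfSymbol, norm_mul, norm_mul, norm_pow, norm_exp_dirFreq_mul_I, norm_dirFreq]
  have hy1 : 0 < (1 + y) ^ 2 := by positivity
  calc _ ≤ (2 * Real.pi * |S|) ^ j * Real.exp (-(2 * Real.pi * s * y)) * (|C| * s ^ 2) := by
        have hsS' : |s| ≤ |S| := abs_le_abs_of_nonneg hs.le hsS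
        gcongr
        · exact (h2 ξ).trans (by gcongr; exact le_abs_self C)
    _ = (2 * Real.pi * |S|) ^ j * (|C| * (Real.exp (-(2 * Real.pi * s * y)) *
          (s * (1 + y)) ^ 2)) * ((1 + y) ^ 2)⁻¹ := by field_simp
    _ ≤ _ := by gcongr

variable [FiniteDimensional ℝ V] [BorelSpace V]

@[fun_prop]
theorem measurable_dirFreq (v : V) : Measurable (dirFreq v) := by
  unfold dirFreq
  fun_prop

/-- The `j`-th derivative in `z` of the extension of `synth χ` to the points `x + z v`. -/
noncomputable def halfExt (v : V) (χ : V → ℂ) (j : ℕ) (z : ℂ) (x : V) : ℂ :=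
  synth (halfSymbol v χ j z) x

theorem halfExt_zero_zero (v : V) (χ : V → ℂ) (x : V) : halfExt v χ 0 0 x = synth χ x := by
  simp [halfExt, synth, halfSymbol]

theorem halfExt_add_ofReal (v : V) (χ : V → ℂ) (j : ℕ) (z : ℂ) (x : V) (t : ℝ) :
    halfExt v χ j z (x + t • v) = halfExt v χ j (z + t) x := by
  refine integral_congr_ae (ae_of_all _ fun ξ => ?_)
  simp only [halfSymbol, planeWave_add_left, mul_add, Complex.exp_add, exp_dirFreq_ofReal]
  ring

theorem BandLimited.bandLimited_halfSymbol (hχ : BandLimited χ) (v : V) (j : ℕ) (z : ℂ) :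
    BandLimited (halfSymbol v χ j z) := by
  refine hχ.mul (m := fun ξ => dirFreq v ξ ^ j * Complex.exp (dirFreq v ξ * z)) (by fun_prop)
    fun R => ?_
  have hc : Continuous fun ξ : V => dirFreq v ξ ^ j * Complex.exp (dirFreq v ξ * z) := by
    unfold dirFreq
    fun_prop
  obtain ⟨B, hB⟩ := (isCompact_closedBall (0 : V) R).exists_bound_of_continuousOn hc.continuousOn
  exact ⟨B, fun ξ hξ => hB ξ (by simpa using hξ)⟩

theorem measurable_halfExt (hχ : Measurable χ) (v : V) (j : ℕ) :
    Measurable fun q : V × ℂ => halfExt v χ j q.2 q.1 := by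
  have h : Measurable fun w : (V × ℂ) × V => planeWave w.1.1 w.2 *
      halfSymbol v χ j w.1.2 w.2 := by
    unfold halfSymbol
    have := measurable_dirFreq v
    fun_prop
  exact h.stronglyMeasurable.integral_prod_right.measurable

theorem hasDerivAt_halfExt (hχ : BandLimited χ) (v : V) (j : ℕ) (z : ℂ) (x : V) :
    HasDerivAt (fun z => halfExt v χ j z x) (halfExt v χ (j + 1) z x) z := by
  obtain ⟨C, hC⟩ := hχ.bdd
  obtain ⟨R, hR⟩ := hχ.supp
  have hd : ∀ ξ : V, ‖ξ‖ ≤ R → ‖dirFreq v ξ‖ ≤ 2 * Real.pi * (‖v‖ * R) := fun ξ hξ => by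
    rw [norm_dirFreq]
    gcongr
    exact (abs_real_inner_le_norm _ _).trans (by gcongr)
  set K := 2 * Real.pi * (‖v‖ * R)
  refine (hasDerivAt_integral_of_dominated_loc_of_deriv_le (𝕜 := ℂ)
    (F := fun z ξ => planeWave x ξ * halfSymbol v χ j z ξ)
    (F' := fun z ξ => planeWave x ξ * halfSymbol v χ (j + 1) z ξ)
    (bound := fun ξ => K ^ (j + 1) * Real.exp (K * (‖z‖ + 1)) * ‖χ ξ‖)
    (Metric.ball_mem_nhds z one_pos) ?_ ?_ ?_ ?_ ?_ ?_).2
  · filter_upwards with w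
    exact (integrable_synth (hχ.bandLimited_halfSymbol v j w).integrable x).aestronglyMeasurable
  · exact integrable_synth (hχ.bandLimited_halfSymbol v j z).integrable x
  · exact (integrable_synth (hχ.bandLimited_halfSymbol v (j + 1) z).integrable x).aestronglyMeasurable
  · filter_upwards with ξ w hw
    rw [norm_mul, norm_planeWave, one_mul]
    by_cases hξ : ‖ξ‖ ≤ R
    · have h1 := hd ξ hξ
      have hK : 0 ≤ K := (norm_nonneg _).trans h1
      have h2 : ‖w‖ ≤ ‖z‖ + 1 := by
        have := norm_sub_norm_le w z
        rw [Metric.mem_ball, dist_eq_norm] at hw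
        linarith
      rw [halfSymbol, norm_mul, norm_mul, norm_pow]
      gcongr
      refine (Complex.norm_exp_le_exp_norm _).trans ?_
      rw [norm_mul]
      gcongr
    · simp [halfSymbol, hR ξ (not_le.1 hξ)]
  · exact hχ.integrable.norm.const_mul _
  · filter_upwards with ξ w hw
    unfold halfSymbol
    have h := (((hasDerivAt_id w).const_mul (dirFreq v ξ)).cexp.const_mul
      (dirFreq v ξ ^ j)).mul_const (χ ξ) |>.const_mul (planeWave x ξ)
    simp only [id, mul_one] at h
    convert! h using 1
    ring

theorem hasDerivAt_halfExt_mul_I (hχ : BandLimited χ) (v : V) (j : ℕ) (y : ℝ) (x : V) :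
    HasDerivAt (fun y : ℝ => halfExt v χ j (y * Complex.I) x)
      (Complex.I * halfExt v χ (j + 1) (y * Complex.I) x) y := by
  have h := (hasDerivAt_halfExt hχ v j (y * Complex.I) x).scomp y
    ((Complex.ofRealCLM.hasDerivAt (x := y)).mul_const Complex.I)
  simpa [Function.comp_def] using! h

theorem hasDerivAt_halfExt_add_smul (hχ : BandLimited χ) (v : V) (j : ℕ) (z : ℂ) (x : V) (t : ℝ) :
    HasDerivAt (fun t : ℝ => halfExt v χ j z (x + t • v)) (halfExt v χ (j + 1) z (x + t • v)) t := by
  simp_rw [halfExt_add_ofReal]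
  have h := (hasDerivAt_halfExt hχ v j (z + t) x).scomp t
    ((Complex.ofRealCLM.hasDerivAt (x := t)).const_add z)
  simpa [Function.comp_def] using! h

/-- Uniform and mean-square decay of the extension. -/
theorem exists_norm_halfExt_le (hχ : BandLimited χ) (h0 : ∀ ξ, ⟪v, ξ⟫ ≤ 0 → χ ξ = 0) {C : ℝ}
    (h2 : ∀ ξ, ‖χ ξ‖ ≤ C * ⟪v, ξ⟫ ^ 2) (j : ℕ) : ∃ A : ℝ, 0 ≤ A ∧ ∀ y : ℝ, 0 ≤ y →
      (∀ x, ‖halfExt v χ j (y * Complex.I) x‖ ≤ A * ((1 + y) ^ 2)⁻¹) ∧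
      eLpNorm (halfExt v χ j (y * Complex.I)) 2 volume ≤ ENNReal.ofReal (A * ((1 + y) ^ 2)⁻¹) := by
  obtain ⟨A, R, hA, hb⟩ := exists_norm_halfSymbol_le hχ h0 h2 j
  set N := volume.real (Metric.closedBall (0 : V) R)
  have hfin : volume (Metric.closedBall (0 : V) R) ≠ ⊤ := measure_closedBall_lt_top.ne
  refine ⟨A * (N + N ^ (1 / 2 : ℝ)), by positivity, fun y hy => ⟨fun x => ?_, ?_⟩⟩
  · calc _ ≤ ∫ ξ, (Metric.closedBall (0 : V) R).indicator (fun _ => A * ((1 + y) ^ 2)⁻¹) ξ := by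
          refine norm_integral_le_of_norm_le ?_ (ae_of_all _ fun ξ => ?_)
          · exact (integrable_indicator_iff measurableSet_closedBall).2 
              (integrableOn_const hfin)
          · rw [norm_mul, norm_planeWave, one_mul]
            exact hb y hy ξ
      _ = A * N * ((1 + y) ^ 2)⁻¹ := by
          rw [integral_indicator measurableSet_closedBall, setIntegral_const, smul_eq_mul]
          ring
      _ ≤ _ := by
          gcongr
          linarith [show 0 ≤ N ^ (1 / 2 : ℝ) by positivity]
  · have e : halfExt v χ j (y * Complex.I) = synth (halfSymbol v χ j (y * Complex.I)) := rfl
    rw [e, (hχ.bandLimited_halfSymbol v j _).eLpNorm_synth_two]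
    refine (eLpNorm_mono_real (hb y hy)).trans ?_
    rw [eLpNorm_indicator_const measurableSet_closedBall (by norm_num) (by norm_num),
      Real.enorm_of_nonneg (by positivity)]
    have : volume (Metric.closedBall (0 : V) R) = ENNReal.ofReal N := by
      simp [N, measureReal_def, ENNReal.ofReal_toReal hfin]
    rw [this, ENNReal.ofReal_rpow_of_nonneg measureReal_nonneg (by norm_num),
      ← ENNReal.ofReal_mul (by positivity)]
    refine ENNReal.ofReal_le_ofReal ?_
    have hN : 0 ≤ N := measureReal_nonneg
    norm_num
    calc _ = A * N ^ (1 / 2 : ℝ) * ((1 + y) ^ 2)⁻¹ := by ring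
      _ ≤ _ := by gcongr; linarith

end Extension

/-! ### Subharmonic functions of band-limited functions with spectrum in a half space -/

section Jet

/-- The second derivative of `Ψ` along a curve through `w` with velocity `a` and acceleration
`b`. -/
noncomputable def secondJet (Ψ : ℂ → ℝ) (w a b : ℂ) : ℝ :=
  fderiv ℝ (fderiv ℝ Ψ) w a a + fderiv ℝ Ψ w b

variable {Ψ : ℂ → ℝ}

theorem hasDerivAt_comp_curve (hΨ : ContDiff ℝ 2 Ψ) {c : ℝ → ℂ} {a : ℂ} {t : ℝ}
    (hc : HasDerivAt c a t) : HasDerivAt (fun t => Ψ (c t)) (fderiv ℝ Ψ (c t) a) t :=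
  ((hΨ.differentiable (by norm_num)) (c t)).hasFDerivAt.comp_hasDerivAt t hc

theorem hasDerivAt_fderiv_comp_curve (hΨ : ContDiff ℝ 2 Ψ) {c a : ℝ → ℂ} {b : ℂ} {t : ℝ}
    (hc : HasDerivAt c (a t) t) (ha : HasDerivAt a b t) :
    HasDerivAt (fun t => fderiv ℝ Ψ (c t) (a t)) (secondJet Ψ (c t) (a t) b) t := by
  have h1 : ContDiff ℝ 1 (fderiv ℝ Ψ) := hΨ.fderiv_right (by norm_num)
  have h2 := ((h1.differentiable (by norm_num)) (c t)).hasFDerivAt.comp_hasDerivAt t hc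
  exact h2.clm_apply ha

theorem exists_fderiv_bound (hΨ : ContDiff ℝ 2 Ψ) (h0 : fderiv ℝ Ψ 0 = 0) (M : ℝ) :
    ∃ K : ℝ, 0 ≤ K ∧ ∀ w, ‖w‖ ≤ M →
      ‖fderiv ℝ Ψ w‖ ≤ K * ‖w‖ ∧ ‖fderiv ℝ (fderiv ℝ Ψ) w‖ ≤ K := by
  have h1 : ContDiff ℝ 1 (fderiv ℝ Ψ) := hΨ.fderiv_right (by norm_num)
  have h2 : Continuous (fderiv ℝ (fderiv ℝ Ψ)) := h1.continuous_fderiv (by norm_num)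
  obtain ⟨K, hK⟩ := (isCompact_closedBall (0 : ℂ) M).exists_bound_of_continuousOn 
    (Continuous.norm (E := ℂ →L[ℝ] ℂ →L[ℝ] ℝ) h2).continuousOn
  simp only [norm_norm] at hK
  refine ⟨max K 0, le_max_right _ _, fun w hw => ⟨?_, ?_⟩⟩
  · have hM : 0 ≤ M := (norm_nonneg _).trans hw
    have h := (convex_closedBall (0 : ℂ) M).norm_image_sub_le_of_norm_fderiv_le (𝕜 := ℝ)
      (f := fderiv ℝ Ψ) (C := max K 0) (fun z _ => (h1.differentiable (by norm_num)) z)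
      (fun z hz => (hK z hz).trans (le_max_left _ _)) (x := 0) (y := w)
      (by simpa using hM) (by simpa using hw)
    simpa [h0] using h
  · exact (hK w (by simpa using hw)).trans (le_max_left _ _)

theorem measurable_secondJet (hΨ : ContDiff ℝ 2 Ψ) {X : Type*} [MeasurableSpace X]
    {w a b : X → ℂ} (hw : Measurable w) (ha : Measurable a) (hb : Measurable b) :
    Measurable fun x => secondJet Ψ (w x) (a x) (b x) := by
  have h1 : ContDiff ℝ 1 (fderiv ℝ Ψ) := hΨ.fderiv_right (by norm_num)
  have h2 : Continuous (fderiv ℝ (fderiv ℝ Ψ)) := h1.continuous_fderiv (by norm_num)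
  have h3 : Continuous fun q : ℂ × ℂ × ℂ => secondJet Ψ q.1 q.2.1 q.2.2 := by
    unfold secondJet
    have := h1.continuous
    fun_prop
  exact h3.measurable.comp (hw.prodMk (ha.prodMk hb))

theorem abs_secondJet_le {K : ℝ} {w : ℂ} (h1 : ‖fderiv ℝ Ψ w‖ ≤ K * ‖w‖)
    (h2 : ‖fderiv ℝ (fderiv ℝ Ψ) w‖ ≤ K) (a b : ℂ) :
    |secondJet Ψ w a b| ≤ K * (‖w‖ ^ 2 + ‖a‖ ^ 2 + ‖b‖ ^ 2) := by
  have hK : 0 ≤ K := (ContinuousLinearMap.opNorm_nonneg _).trans h2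
  have e1 : |fderiv ℝ (fderiv ℝ Ψ) w a a| ≤ K * ‖a‖ * ‖a‖ :=
    
    (ContinuousLinearMap.le_opNorm₂ (fderiv ℝ (fderiv ℝ Ψ) w) a a).trans (by gcongr)
  have e2 : |fderiv ℝ Ψ w b| ≤ K * ‖w‖ * ‖b‖ :=
    (ContinuousLinearMap.le_opNorm (fderiv ℝ Ψ w) b).trans (by gcongr)
  have e3 : K * (‖w‖ * ‖b‖) ≤ K * (‖w‖ ^ 2 + ‖b‖ ^ 2) := by
    gcongr
    nlinarith [sq_nonneg (‖w‖ - ‖b‖), sq_nonneg ‖w‖, sq_nonneg ‖b‖]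
  refine (abs_add_le _ _).trans ?_
  linarith

end Jet

section Green

variable {V : Type*} [NormedAddCommGroup V] [InnerProductSpace ℝ V] [FiniteDimensional ℝ V]
  [MeasurableSpace V] [BorelSpace V]

/-- The integral of a directional derivative vanishes. -/
theorem integral_hasLineDerivAt_eq_zero {g g' : V → ℝ} {v : V} (hg : Integrable g)
    (hg' : Integrable g') (h : ∀ x, HasLineDerivAt ℝ g (g' x) x v) : ∫ x, g' x = 0 := by
  have h1 := integral_bilinear_hasLineDerivAt_right_eq_neg_left_of_integrable
    (μ := (volume : Measure V)) (f := fun _ : V => (1 : ℝ)) (f' := fun _ => 0) (g := g) (g' := g')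
    (v := v) (B := ContinuousLinearMap.mul ℝ ℝ) (by simp) (by simpa) (by simpa)
    (fun x _ => by simpa using! (hasFDerivAt_const (1 : ℝ) x).hasLineDerivAt v) (fun x _ => h x)
  simpa using h1

theorem integral_norm_sq_le_of_eLpNorm_le {F : V → ℂ} (hF : AEStronglyMeasurable F volume) {B : ℝ}
    (hB : 0 ≤ B) (h : eLpNorm F 2 volume ≤ ENNReal.ofReal B) :
    Integrable (fun x => ‖F x‖ ^ 2) ∧ ∫ x, ‖F x‖ ^ 2 ≤ B ^ 2 := by
  have hm : MemLp F 2 volume := ⟨hF, h.trans_lt ENNReal.ofReal_lt_top⟩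
  refine ⟨by simpa using hm.integrable_norm_pow (by norm_num), ?_⟩
  have e := hm.eLpNorm_eq_integral_rpow_norm (by norm_num) (by norm_num)
  rw [e, ENNReal.ofReal_le_ofReal_iff hB] at h
  simp only [ENNReal.toReal_ofNat, Real.rpow_ofNat] at h
  have h0 : 0 ≤ ∫ x, ‖F x‖ ^ 2 := integral_nonneg fun x => by positivity
  rw [← one_div, ← Real.sqrt_eq_rpow] at h
  exact (Real.sqrt_le_left hB).1 h

theorem mul_inv_one_add_sq_sq_le {y : ℝ} (hy : 0 ≤ y) :
    y * (((1 + y) ^ 2)⁻¹) ^ 2 ≤ (1 + y ^ 2)⁻¹ := by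
  rw [← inv_pow, ← pow_mul, inv_pow, ← div_eq_mul_inv, div_le_iff₀ (by positivity),
    inv_mul_eq_div, le_div_iff₀ (by positivity)]
  have e : (1 + y) ^ (2 * 2) - y * (1 + y ^ 2) = 1 + 3 * y + 6 * y ^ 2 + 3 * y ^ 3 + y ^ 4 := by
    ring
  have : 0 ≤ 1 + 3 * y + 6 * y ^ 2 + 3 * y ^ 3 + y ^ 4 := by positivity
  linarith

/-- The function `r y = A (1 + y) ^ (-2)` bounding an extension to the half plane. -/
noncomputable def extBound (A y : ℝ) : ℝ := A * ((1 + y) ^ 2)⁻¹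

theorem extBound_nonneg {A : ℝ} (hA : 0 ≤ A) (y : ℝ) : 0 ≤ extBound A y := by
  unfold extBound
  positivity

theorem extBound_le {A y : ℝ} (hA : 0 ≤ A) (hy : 0 ≤ y) : extBound A y ≤ A :=
  mul_le_of_le_one_right hA (inv_le_one_of_one_le₀ (by nlinarith))

theorem mul_extBound_sq_le (A : ℝ) {y : ℝ} (hy : 0 ≤ y) :
    y * extBound A y ^ 2 ≤ A ^ 2 * (1 + y ^ 2)⁻¹ := by
  refine le_trans (le_of_eq ?_)
    (mul_le_mul_of_nonneg_left (mul_inv_one_add_sq_sq_le hy) (sq_nonneg A))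
  unfold extBound
  ring

theorem tendsto_extBound (A : ℝ) : Filter.Tendsto (extBound A) Filter.atTop (nhds 0) := by
  rw [← mul_zero A]
  refine Filter.Tendsto.const_mul _ (tendsto_inv_atTop_zero.comp ?_)
  exact (Filter.tendsto_pow_atTop (by norm_num)).comp
    (Filter.tendsto_atTop_add_const_left _ _ Filter.tendsto_id)

theorem tendsto_mul_inv_one_add_sq (A : ℝ) :
    Filter.Tendsto (fun y : ℝ => A * (1 + y ^ 2)⁻¹) Filter.atTop (nhds 0) := by
  rw [← mul_zero A]
  refine Filter.Tendsto.const_mul _ (tendsto_inv_atTop_zero.comp ?_)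
  exact Filter.tendsto_atTop_add_const_left _ _ (Filter.tendsto_pow_atTop (by norm_num))

/-- The functions `G j y` are the derivatives of order `j` of a function holomorphic in the half
planes `x + ℝ v + i (0, ∞) v`, with quadratic decay for `j ≤ 2`. -/
structure HalfPlaneJet (v : V) (A : ℝ) (G : ℕ → ℝ → V → ℂ) : Prop where
  nonneg : 0 ≤ A
  meas : ∀ j, Measurable fun q : V × ℝ => G j q.2 q.1
  vert : ∀ j x y, HasDerivAt (fun y => G j y x) (Complex.I * G (j + 1) y x) y
  horiz : ∀ j x y, HasDerivAt (fun t : ℝ => G j y (x + t • v)) (G (j + 1) y x) 0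
  bound : ∀ j < 3, ∀ y, 0 ≤ y → ∀ x, ‖G j y x‖ ≤ extBound A y
  bound_two : ∀ j < 3, ∀ y, 0 ≤ y → eLpNorm (G j y) 2 volume ≤ ENNReal.ofReal (extBound A y)

theorem exists_halfPlaneJet {v : V} {χ : V → ℂ} (hχ : BandLimited χ)
    (h0 : ∀ ξ, ⟪v, ξ⟫ ≤ 0 → χ ξ = 0) {C : ℝ} (h2 : ∀ ξ, ‖χ ξ‖ ≤ C * ⟪v, ξ⟫ ^ 2) :
    ∃ A G, HalfPlaneJet v A G ∧ G 0 0 = synth χ := by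
  choose A hA0 hA using exists_norm_halfExt_le hχ h0 h2
  have hle : ∀ j < 3, ∀ y : ℝ, 0 ≤ y →
      A j * ((1 + y) ^ 2)⁻¹ ≤ extBound (∑ j ∈ Finset.range 3, A j) y := fun j hj y hy => by
    unfold extBound
    gcongr
    exact Finset.single_le_sum (fun j _ => hA0 j) (Finset.mem_range.2 hj)
  refine ⟨∑ j ∈ Finset.range 3, A j, fun j y x => halfExt v χ j (y * Complex.I) x,
    ⟨Finset.sum_nonneg fun j _ => hA0 j, fun j => ?_, fun j x y => ?_, fun j x y => ?_,
      fun j hj y hy x => ?_, fun j hj y hy => ?_⟩, ?_⟩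
  · exact (measurable_halfExt hχ.meas v j).comp
      (f := fun q : V × ℝ => (q.1, (q.2 : ℂ) * Complex.I)) (by fun_prop)
  · exact hasDerivAt_halfExt_mul_I hχ v j y x
  · simpa using hasDerivAt_halfExt_add_smul hχ v j (y * Complex.I) x 0
  · exact ((hA j y hy).1 x).trans (hle j hj y hy)
  · exact (hA j y hy).2.trans (ENNReal.ofReal_le_ofReal (hle j hj y hy))
  · ext x
    simp [halfExt_zero_zero]

namespace HalfPlaneJet

variable {v : V} {A K : ℝ} {G : ℕ → ℝ → V → ℂ} {Ψ : ℂ → ℝ}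

theorem meas_slice (h : HalfPlaneJet v A G) (j : ℕ) (y : ℝ) : Measurable (G j y) :=
  (h.meas j).comp (measurable_id.prodMk measurable_const)

/-- The square function of a half-plane jet. -/
noncomputable def sqSum (G : ℕ → ℝ → V → ℂ) (y : ℝ) (x : V) : ℝ :=
  ‖G 0 y x‖ ^ 2 + ‖G 1 y x‖ ^ 2 + ‖G 2 y x‖ ^ 2

/-- The second derivative of `Ψ ∘ G` in the vertical direction. -/
noncomputable def vertJet (Ψ : ℂ → ℝ) (G : ℕ → ℝ → V → ℂ) (y : ℝ) (x : V) : ℝ :=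
  secondJet Ψ (G 0 y x) (Complex.I * G 1 y x) (Complex.I * (Complex.I * G 2 y x))

theorem sqSum_le (h : HalfPlaneJet v A G) {y : ℝ} (hy : 0 ≤ y) (x : V) :
    sqSum G y x ≤ 3 * extBound A y ^ 2 := by
  have h := fun j (hj : j < 3) => pow_le_pow_left₀ (norm_nonneg _) (h.bound j hj y hy x) 2
  unfold sqSum
  linarith [h 0 (by norm_num), h 1 (by norm_num), h 2 (by norm_num)]

theorem integrable_sqSum (h : HalfPlaneJet v A G) {y : ℝ} (hy : 0 ≤ y) :
    Integrable (sqSum G y) ∧ ∫ x, sqSum G y x ≤ 3 * extBound A y ^ 2 := by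
  have h := fun j (hj : j < 3) => integral_norm_sq_le_of_eLpNorm_le
    (h.meas_slice j y).aestronglyMeasurable (extBound_nonneg h.nonneg y) (h.bound_two j hj y hy)
  have i0 := h 0 (by norm_num)
  have i1 := h 1 (by norm_num)
  have i2 := h 2 (by norm_num)
  refine ⟨(i0.1.add i1.1).add i2.1, ?_⟩
  have e : ∫ x, sqSum G y x =
      (∫ x, ‖G 0 y x‖ ^ 2) + (∫ x, ‖G 1 y x‖ ^ 2) + ∫ x, ‖G 2 y x‖ ^ 2 := by
    rw [← integral_add i0.1 i1.1, ← integral_add (f := fun x => ‖G 0 y x‖ ^ 2 + ‖G 1 y x‖ ^ 2)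
      (i0.1.add i1.1) i2.1]
    rfl
  linarith [i0.2, i1.2, i2.2]

theorem measurable_vertJet (h : HalfPlaneJet v A G) (hΨ : ContDiff ℝ 2 Ψ) :
    Measurable fun q : V × ℝ => vertJet Ψ G q.2 q.1 :=
  measurable_secondJet hΨ (h.meas 0) ((h.meas 1).const_mul _)
    (((h.meas 2).const_mul _).const_mul _)

/-- The Hessian bounds for `Ψ` on the range of the jet. -/
def HessBound (Ψ : ℂ → ℝ) (A K : ℝ) : Prop := ∀ w, ‖w‖ ≤ A →
  ‖fderiv ℝ Ψ w‖ ≤ K * ‖w‖ ∧ ‖fderiv ℝ (fderiv ℝ Ψ) w‖ ≤ K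

theorem norm_le (h : HalfPlaneJet v A G) {y : ℝ} (hy : 0 ≤ y) (x : V) : ‖G 0 y x‖ ≤ A :=
  (h.bound 0 (by norm_num) y hy x).trans (extBound_le h.nonneg hy)

theorem abs_vertJet_le (h : HalfPlaneJet v A G) (hK : HessBound Ψ A K) {y : ℝ} (hy : 0 ≤ y)
    (x : V) : |vertJet Ψ G y x| ≤ K * sqSum G y x := by
  have h := abs_secondJet_le (hK _ (h.norm_le hy x)).1 (hK _ (h.norm_le hy x)).2
    (Complex.I * G 1 y x) (Complex.I * (Complex.I * G 2 y x))
  simpa [vertJet, sqSum] using h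

theorem integrable_vertJet (h : HalfPlaneJet v A G) (hΨ : ContDiff ℝ 2 Ψ) (hK : HessBound Ψ A K)
    {y : ℝ} (hy : 0 ≤ y) : Integrable (vertJet Ψ G y) :=
  ((h.integrable_sqSum hy).1.const_mul K).mono'
    ((h.measurable_vertJet hΨ).comp (measurable_id.prodMk measurable_const)).aestronglyMeasurable
    (ae_of_all _ (h.abs_vertJet_le hK hy))

theorem mul_sq_le (hK0 : 0 ≤ K) {y : ℝ} (hy : 0 ≤ y) :
    y * (K * (3 * extBound A y ^ 2)) ≤ K * 3 * A ^ 2 * (1 + y ^ 2)⁻¹ :=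
  calc _ = K * 3 * (y * extBound A y ^ 2) := by ring
    _ ≤ K * 3 * (A ^ 2 * (1 + y ^ 2)⁻¹) :=
      mul_le_mul_of_nonneg_left (mul_extBound_sq_le A hy) (by positivity)
    _ = _ := by ring

theorem integrableOn_mul_inv_one_add_sq (B : ℝ) :
    IntegrableOn (fun y : ℝ => B * (1 + y ^ 2)⁻¹) (Set.Ioi 0) :=
  (integrable_inv_one_add_sq.const_mul _).integrableOn

theorem integral_mul_vertJet (h : HalfPlaneJet v A G) (hΨ : ContDiff ℝ 2 Ψ) (hΨ0 : Ψ 0 = 0)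
    (hK0 : 0 ≤ K) (hK : HessBound Ψ A K) (x : V) :
    ∫ y in Set.Ioi (0 : ℝ), y * vertJet Ψ G y x = Ψ (G 0 0 x) := by
  have hder : ∀ y : ℝ, HasDerivAt (fun y => y * fderiv ℝ Ψ (G 0 y x) (Complex.I * G 1 y x) -
      Ψ (G 0 y x)) (y * vertJet Ψ G y x) y := fun y => by
    have h := ((hasDerivAt_id y).mul (hasDerivAt_fderiv_comp_curve hΨ (h.vert 0 x y)
      ((h.vert 1 x y).const_mul Complex.I))).sub (hasDerivAt_comp_curve hΨ (h.vert 0 x y))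
    refine h.congr_deriv ?_
    simp only [id, vertJet]
    ring
  have hlim0 : Filter.Tendsto (fun y => G 0 y x) Filter.atTop (nhds 0) := by
    refine squeeze_zero_norm' (a := extBound A) ?_ (tendsto_extBound A)
    filter_upwards [Filter.eventually_ge_atTop 0] with y hy
    exact h.bound 0 (by norm_num) y hy x
  have hlim : Filter.Tendsto (fun y => y * fderiv ℝ Ψ (G 0 y x) (Complex.I * G 1 y x) -
      Ψ (G 0 y x)) Filter.atTop (nhds (0 - 0)) := by
    refine Filter.Tendsto.sub ?_ ?_
    · refine squeeze_zero_norm' (a := fun y => K * A ^ 2 * (1 + y ^ 2)⁻¹) ?_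
        (tendsto_mul_inv_one_add_sq _)
      filter_upwards [Filter.eventually_ge_atTop 0] with y hy
      rw [norm_mul, Real.norm_of_nonneg hy]
      have h0 := h.bound 0 (by norm_num) y hy x
      have h1 := h.bound 1 (by norm_num) y hy x
      have h2 := (hK _ (h.norm_le hy x)).1
      have h3 := ContinuousLinearMap.le_opNorm (fderiv ℝ Ψ (G 0 y x)) (Complex.I * G 1 y x)
      rw [norm_mul, Complex.norm_I, one_mul] at h3
      have h4 : ‖fderiv ℝ Ψ (G 0 y x)‖ ≤ K * extBound A y := h2.trans (by gcongr)
      have h5 : ‖fderiv ℝ Ψ (G 0 y x) (Complex.I * G 1 y x)‖ ≤ K * extBound A y * extBound A y :=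
        h3.trans (mul_le_mul h4 h1 (norm_nonneg _)
          (mul_nonneg hK0 (extBound_nonneg h.nonneg y)))
      calc _ ≤ y * (K * extBound A y * extBound A y) := by gcongr
        _ = K * (y * extBound A y ^ 2) := by ring
        _ ≤ K * (A ^ 2 * (1 + y ^ 2)⁻¹) :=
          mul_le_mul_of_nonneg_left (mul_extBound_sq_le A hy) hK0
        _ = _ := by ring
    · rw [← hΨ0]
      exact (hΨ.continuous.tendsto 0).comp hlim0
  have hm : Measurable fun y => vertJet Ψ G y x :=
    (h.measurable_vertJet hΨ).comp (measurable_const.prodMk measurable_id)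
  have hi : IntegrableOn (fun y => y * vertJet Ψ G y x) (Set.Ioi 0) := by
    refine (integrableOn_mul_inv_one_add_sq _).mono' (measurable_id.mul hm).aestronglyMeasurable
      (?_ : ∀ᵐ y ∂volume.restrict (Set.Ioi 0), _ ≤ K * 3 * A ^ 2 * (1 + y ^ 2)⁻¹)
    filter_upwards [ae_restrict_mem measurableSet_Ioi] with y hy
    have hy' : 0 ≤ y := le_of_lt hy
    rw [norm_mul, Real.norm_of_nonneg hy', Real.norm_eq_abs]
    refine le_trans ?_ (mul_sq_le hK0 hy')
    refine mul_le_mul_of_nonneg_left ((h.abs_vertJet_le hK hy' x).trans ?_) hy'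
    exact mul_le_mul_of_nonneg_left (h.sqSum_le hy' x) hK0
  rw [integral_Ioi_of_hasDerivAt_of_tendsto' (fun y _ => hder y) hi hlim]
  simp

theorem integrable_prod_mul_vertJet (h : HalfPlaneJet v A G) (hΨ : ContDiff ℝ 2 Ψ)
    (hK0 : 0 ≤ K) (hK : HessBound Ψ A K) :
    Integrable (Function.uncurry fun (x : V) (y : ℝ) => y * vertJet Ψ G y x)
      ((volume : Measure V).prod (volume.restrict (Set.Ioi 0))) := by
  have hm : Measurable (Function.uncurry fun (x : V) (y : ℝ) => y * vertJet Ψ G y x) :=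
    measurable_snd.mul (h.measurable_vertJet hΨ)
  rw [integrable_prod_iff' hm.aestronglyMeasurable]
  constructor
  · filter_upwards [ae_restrict_mem measurableSet_Ioi] with y hy
    exact (h.integrable_vertJet hΨ hK (le_of_lt hy)).const_mul y
  · refine (integrableOn_mul_inv_one_add_sq _).mono' ?_
      (?_ : ∀ᵐ y ∂volume.restrict (Set.Ioi 0), _ ≤ K * 3 * A ^ 2 * (1 + y ^ 2)⁻¹)
    · exact hm.norm.stronglyMeasurable.integral_prod_left'.aestronglyMeasurable
    · filter_upwards [ae_restrict_mem measurableSet_Ioi] with y hy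
      have hy' : 0 ≤ y := le_of_lt hy
      rw [Real.norm_of_nonneg (integral_nonneg fun x => norm_nonneg _)]
      simp only [Function.uncurry, norm_mul, Real.norm_of_nonneg hy', integral_const_mul]
      refine le_trans ?_ (mul_sq_le hK0 hy')
      refine mul_le_mul_of_nonneg_left ?_ hy'
      refine (integral_mono (h.integrable_vertJet hΨ hK hy').norm
        ((h.integrable_sqSum hy').1.const_mul K) (h.abs_vertJet_le hK hy')).trans ?_
      rw [integral_const_mul]
      exact mul_le_mul_of_nonneg_left (h.integrable_sqSum hy').2 hK0

theorem integral_horizJet (h : HalfPlaneJet v A G) (hΨ : ContDiff ℝ 2 Ψ)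
    (hK0 : 0 ≤ K) (hK : HessBound Ψ A K) {y : ℝ} (hy : 0 ≤ y) :
    Integrable (fun x => secondJet Ψ (G 0 y x) (G 1 y x) (G 2 y x)) ∧
      ∫ x, secondJet Ψ (G 0 y x) (G 1 y x) (G 2 y x) = 0 := by
  have hintegral : Integrable fun x => secondJet Ψ (G 0 y x) (G 1 y x) (G 2 y x) :=
    ((h.integrable_sqSum hy).1.const_mul K).mono' (measurable_secondJet hΨ (h.meas_slice 0 y)
      (h.meas_slice 1 y) (h.meas_slice 2 y)).aestronglyMeasurable (ae_of_all _ fun x =>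
        abs_secondJet_le (hK _ (h.norm_le hy x)).1 (hK _ (h.norm_le hy x)).2 _ _)
  refine ⟨hintegral, integral_hasLineDerivAt_eq_zero (v := v)
    (g := fun x => fderiv ℝ Ψ (G 0 y x) (G 1 y x)) ?_ hintegral fun x => ?_⟩
  · have hc : Continuous fun q : ℂ × ℂ => fderiv ℝ Ψ q.1 q.2 := by
      have := hΨ.continuous_fderiv (by norm_num)
      fun_prop
    refine ((h.integrable_sqSum hy).1.const_mul K).mono'
      (hc.measurable.comp ((h.meas_slice 0 y).prodMk (h.meas_slice 1 y))).aestronglyMeasurable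
      (ae_of_all _ fun x => ?_)
    refine (ContinuousLinearMap.le_opNorm (fderiv ℝ Ψ (G 0 y x)) (G 1 y x)).trans ?_
    refine (mul_le_mul_of_nonneg_right (hK _ (h.norm_le hy x)).1 (norm_nonneg _)).trans ?_
    rw [mul_assoc]
    refine mul_le_mul_of_nonneg_left ?_ hK0
    unfold sqSum
    nlinarith [sq_nonneg (‖G 0 y x‖ - ‖G 1 y x‖), sq_nonneg ‖G 0 y x‖,
      sq_nonneg ‖G 1 y x‖, sq_nonneg ‖G 2 y x‖]
  · have h0 := h.horiz 0 x y
    have h1 := h.horiz 1 x y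
    have h1' : HasDerivAt (fun t : ℝ => G 0 y (x + t • v)) (G 1 y (x + (0 : ℝ) • v)) 0 := by
      simpa using h0
    have h2 := hasDerivAt_fderiv_comp_curve (a := fun t => G 1 y (x + t • v)) hΨ h1' h1
    simpa [HasLineDerivAt] using h2

theorem integral_vertJet_nonneg (h : HalfPlaneJet v A G) (hΨ : ContDiff ℝ 2 Ψ)
    (hK0 : 0 ≤ K) (hK : HessBound Ψ A K) (hsub : ∀ w h, 0 ≤ fderiv ℝ (fderiv ℝ Ψ) w h h +
      fderiv ℝ (fderiv ℝ Ψ) w (Complex.I * h) (Complex.I * h)) {y : ℝ} (hy : 0 ≤ y) :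
    0 ≤ ∫ x, vertJet Ψ G y x := by
  obtain ⟨hi, hz⟩ := h.integral_horizJet hΨ hK0 hK hy
  have e : ∫ x, vertJet Ψ G y x =
      ∫ x, (vertJet Ψ G y x + secondJet Ψ (G 0 y x) (G 1 y x) (G 2 y x)) := by
    rw [integral_add (h.integrable_vertJet hΨ hK hy) hi, hz, add_zero]
  rw [e]
  refine integral_nonneg fun x => ?_
  have e2 : Complex.I * (Complex.I * G 2 y x) = -G 2 y x := by
    rw [← mul_assoc, Complex.I_mul_I, neg_one_mul]
  simp only [Pi.zero_apply, vertJet, secondJet, e2, map_neg]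
  linarith [hsub (G 0 y x) (G 1 y x)]

end HalfPlaneJet

/-- Green's formula in the half planes `x + ℝ v + i (0, ∞) v`: a subharmonic function vanishing to
second order at the origin has nonnegative integral along a function whose spectrum lies in
a half space. -/
theorem integral_comp_synth_nonneg {Ψ : ℂ → ℝ} (hΨ : ContDiff ℝ 2 Ψ) (hΨ0 : Ψ 0 = 0)
    (hΨ1 : fderiv ℝ Ψ 0 = 0) (hsub : ∀ w h, 0 ≤ fderiv ℝ (fderiv ℝ Ψ) w h h +
      fderiv ℝ (fderiv ℝ Ψ) w (Complex.I * h) (Complex.I * h)) {v : V} {χ : V → ℂ}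
    (hχ : BandLimited χ) (h0 : ∀ ξ, ⟪v, ξ⟫ ≤ 0 → χ ξ = 0) {C : ℝ}
    (h2 : ∀ ξ, ‖χ ξ‖ ≤ C * ⟪v, ξ⟫ ^ 2) : 0 ≤ ∫ x, Ψ (synth χ x) := by
  obtain ⟨A, G, h, hG⟩ := exists_halfPlaneJet hχ h0 h2
  obtain ⟨K, hK0, hK⟩ := exists_fderiv_bound hΨ hΨ1 A
  calc (0 : ℝ) ≤ ∫ y in Set.Ioi (0 : ℝ), ∫ x, y * HalfPlaneJet.vertJet Ψ G y x := by
        refine setIntegral_nonneg measurableSet_Ioi fun y hy => ?_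
        rw [integral_const_mul]
        exact mul_nonneg (le_of_lt hy) (h.integral_vertJet_nonneg hΨ hK0 hK hsub (le_of_lt hy))
    _ = ∫ x, ∫ y in Set.Ioi (0 : ℝ), y * HalfPlaneJet.vertJet Ψ G y x :=
        (integral_integral_swap (h.integrable_prod_mul_vertJet hΨ hK0 hK)).symm
    _ = ∫ x, Ψ (synth χ x) := by
        rw [← hG]
        exact integral_congr_ae (ae_of_all _ (h.integral_mul_vertJet hΨ hΨ0 hK0 hK))

end Green

/-! ### Control of a function with half-space spectrum by its real part -/

section RieszFunction

theorem fderiv_eq_of_hasDerivAt_line {Ψ : ℂ → ℝ} (hΨ : ContDiff ℝ 2 Ψ) {w h : ℂ} {k : ℝ → ℝ} {l : ℝ}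
    (hk : ∀ t : ℝ, HasDerivAt (fun t : ℝ => Ψ (w + t * h)) (k t) t) (hl : HasDerivAt k l 0) :
    fderiv ℝ Ψ w h = k 0 ∧ fderiv ℝ (fderiv ℝ Ψ) w h h = l := by
  have hc : ∀ t : ℝ, HasDerivAt (fun t : ℝ => w + t * h) h t := fun t => by
    simpa using ((Complex.ofRealCLM.hasDerivAt (x := t)).mul_const h).const_add w
  have h1 : ∀ t : ℝ, fderiv ℝ Ψ (w + t * h) h = k t := fun t =>
    (hasDerivAt_comp_curve hΨ (hc t)).unique (hk t)
  have h2 := hasDerivAt_fderiv_comp_curve (a := fun _ => h) hΨ (hc 0) (hasDerivAt_const 0 h)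
  simp only [h1] at h2
  refine ⟨by simpa using h1 0, ?_⟩
  simpa [secondJet] using h2.unique hl

theorem hasDerivAt_quadratic_rpow {c₀ c₁ c₂ : ℝ} (s : ℝ) (hpos : ∀ t, 0 < c₀ + c₁ * t + c₂ * t ^ 2) :
    (∀ t, HasDerivAt (fun t => (c₀ + c₁ * t + c₂ * t ^ 2) ^ s)
      ((c₁ + 2 * c₂ * t) * s * (c₀ + c₁ * t + c₂ * t ^ 2) ^ (s - 1)) t) ∧
    HasDerivAt (fun t => (c₁ + 2 * c₂ * t) * s * (c₀ + c₁ * t + c₂ * t ^ 2) ^ (s - 1))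
      (s * c₀ ^ (s - 2) * ((s - 1) * c₁ ^ 2 + 2 * c₂ * c₀)) 0 := by
  have hq : ∀ t, HasDerivAt (fun t => c₀ + c₁ * t + c₂ * t ^ 2) (c₁ + 2 * c₂ * t) t := fun t => by
    have := (((hasDerivAt_id t).const_mul c₁).const_add c₀).add (((hasDerivAt_id t).pow 2).const_mul c₂)
    refine this.congr_deriv ?_
    simp
    ring
  have hl : ∀ t, HasDerivAt (fun t => (c₁ + 2 * c₂ * t) * s) (2 * c₂ * s) t := fun t => by
    have := (((hasDerivAt_id t).const_mul (2 * c₂)).const_add c₁).mul_const s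
    simpa using this
  refine ⟨fun t => (hq t).rpow_const (Or.inl (hpos t).ne'), ?_⟩
  have h := (hl 0).mul ((hq 0).rpow_const (p := s - 1) (Or.inl (hpos 0).ne'))
  refine h.congr_deriv ?_
  have h0 : 0 < c₀ := by simpa using hpos 0
  have e : c₀ ^ (s - 1) = c₀ ^ (s - 2) * c₀ := by
    rw [← Real.rpow_add_one h0.ne']
    ring_nf
  have e2 : s - 1 - 1 = s - 2 := by ring
  simp only [mul_zero, add_zero, ne_eq, OfNat.ofNat_ne_zero, not_false_eq_true, zero_pow, e2]
  rw [e]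
  ring

/-- A smooth subharmonic function comparing `|w| ^ (2 s)` with `|Re w| ^ (2 s)`. -/
noncomputable def rieszFun (q s ε : ℝ) (w : ℂ) : ℝ :=
  q * ((ε + w.re ^ 2) ^ s - ε ^ s) - ((ε + (w.re ^ 2 + w.im ^ 2)) ^ s - ε ^ s)

variable {q s ε : ℝ}

theorem contDiff_rieszFun (q s : ℝ) (hε : 0 < ε) : ContDiff ℝ 2 (rieszFun q s ε) := by
  have hre : ContDiff ℝ 2 fun w : ℂ => w.re := Complex.reCLM.contDiff
  have him : ContDiff ℝ 2 fun w : ℂ => w.im := Complex.imCLM.contDiff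
  unfold rieszFun
  refine (contDiff_const.mul (ContDiff.sub ?_ contDiff_const)).sub
    (ContDiff.sub ?_ contDiff_const)
  · exact (contDiff_const.add (hre.pow 2)).rpow_const_of_ne fun w => by positivity
  · exact (contDiff_const.add ((hre.pow 2).add (him.pow 2))).rpow_const_of_ne
      fun w => by positivity

theorem fderiv_rieszFun (q s : ℝ) (hε : 0 < ε) (w h : ℂ) :
    (w = 0 → fderiv ℝ (rieszFun q s ε) w h = 0) ∧ fderiv ℝ (fderiv ℝ (rieszFun q s ε)) w h h =
      q * (s * (ε + w.re ^ 2) ^ (s - 2) *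
        ((s - 1) * (2 * w.re * h.re) ^ 2 + 2 * h.re ^ 2 * (ε + w.re ^ 2))) -
      s * (ε + (w.re ^ 2 + w.im ^ 2)) ^ (s - 2) *
        ((s - 1) * (2 * w.re * h.re + 2 * w.im * h.im) ^ 2 +
          2 * (h.re ^ 2 + h.im ^ 2) * (ε + (w.re ^ 2 + w.im ^ 2))) := by
  obtain ⟨a1, a2⟩ := hasDerivAt_quadratic_rpow (c₀ := ε + w.re ^ 2) (c₁ := 2 * w.re * h.re)
    (c₂ := h.re ^ 2) s fun t => by nlinarith [sq_nonneg (w.re + t * h.re)]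
  obtain ⟨b1, b2⟩ := hasDerivAt_quadratic_rpow (c₀ := ε + (w.re ^ 2 + w.im ^ 2))
    (c₁ := 2 * w.re * h.re + 2 * w.im * h.im) (c₂ := h.re ^ 2 + h.im ^ 2) s fun t => by
      nlinarith [sq_nonneg (w.re + t * h.re), sq_nonneg (w.im + t * h.im)]
  have e : (fun t : ℝ => rieszFun q s ε (w + t * h)) = fun t : ℝ =>
      q * ((ε + w.re ^ 2 + 2 * w.re * h.re * t + h.re ^ 2 * t ^ 2) ^ s - ε ^ s) -
      ((ε + (w.re ^ 2 + w.im ^ 2) + (2 * w.re * h.re + 2 * w.im * h.im) * t +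
        (h.re ^ 2 + h.im ^ 2) * t ^ 2) ^ s - ε ^ s) := by
    ext t
    simp only [rieszFun, Complex.add_re, Complex.mul_re, Complex.ofReal_re, Complex.ofReal_im,
      zero_mul, sub_zero, Complex.add_im, Complex.mul_im, add_zero]
    have e1 : ε + (w.re + t * h.re) ^ 2 =
        ε + w.re ^ 2 + 2 * w.re * h.re * t + h.re ^ 2 * t ^ 2 := by ring
    have e2 : ε + ((w.re + t * h.re) ^ 2 + (w.im + t * h.im) ^ 2) =
        ε + (w.re ^ 2 + w.im ^ 2) + (2 * w.re * h.re + 2 * w.im * h.im) * t +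
          (h.re ^ 2 + h.im ^ 2) * t ^ 2 := by ring
    rw [e1, e2]
  have hk : ∀ t : ℝ, HasDerivAt (fun t : ℝ => rieszFun q s ε (w + t * h)) _ t := fun t => by
    rw [e]
    exact (((a1 t).sub_const (ε ^ s)).const_mul q).sub ((b1 t).sub_const (ε ^ s))
  obtain ⟨h1, h2⟩ := fderiv_eq_of_hasDerivAt_line (contDiff_rieszFun q s hε) hk
    ((a2.const_mul q).sub b2)
  refine ⟨fun hw => ?_, h2⟩
  rw [h1, hw]
  simp

theorem rieszFun_subharmonic (hs : 1 / 2 < s) (hs1 : s ≤ 1) (hε : 0 < ε) (w h : ℂ) :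
    0 ≤ fderiv ℝ (fderiv ℝ (rieszFun (2 / (2 * s - 1)) s ε)) w h h +
      fderiv ℝ (fderiv ℝ (rieszFun (2 / (2 * s - 1)) s ε)) w (Complex.I * h) (Complex.I * h) := by
  rw [(fderiv_rieszFun _ s hε w h).2, (fderiv_rieszFun _ s hε w (Complex.I * h)).2]
  simp only [Complex.mul_re, Complex.I_re, zero_mul, Complex.I_im, one_mul, zero_sub,
    Complex.mul_im]
  set Q := ε + w.re ^ 2 with hQ
  set R := ε + (w.re ^ 2 + w.im ^ 2) with hR
  set n := h.re ^ 2 + h.im ^ 2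
  have hQ0 : 0 < Q := by positivity
  have hR0 : 0 < R := by positivity
  have hQR : Q ≤ R := by nlinarith [sq_nonneg w.im]
  have hn : 0 ≤ n := by positivity
  have h21 : 0 < 2 * s - 1 := by linarith
  have eQ : Q ^ (s - 1) = Q ^ (s - 2) * Q := by
    rw [← Real.rpow_add_one hQ0.ne']
    ring_nf
  have eR : R ^ (s - 1) = R ^ (s - 2) * R := by
    rw [← Real.rpow_add_one hR0.ne']
    ring_nf
  have hcmp : R ^ (s - 1) ≤ Q ^ (s - 1) :=
    Real.rpow_le_rpow_of_nonpos hQ0 hQR (by linarith)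
  have hQs : 0 < Q ^ (s - 2) := Real.rpow_pos_of_pos hQ0 _
  have hRs : 0 < R ^ (s - 2) := Real.rpow_pos_of_pos hR0 _
  have i1 : 2 * (2 * s - 1) * Q ≤ 4 * (s - 1) * w.re ^ 2 + 2 * Q := by
    rw [hQ]
    nlinarith
  have i2 : 4 * (s - 1) * (w.re ^ 2 + w.im ^ 2) + 4 * R ≤ 4 * R := by
    nlinarith [sq_nonneg w.re, sq_nonneg w.im]
  have j1 : 4 * Q ^ (s - 1) ≤ 2 / (2 * s - 1) * (Q ^ (s - 2) *
      (4 * (s - 1) * w.re ^ 2 + 2 * Q)) := by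
    have := mul_le_mul_of_nonneg_left i1 hQs.le
    calc 4 * Q ^ (s - 1) = 2 / (2 * s - 1) * (Q ^ (s - 2) * (2 * (2 * s - 1) * Q)) := by
          have h4 : 2 / (2 * s - 1) * (2 * (2 * s - 1)) = 4 := by
            have := h21.ne'
            field_simp
            norm_num
          rw [eQ]
          linear_combination (-(Q ^ (s - 2) * Q)) * h4
      _ ≤ _ := by gcongr
  have j2 : R ^ (s - 2) * (4 * (s - 1) * (w.re ^ 2 + w.im ^ 2) + 4 * R) ≤ 4 * R ^ (s - 1) := by
    rw [eR]
    nlinarith [mul_le_mul_of_nonneg_left i2 hRs.le]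
  have key : 0 ≤ s * n * (2 / (2 * s - 1) * (Q ^ (s - 2) * (4 * (s - 1) * w.re ^ 2 + 2 * Q)) -
      R ^ (s - 2) * (4 * (s - 1) * (w.re ^ 2 + w.im ^ 2) + 4 * R)) :=
    mul_nonneg (mul_nonneg (by linarith) hn) (by linarith)
  refine key.trans (le_of_eq ?_)
  simp only [n]
  ring

theorem rpow_add_sub_rpow_nonneg (hs : 0 ≤ s) (hε : 0 < ε) {t : ℝ} (ht : 0 ≤ t) :
    0 ≤ (ε + t) ^ s - ε ^ s :=
  sub_nonneg.2 (Real.rpow_le_rpow hε.le (by linarith) hs)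

theorem rpow_add_sub_rpow_le (hs : 0 ≤ s) (hs1 : s ≤ 1) (hε : 0 < ε) {t : ℝ} (ht : 0 ≤ t) :
    (ε + t) ^ s - ε ^ s ≤ ε ^ s * (s * (t / ε)) := by
  have h1 : (1 + t / ε) ^ s ≤ 1 + s * (t / ε) :=
    rpow_one_add_le_one_add_mul_self (by have : 0 ≤ t / ε := by positivity
                                         linarith) hs hs1
  have e : ε + t = ε * (1 + t / ε) := by field_simp
  rw [e, Real.mul_rpow hε.le (by positivity)]
  nlinarith [mul_le_mul_of_nonneg_left h1 (Real.rpow_nonneg hε.le s)]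

end RieszFunction

section Control

variable {V : Type*} [NormedAddCommGroup V] [InnerProductSpace ℝ V] [FiniteDimensional ℝ V]
  [MeasurableSpace V] [BorelSpace V]

/-- Band-limited functions supported in a half space, vanishing to second order at its boundary. -/
structure HalfBandLimited (v : V) (χ : V → ℂ) : Prop extends BandLimited χ where
  eq_zero : ∀ ξ, ⟪v, ξ⟫ ≤ 0 → χ ξ = 0
  vanish : ∃ C : ℝ, ∀ ξ, ‖χ ξ‖ ≤ C * ⟪v, ξ⟫ ^ 2

theorem BandLimited.memLp_synth {φ : V → ℂ} (hφ : BandLimited φ) : MemLp (synth φ) 2 volume :=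
  ⟨(measurable_synth hφ.meas).aestronglyMeasurable,
    hφ.eLpNorm_synth_two.trans_lt (hφ.memLp 2).eLpNorm_lt_top⟩

theorem HalfBandLimited.lintegral_le_regularized {v : V} {χ : V → ℂ} (h : HalfBandLimited v χ)
    {s ε : ℝ} (hs : 1 / 2 < s) (hs1 : s ≤ 1) (hε : 0 < ε) :
    ∫⁻ x, ENNReal.ofReal ((ε + ‖synth χ x‖ ^ 2) ^ s - ε ^ s) ≤
      ENNReal.ofReal (2 / (2 * s - 1)) * ∫⁻ x, ‖((synth χ x).re : ℝ)‖ₑ ^ (2 * s) := by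
  have hs0 : 0 ≤ s := by linarith
  obtain ⟨C, hC⟩ := h.vanish
  have hsm := measurable_synth h.meas
  have hq : 0 ≤ 2 / (2 * s - 1) := div_nonneg (by norm_num) (by linarith)
  set q := 2 / (2 * s - 1)
  have hpos : 0 ≤ ∫ x, rieszFun q s ε (synth χ x) :=
    integral_comp_synth_nonneg (contDiff_rieszFun q s hε) (by simp [rieszFun])
      (by ext t
          simpa using (fderiv_rieszFun q s hε 0 t).1 rfl)
      (rieszFun_subharmonic hs hs1 hε) h.toBandLimited h.eq_zero hC
  have hsq : Integrable fun x => ‖synth χ x‖ ^ 2 := by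
    simpa using h.memLp_synth.integrable_norm_pow (by norm_num)
  have hi : ∀ u : V → ℝ, Measurable u → (∀ x, 0 ≤ u x) → (∀ x, u x ≤ ‖synth χ x‖ ^ 2) →
      Integrable fun x => (ε + u x) ^ s - ε ^ s := fun u hu hu0 hu1 => by
    refine (hsq.const_mul (ε ^ s * (s * ε⁻¹))).mono' (by fun_prop) (ae_of_all _ fun x => ?_)
    rw [Real.norm_of_nonneg (rpow_add_sub_rpow_nonneg hs0 hε (hu0 x))]
    refine (rpow_add_sub_rpow_le hs0 hs1 hε (hu0 x)).trans ?_
    rw [div_eq_inv_mul, ← mul_assoc s, ← mul_assoc (ε ^ s)]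
    gcongr
    exact hu1 x
  have hnorm : ∀ x, ‖synth χ x‖ ^ 2 = (synth χ x).re ^ 2 + (synth χ x).im ^ 2 := fun x => by
    rw [Complex.sq_norm, Complex.normSq_apply]
    ring
  have i1 := hi (fun x => (synth χ x).re ^ 2) (by fun_prop) (fun x => sq_nonneg _)
    fun x => by rw [hnorm]; linarith [sq_nonneg (synth χ x).im]
  have i2 := hi (fun x => ‖synth χ x‖ ^ 2) (by fun_prop) (fun x => sq_nonneg _) fun x => le_rfl
  have e : ∫ x, rieszFun q s ε (synth χ x) = q * (∫ x, ((ε + (synth χ x).re ^ 2) ^ s - ε ^ s)) -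
      ∫ x, ((ε + ‖synth χ x‖ ^ 2) ^ s - ε ^ s) := by
    rw [← integral_const_mul, ← integral_sub (i1.const_mul q) i2]
    refine integral_congr_ae (ae_of_all _ fun x => ?_)
    simp only [rieszFun, hnorm]
  rw [← ofReal_integral_eq_lintegral_ofReal i2
    (ae_of_all _ fun x => rpow_add_sub_rpow_nonneg hs0 hε (sq_nonneg _))]
  refine (ENNReal.ofReal_le_ofReal (show _ ≤ q * (∫ x, ((ε + (synth χ x).re ^ 2) ^ s - ε ^ s))
    by linarith)).trans ?_
  rw [ENNReal.ofReal_mul hq, ofReal_integral_eq_lintegral_ofReal i1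
    (ae_of_all _ fun x => rpow_add_sub_rpow_nonneg hs0 hε (sq_nonneg _))]
  gcongr with x
  rw [Real.enorm_eq_ofReal_abs, ENNReal.ofReal_rpow_of_nonneg (abs_nonneg _) (by linarith)]
  refine ENNReal.ofReal_le_ofReal ?_
  rw [Real.rpow_mul (abs_nonneg _), Real.rpow_two, sq_abs, sub_le_iff_le_add']
  exact Real.rpow_add_le_add_rpow hε.le (sq_nonneg _) hs0 hs1

theorem HalfBandLimited.lintegral_le {v : V} {χ : V → ℂ} (h : HalfBandLimited v χ)
    {s : ℝ} (hs : 1 / 2 < s) (hs1 : s ≤ 1) :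
    ∫⁻ x, ‖synth χ x‖ₑ ^ (2 * s) ≤
      ENNReal.ofReal (2 / (2 * s - 1)) * ∫⁻ x, ‖((synth χ x).re : ℝ)‖ₑ ^ (2 * s) := by
  have hs0 : 0 < s := by linarith
  have hsm := measurable_synth h.meas
  set e : ℕ → ℝ := fun n => 1 / ((n : ℝ) + 1)
  have he : Filter.Tendsto e Filter.atTop (nhds 0) := tendsto_one_div_add_atTop_nhds_zero_nat
  have he0 : ∀ n, 0 < e n := fun n => by positivity
  have hlim : ∀ x, Filter.Tendsto
      (fun n => ENNReal.ofReal ((e n + ‖synth χ x‖ ^ 2) ^ s - (e n) ^ s)) Filter.atTop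
      (nhds (‖synth χ x‖ₑ ^ (2 * s))) := fun x => by
    have h1 : Filter.Tendsto (fun n => (e n + ‖synth χ x‖ ^ 2) ^ s - (e n) ^ s) Filter.atTop
        (nhds ((0 + ‖synth χ x‖ ^ 2) ^ s - 0 ^ s)) :=
      ((he.add_const _).rpow_const (Or.inr hs0.le)).sub (he.rpow_const (Or.inr hs0.le))
    have h2 := ENNReal.tendsto_ofReal h1
    convert h2 using 2
    rw [zero_add, Real.zero_rpow hs0.ne', sub_zero, ← ofReal_norm,
      ENNReal.ofReal_rpow_of_nonneg (norm_nonneg _) (by linarith), Real.rpow_mul (norm_nonneg _),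
      Real.rpow_two]
  calc _ = ∫⁻ x, Filter.liminf
        (fun n => ENNReal.ofReal ((e n + ‖synth χ x‖ ^ 2) ^ s - (e n) ^ s)) Filter.atTop :=
      lintegral_congr fun x => (hlim x).liminf_eq.symm
    _ ≤ Filter.liminf (fun n => ∫⁻ x, ENNReal.ofReal ((e n + ‖synth χ x‖ ^ 2) ^ s - (e n) ^ s))
        Filter.atTop := lintegral_liminf_le fun n => by fun_prop
    _ ≤ _ := by
      refine Filter.liminf_le_of_le (by isBoundedDefault) fun b hb => ?_
      obtain ⟨n, hn⟩ := hb.exists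
      exact hn.trans (h.lintegral_le_regularized hs hs1 (he0 n))

/-- The `L ^ p` norm of a function with half-space spectrum is controlled by its real part. -/
def ReControl (V : Type*) [NormedAddCommGroup V] [InnerProductSpace ℝ V] [FiniteDimensional ℝ V]
    [MeasurableSpace V] [BorelSpace V] (p : ℝ) : Prop :=
  ∃ K : ℝ≥0∞, K ≠ ⊤ ∧ ∀ (v : V) (χ : V → ℂ), HalfBandLimited v χ →
    eLpNorm (synth χ) (ENNReal.ofReal p) volume ≤
      K * eLpNorm (fun x => (synth χ x).re) (ENNReal.ofReal p) volume

theorem ReControl.of_le_two {p : ℝ} (hp : 1 < p) (hp2 : p ≤ 2) : ReControl V p := by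
  have hp0 : 0 < p := by linarith
  refine ⟨ENNReal.ofReal (2 / (p - 1)) ^ (1 / p), by
    exact ENNReal.rpow_ne_top_of_nonneg (by positivity) ENNReal.ofReal_ne_top, fun v χ h => ?_⟩
  have h1 := h.lintegral_le (s := p / 2) (by linarith) (by linarith)
  rw [mul_div_cancel₀ p (by norm_num : (2 : ℝ) ≠ 0)] at h1
  have hpe : ENNReal.ofReal p ≠ 0 := by simpa using hp0
  rw [eLpNorm_eq_lintegral_rpow_enorm_toReal hpe ENNReal.ofReal_ne_top,
    eLpNorm_eq_lintegral_rpow_enorm_toReal hpe ENNReal.ofReal_ne_top,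
    ENNReal.toReal_ofReal hp0.le, ← ENNReal.mul_rpow_of_nonneg _ _ (by positivity)]
  exact ENNReal.rpow_le_rpow h1 (by positivity)

end Control

theorem HalfBandLimited.const_mul {W : Type*} [NormedAddCommGroup W] [InnerProductSpace ℝ W]
    [MeasurableSpace W] {v : W} {χ : W → ℂ} (h : HalfBandLimited v χ) (c : ℂ) :
    HalfBandLimited v fun ξ => c * χ ξ where
  toBandLimited := h.toBandLimited.mul measurable_const fun _ => ⟨‖c‖, fun _ _ => le_rfl⟩
  eq_zero ξ hξ := by simp [h.eq_zero ξ hξ]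
  vanish := by
    obtain ⟨C, hC⟩ := h.vanish
    refine ⟨‖c‖ * C, fun ξ => ?_⟩
    rw [norm_mul, mul_assoc]
    exact mul_le_mul_of_nonneg_left (hC ξ) (norm_nonneg _)

section Doubling

variable {V : Type*} [NormedAddCommGroup V] [InnerProductSpace ℝ V] [FiniteDimensional ℝ V]
  [MeasurableSpace V] [BorelSpace V]

theorem enorm_synth_le (φ : V → ℂ) (x : V) : ‖synth φ x‖ₑ ≤ ∫⁻ ξ, ‖φ ξ‖ₑ := by
  refine (enorm_integral_le_lintegral_enorm _).trans (le_of_eq (lintegral_congr fun ξ => ?_))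
  rw [enorm_mul, ← ofReal_norm (planeWave x ξ), norm_planeWave, ENNReal.ofReal_one, one_mul]

theorem BandLimited.eLpNorm_synth_lt_top {φ : V → ℂ} (hφ : BandLimited φ) {r : ℝ} (hr : 2 ≤ r) :
    eLpNorm (synth φ) (ENNReal.ofReal r) volume < ⊤ := by
  have hr0 : 0 < r := by linarith
  have h2 := lintegral_rpow_enorm_lt_top_of_eLpNorm_lt_top (by norm_num) (by norm_num)
    hφ.memLp_synth.eLpNorm_lt_top
  rw [eLpNorm_lt_top_iff_lintegral_rpow_enorm_lt_top (by simpa using hr0) ENNReal.ofReal_ne_top,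
    ENNReal.toReal_ofReal hr0.le]
  calc ∫⁻ x, ‖synth φ x‖ₑ ^ r ≤ ∫⁻ x, (∫⁻ ξ, ‖φ ξ‖ₑ) ^ (r - 2) * ‖synth φ x‖ₑ ^ (2 : ℝ) := by
        refine lintegral_mono fun x => ?_
        dsimp only
        rw [← sub_add_cancel r 2, ENNReal.rpow_add_of_nonneg _ _ (by linarith) (by norm_num),
          sub_add_cancel]
        gcongr
        exact enorm_synth_le φ x
    _ = (∫⁻ ξ, ‖φ ξ‖ₑ) ^ (r - 2) * ∫⁻ x, ‖synth φ x‖ₑ ^ (2 : ℝ) := by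
        have := measurable_synth hφ.meas
        rw [lintegral_const_mul _ (by fun_prop)]
    _ < ⊤ := ENNReal.mul_lt_top
        (ENNReal.rpow_lt_top_of_nonneg (by linarith) hφ.integrable.hasFiniteIntegral.ne)
        (by simpa using h2)

theorem locBdd₂_one {W : Type*} [NormedAddCommGroup W] : LocBdd₂ fun _ _ : W => (1 : ℂ) := fun _ => ⟨1, by simp⟩

theorem BandLimited.convolution {φ ψ : V → ℂ} (hφ : BandLimited φ) (hψ : BandLimited ψ) :
    BandLimited fun ζ => ∫ ξ, φ ξ * ψ (ζ - ξ) := by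
  simpa using bandLimited_profile (σ := fun _ _ => 1) measurable_const locBdd₂_one hφ hψ

theorem bisynth_one (φ ψ : V → ℂ) (x : V) :
    bisynth (fun _ _ => 1) φ ψ x = synth φ x * synth ψ x := by
  rw [bisynth, synth, synth, ← integral_prod_mul, Measure.volume_eq_prod]
  congr 1
  ext z
  rw [planeWave_add_right]
  ring

theorem synth_convolution {φ ψ : V → ℂ} (hφ : BandLimited φ) (hψ : BandLimited ψ) (x : V) :
    synth (fun ζ => ∫ ξ, φ ξ * ψ (ζ - ξ)) x = synth φ x * synth ψ x := by
  have h := bisynth_eq_synth (σ := fun _ _ => 1) measurable_const locBdd₂_one hφ hψ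
    (m := fun _ => 1) measurable_const (LpMultiplier.one 2).bdd
  simp only [one_mul] at h
  rw [← h, bisynth_one]

theorem synth_const_mul (c : ℂ) (φ : V → ℂ) (x : V) :
    synth (fun ξ => c * φ ξ) x = c * synth φ x := by
  rw [synth, synth, ← integral_const_mul]
  congr 1
  ext ξ
  ring

theorem HalfBandLimited.convolution {v : V} {χ : V → ℂ} (h : HalfBandLimited v χ) :
    HalfBandLimited v fun ζ => ∫ ξ, χ ξ * χ (ζ - ξ) where
  toBandLimited := h.toBandLimited.convolution h.toBandLimited
  eq_zero ζ hζ := by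
    refine (integral_congr_ae (ae_of_all _ fun ξ => ?_)).trans (integral_zero _ _)
    rcases le_or_gt ⟪v, ξ⟫ 0 with h1 | h1
    · simp [h.eq_zero ξ h1]
    · simp [h.eq_zero (ζ - ξ) (by rw [inner_sub_right]; linarith)]
  vanish := by
    obtain ⟨C, hC⟩ := h.vanish
    refine ⟨(∫ ξ, ‖χ ξ‖) * |C|, fun ζ => ?_⟩
    rw [mul_assoc, ← integral_mul_const]
    refine norm_integral_le_of_norm_le (h.integrable.norm.mul_const _)
      (ae_of_all _ fun ξ => ?_)
    rw [norm_mul]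
    rcases le_or_gt ⟪v, ξ⟫ 0 with h1 | h1
    · simp [h.eq_zero ξ h1]
    rcases le_or_gt ⟪v, ζ - ξ⟫ 0 with h2 | h2
    · simp only [h.eq_zero _ h2, norm_zero, mul_zero]
      positivity
    have h3 : ⟪v, ζ - ξ⟫ ≤ ⟪v, ζ⟫ := by
      rw [inner_sub_right]
      linarith
    gcongr
    refine (hC _).trans ?_
    gcongr
    exact le_abs_self C

theorem ReControl.two_mul {p : ℝ} (hp : 1 < p) (h : ReControl V p) : ReControl V (2 * p) := by
  obtain ⟨K, hK, h⟩ := h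
  refine ⟨2 * K, ENNReal.mul_ne_top (by norm_num) hK, fun v χ hχ => ?_⟩
  set N := eLpNorm (synth χ) (ENNReal.ofReal (2 * p)) volume
  set U := eLpNorm (fun x => (synth χ x).re) (ENNReal.ofReal (2 * p)) volume
  have hN : N < ⊤ := hχ.eLpNorm_synth_lt_top (by linarith)
  have hm := measurable_synth hχ.meas
  have hG := h v _ (hχ.convolution.const_mul (-Complex.I))
  have e : ∀ x, synth (fun ξ => -Complex.I * ∫ η, χ η * χ (ξ - η)) x =
      -Complex.I * (synth χ x * synth χ x) := fun x => by
    rw [synth_const_mul, synth_convolution hχ.toBandLimited hχ.toBandLimited]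
  have e1 : eLpNorm (synth fun ξ => -Complex.I * ∫ η, χ η * χ (ξ - η)) (ENNReal.ofReal p) volume =
      N ^ 2 := by
    have := eLpNorm_norm_rpow (p := ENNReal.ofReal p) (μ := volume) (synth χ) (q := 2) (by norm_num)
    rw [← ENNReal.ofReal_mul (by linarith), mul_comm p 2] at this
    rw [← ENNReal.rpow_two, ← this]
    refine eLpNorm_congr_norm_ae (ae_of_all _ fun x => ?_)
    rw [e]
    simp [sq]
  have e2 : eLpNorm (fun x => (synth (fun ξ => -Complex.I * ∫ η, χ η * χ (ξ - η)) x).re)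
      (ENNReal.ofReal p) volume ≤ 2 * U * N := by
    have : ENNReal.HolderTriple (ENNReal.ofReal (2 * p)) (ENNReal.ofReal (2 * p))
        (ENNReal.ofReal p) := ⟨by
      rw [← ENNReal.ofReal_inv_of_pos (by linarith), ← ENNReal.ofReal_inv_of_pos (by linarith),
        ← ENNReal.ofReal_add (by positivity) (by positivity)]
      congr 1
      field_simp
      norm_num⟩
    refine le_trans (le_of_eq ?_) (eLpNorm_le_eLpNorm_mul_eLpNorm_of_nnnorm
      (f := fun x => (synth χ x).re) (g := synth χ) (p := ENNReal.ofReal (2 * p))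
      (q := ENNReal.ofReal (2 * p)) (r := ENNReal.ofReal p) (by fun_prop) hm.aestronglyMeasurable
      (fun u w => 2 * u * w.im) 2 (ae_of_all _ fun x => ?_))
    · congr 1
      ext x
      rw [e]
      simp
      ring
    · rw [← NNReal.coe_le_coe]
      simp only [coe_nnnorm, NNReal.coe_mul, NNReal.coe_ofNat, norm_mul, Real.norm_ofNat]
      gcongr
      exact Complex.abs_im_le_norm _
  rw [e1] at hG
  rcases eq_or_ne N 0 with h0 | h0
  · simp [h0]
  · have h3 : N * N ≤ 2 * K * U * N := by
      rw [← sq]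
      refine hG.trans ((mul_le_mul_right e2 K).trans (le_of_eq ?_))
      ring
    exact (ENNReal.mul_le_mul_iff_left h0 hN.ne).1 h3

/-- The `L ^ p` norm of a function with half-space spectrum is controlled by its real part. -/
theorem reControl {p : ℝ} (hp : 1 < p) : ReControl V p := by
  have key : ∀ (n : ℕ) (p : ℝ), 1 < p → p ≤ 2 ^ (n + 1) → ReControl V p := by
    intro n
    induction n with
    | zero => exact fun p hp h => ReControl.of_le_two hp (by simpa using h)
    | succ n ih =>
      intro p hp h
      rcases le_or_gt p 2 with h2 | h2
      · exact ReControl.of_le_two hp h2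
      · have := (ih (p / 2) (by linarith) (by rw [pow_succ] at h; linarith)).two_mul (by linarith)
        rwa [mul_div_cancel₀ p (by norm_num : (2 : ℝ) ≠ 0)] at this
  obtain ⟨n, hn⟩ := pow_unbounded_of_one_lt p (by norm_num : (1 : ℝ) < 2)
  exact key n p hp (hn.le.trans (pow_le_pow_right₀ (by norm_num) n.le_succ))

end Doubling

/-! ### Sharp cutoffs to half spaces -/

theorem BandLimited.conj_neg {W : Type*} [NormedAddCommGroup W] [MeasurableSpace W] [BorelSpace W]
    {φ : W → ℂ} (hφ : BandLimited φ) :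
    BandLimited fun ξ => starRingEnd ℂ (φ (-ξ)) where
  meas := by
    have := hφ.meas
    fun_prop
  bdd := by
    obtain ⟨C, hC⟩ := hφ.bdd
    exact ⟨C, fun ξ => by simpa using hC (-ξ)⟩
  supp := by
    obtain ⟨R, hR⟩ := hφ.supp
    exact ⟨R, fun ξ hξ => by simpa using hR (-ξ) (by simpa using hξ)⟩

theorem BandLimited.add {W : Type*} [NormedAddCommGroup W] [MeasurableSpace W] {φ ψ : W → ℂ}
    (hφ : BandLimited φ) (hψ : BandLimited ψ) :
    BandLimited fun ξ => φ ξ + ψ ξ where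
  meas := hφ.meas.add hψ.meas
  bdd := by
    obtain ⟨C, hC⟩ := hφ.bdd
    obtain ⟨D, hD⟩ := hψ.bdd
    exact ⟨C + D, fun ξ => (norm_add_le _ _).trans (add_le_add (hC ξ) (hD ξ))⟩
  supp := by
    obtain ⟨R, hR⟩ := hφ.supp
    obtain ⟨S, hS⟩ := hψ.supp
    exact ⟨max R S, fun ξ hξ => by
      rw [hR ξ ((le_max_left _ _).trans_lt hξ), hS ξ ((le_max_right _ _).trans_lt hξ), add_zero]⟩

section HalfSpace

/-- The indicator function of the open half space `0 < ⟪v, ξ⟫`. -/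
noncomputable def halfSpace {V : Type*} [NormedAddCommGroup V] [InnerProductSpace ℝ V] (v ξ : V) :
    ℂ :=
  if 0 < ⟪v, ξ⟫ then 1 else 0

variable {V : Type*} [NormedAddCommGroup V] [InnerProductSpace ℝ V]

theorem halfSpace_of_pos {v ξ : V} (h : 0 < ⟪v, ξ⟫) : halfSpace v ξ = 1 := if_pos h

theorem halfSpace_of_nonpos {v ξ : V} (h : ⟪v, ξ⟫ ≤ 0) : halfSpace v ξ = 0 := if_neg h.not_gt

theorem norm_halfSpace_le (v ξ : V) : ‖halfSpace v ξ‖ ≤ 1 := by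
  unfold halfSpace
  split_ifs <;> simp

theorem locBdd_halfSpace (v : V) : LocBdd (halfSpace v) :=
  fun _ => ⟨1, fun ξ _ => norm_halfSpace_le v ξ⟩

variable [FiniteDimensional ℝ V] [MeasurableSpace V] [BorelSpace V]

@[fun_prop]
theorem measurable_halfSpace (v : V) : Measurable (halfSpace v) :=
  Measurable.ite (measurableSet_lt measurable_const (by fun_prop)) measurable_const
    measurable_const

theorem synth_add {φ ψ : V → ℂ} (hφ : Integrable φ) (hψ : Integrable ψ) (x : V) :
    synth (fun ξ => φ ξ + ψ ξ) x = synth φ x + synth ψ x := by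
  rw [synth, synth, synth, ← integral_add (integrable_synth hφ x) (integrable_synth hψ x)]
  congr 1
  ext ξ
  ring

theorem synth_conj_neg (φ : V → ℂ) (x : V) :
    synth (fun ξ => starRingEnd ℂ (φ (-ξ))) x = starRingEnd ℂ (synth φ x) := by
  rw [synth, synth, ← integral_conj, ← integral_neg_eq_self]
  congr 1
  ext ξ
  rw [map_mul, neg_neg, planeWave, planeWave, ← Complex.exp_conj, map_mul, Complex.conj_ofReal,
    Complex.conj_I, inner_neg_right]
  push_cast
  ring_nf

theorem BandLimited.halfSpace {φ : V → ℂ} (hφ : BandLimited φ) (v : V) :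
    BandLimited fun ξ => halfSpace v ξ * φ ξ :=
  hφ.mul (measurable_halfSpace v) (locBdd_halfSpace v)

theorem BandLimited.halfBandLimited {φ : V → ℂ} (hφ : BandLimited φ) {v : V} {C : ℝ}
    (hC : ∀ ξ, ‖φ ξ‖ ≤ C * ⟪v, ξ⟫ ^ 2) : HalfBandLimited v fun ξ => _root_.halfSpace v ξ * φ ξ where
  toBandLimited := hφ.halfSpace v
  eq_zero ξ hξ := by rw [halfSpace_of_nonpos hξ, zero_mul]
  vanish := ⟨C, fun ξ => by
    rw [norm_mul]
    exact (mul_le_of_le_one_left (norm_nonneg _) (norm_halfSpace_le v ξ)).trans (hC ξ)⟩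

theorem exists_eLpNorm_halfSpace_le_of_vanish {p : ℝ} (hp : 1 < p) : ∃ K : ℝ≥0∞, K ≠ ⊤ ∧
    ∀ (v : V) (φ : V → ℂ), BandLimited φ → (∃ C : ℝ, ∀ ξ, ‖φ ξ‖ ≤ C * ⟪v, ξ⟫ ^ 2) →
      eLpNorm (synth fun ξ => halfSpace v ξ * φ ξ) (ENNReal.ofReal p) volume ≤
        K * eLpNorm (synth φ) (ENNReal.ofReal p) volume := by
  obtain ⟨K, hK, h⟩ := reControl (V := V) hp
  refine ⟨K + K, ENNReal.add_ne_top.2 ⟨hK, hK⟩, fun v φ hφ ⟨C, hC⟩ => ?_⟩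
  have hp1 : 1 ≤ ENNReal.ofReal p := by simpa using hp.le
  set P := synth fun ξ => halfSpace v ξ * φ ξ
  set M := synth fun ξ => halfSpace v (-ξ) * φ ξ
  have hneg : BandLimited fun ξ => halfSpace v (-ξ) * φ ξ :=
    hφ.mul (by fun_prop) fun _ => ⟨1, fun ξ _ => norm_halfSpace_le v _⟩
  have hsum : ∀ x, synth φ x = P x + M x := fun x => by
    rw [← synth_add (hφ.halfSpace v).integrable hneg.integrable]
    congr 1
    ext ξ
    rcases lt_trichotomy ⟪v, ξ⟫ 0 with h1 | h1 | h1
    · rw [halfSpace_of_nonpos h1.le, halfSpace_of_pos (by rw [inner_neg_right]; linarith)]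
      ring
    · have := hC ξ
      rw [h1] at this
      have : φ ξ = 0 := by simpa using this
      simp [this]
    · rw [halfSpace_of_pos h1, halfSpace_of_nonpos (by rw [inner_neg_right]; linarith)]
      ring
  have hψ : ∀ a b : ℂ, HalfBandLimited v fun ξ =>
      halfSpace v ξ * (a * φ ξ + b * starRingEnd ℂ (φ (-ξ))) := fun a b => by
    refine BandLimited.halfBandLimited (C := (‖a‖ + ‖b‖) * C)
      ((hφ.mul measurable_const fun _ => ⟨‖a‖, fun _ _ => le_rfl⟩).add
      (hφ.conj_neg.mul measurable_const fun _ => ⟨‖b‖, fun _ _ => le_rfl⟩)) fun ξ => ?_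
    have h1 := mul_le_mul_of_nonneg_left (hC ξ) (norm_nonneg a)
    have h2 := mul_le_mul_of_nonneg_left (hC (-ξ)) (norm_nonneg b)
    refine (norm_add_le _ _).trans ?_
    rw [norm_mul, norm_mul, RCLike.norm_conj]
    rw [inner_neg_right, neg_sq] at h2
    linarith
  have hsynth : ∀ (a b : ℂ) (x : V),
      synth (fun ξ => halfSpace v ξ * (a * φ ξ + b * starRingEnd ℂ (φ (-ξ)))) x =
        a * P x + b * starRingEnd ℂ (M x) := fun a b x => by
    rw [← synth_conj_neg, ← synth_const_mul, ← synth_const_mul, ← synth_add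
      ((hφ.halfSpace v).integrable.const_mul a) (hneg.conj_neg.integrable.const_mul b)]
    congr 1
    ext ξ
    have : starRingEnd ℂ (halfSpace v ξ) = halfSpace v ξ := by
      unfold halfSpace
      split_ifs <;> simp
    rw [map_mul, neg_neg, this]
    ring
  set P₁ := synth fun ξ => halfSpace v ξ * (1 * φ ξ + 1 * starRingEnd ℂ (φ (-ξ))) with hP₁
  set P₂ := synth fun ξ => halfSpace v ξ * (-Complex.I * φ ξ + Complex.I * starRingEnd ℂ (φ (-ξ)))
    with hP₂
  have b1 : eLpNorm P₁ (ENNReal.ofReal p) volume ≤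
      K * eLpNorm (synth φ) (ENNReal.ofReal p) volume := by
    refine (h v _ (hψ 1 1)).trans (mul_le_mul_right (eLpNorm_mono fun x => ?_) K)
    have : (synth (fun ξ => halfSpace v ξ * (1 * φ ξ + 1 * starRingEnd ℂ (φ (-ξ)))) x).re =
        (synth φ x).re := by
      rw [hsynth, hsum]
      simp
    rw [this]
    exact Complex.abs_re_le_norm _
  have b2 : eLpNorm P₂ (ENNReal.ofReal p) volume ≤
      K * eLpNorm (synth φ) (ENNReal.ofReal p) volume := by
    refine (h v _ (hψ (-Complex.I) Complex.I)).trans (mul_le_mul_right (eLpNorm_mono fun x => ?_) K)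
    have : (synth (fun ξ => halfSpace v ξ *
        (-Complex.I * φ ξ + Complex.I * starRingEnd ℂ (φ (-ξ)))) x).re = (synth φ x).im := by
      rw [hsynth, hsum]
      simp
    rw [this]
    exact Complex.abs_im_le_norm _
  have hm1 := measurable_synth (hψ 1 1).meas
  have hm2 := measurable_synth (hψ (-Complex.I) Complex.I).meas
  calc eLpNorm P (ENNReal.ofReal p) volume
      ≤ eLpNorm (P₁ + Complex.I • P₂) (ENNReal.ofReal p) volume := by
        refine eLpNorm_mono fun x => ?_
        have : P₁ x + Complex.I * P₂ x = 2 * P x := by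
          rw [hP₁, hP₂, hsynth, hsynth]
          linear_combination (-P x + starRingEnd ℂ (M x)) * Complex.I_sq
        rw [Pi.add_apply, Pi.smul_apply, smul_eq_mul, this, norm_mul, Complex.norm_ofNat]
        linarith [norm_nonneg (P x)]
    _ ≤ eLpNorm P₁ (ENNReal.ofReal p) volume + eLpNorm P₂ (ENNReal.ofReal p) volume := by
        refine (eLpNorm_add_le hm1.aestronglyMeasurable
          (hm2.aestronglyMeasurable.const_smul _) hp1).trans (add_le_add_right ?_ _)
        refine eLpNorm_const_smul_le.trans (le_of_eq ?_)
        rw [← ofReal_norm, Complex.norm_I, ENNReal.ofReal_one, one_mul]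
    _ ≤ _ := by
        rw [add_mul]
        exact add_le_add b1 b2

theorem LpMultiplier.halfSpace {p : ℝ} (hp : 1 < p) :
    ∃ K : ℝ≥0∞, K ≠ ⊤ ∧ ∀ v : V, LpMultiplier p K (halfSpace v) := by
  obtain ⟨K, hK, h⟩ := exists_eLpNorm_halfSpace_le_of_vanish (V := V) hp
  let A : ℝ≥0∞ := 1 + ‖(-1 : ℂ)‖ₑ * 1
  have hA : A * A ≠ ⊤ := ENNReal.mul_ne_top (by simp [A]) (by simp [A])
  refine ⟨K * (A * A), ENNReal.mul_ne_top hK hA, fun v =>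
    ⟨measurable_halfSpace v, locBdd_halfSpace v, fun φ hφ => ?_⟩⟩
  let m : ℕ → V → ℂ := fun n ξ => 1 + -1 * (Real.exp (-((n : ℝ) * |⟪v, ξ⟫|)) : ℂ)
  have hm : ∀ n, LpMultiplier p (A * A) fun ξ => m n ξ * m n ξ := fun n =>
    have h1 := (LpMultiplier.one p).add hp
      ((LpMultiplier.exp_neg_mul_abs_inner hp (Nat.cast_nonneg n) v).const_mul (-1))
    h1.mul h1
  have hreal : ∀ n ξ, m n ξ = ((1 - Real.exp (-((n : ℝ) * |⟪v, ξ⟫|)) : ℝ) : ℂ) := fun n ξ => by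
    simp only [m]
    push_cast
    ring
  have hnorm : ∀ n ξ, ‖m n ξ‖ = 1 - Real.exp (-((n : ℝ) * |⟪v, ξ⟫|)) := fun n ξ => by
    rw [hreal, Complex.norm_real, Real.norm_of_nonneg]
    have : Real.exp (-((n : ℝ) * |⟪v, ξ⟫|)) ≤ 1 :=
      Real.exp_le_one_iff.2 (neg_nonpos.2 (by positivity))
    linarith
  have hnorm1 : ∀ n ξ, ‖m n ξ‖ ≤ 1 := fun n ξ => by
    rw [hnorm]
    linarith [Real.exp_pos (-((n : ℝ) * |⟪v, ξ⟫|))]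
  have hnorm2 : ∀ n ξ, ‖m n ξ‖ ≤ n * |⟪v, ξ⟫| := fun n ξ => by
    rw [hnorm]
    linarith [Real.one_sub_le_exp_neg ((n : ℝ) * |⟪v, ξ⟫|)]
  have hφn : ∀ n, BandLimited fun ξ => m n ξ * m n ξ * φ ξ := fun n =>
    hφ.mul (hm n).meas (hm n).bdd
  obtain ⟨D, hD⟩ := hφ.bdd
  have hbound : ∀ n, eLpNorm (synth fun ξ => _root_.halfSpace v ξ * (m n ξ * m n ξ * φ ξ))
      (ENNReal.ofReal p) volume ≤ K * (A * A) * eLpNorm (synth φ) (ENNReal.ofReal p) volume :=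
    fun n => by
      refine (h v _ (hφn n) ⟨n ^ 2 * D, fun ξ => ?_⟩).trans ?_
      · have : n ^ 2 * D * ⟪v, ξ⟫ ^ 2 = (n * |⟪v, ξ⟫|) * (n * |⟪v, ξ⟫|) * D := by
          rw [← sq_abs ⟪v, ξ⟫]
          ring
        rw [norm_mul, norm_mul, this]
        gcongr
        exacts [hnorm2 n ξ, hnorm2 n ξ, hD ξ]
      · rw [mul_assoc]
        gcongr
        exact (hm n).bound φ hφ
  refine Lp.eLpNorm_le_of_ae_tendsto (u := Filter.atTop) (Filter.Eventually.of_forall hbound)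
    (fun n => (measurable_synth ((hφn n).halfSpace v).meas).aestronglyMeasurable)
    (ae_of_all _ fun x => ?_)
  refine tendsto_integral_of_dominated_convergence (fun ξ => ‖φ ξ‖)
    (fun n => (integrable_synth ((hφn n).halfSpace v).integrable x).aestronglyMeasurable)
    hφ.integrable.norm (fun n => ae_of_all _ fun ξ => ?_) (ae_of_all _ fun ξ => ?_)
  · rw [norm_mul, norm_planeWave, one_mul, norm_mul, norm_mul, norm_mul]
    calc _ ≤ 1 * (1 * 1 * ‖φ ξ‖) := by
          gcongr
          exacts [norm_halfSpace_le v ξ, hnorm1 n ξ, hnorm1 n ξ]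
      _ = _ := by ring
  · rcases le_or_gt ⟪v, ξ⟫ 0 with h1 | h1
    · simp [halfSpace_of_nonpos h1]
    · have hlim : Filter.Tendsto (fun n => m n ξ) Filter.atTop (nhds 1) := by
        have h2 : Filter.Tendsto (fun n : ℕ => Real.exp (-((n : ℝ) * |⟪v, ξ⟫|))) Filter.atTop
            (nhds 0) := Real.tendsto_exp_neg_atTop_nhds_zero.comp
          (tendsto_natCast_atTop_atTop.atTop_mul_const (abs_pos.2 h1.ne'))
        have h3 := (Complex.continuous_ofReal.tendsto _).comp h2
        simpa [m] using (h3.const_mul (-1 : ℂ)).const_add (1 : ℂ)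
      have := ((((hlim.mul hlim).mul_const (φ ξ)).const_mul (_root_.halfSpace v ξ)).const_mul
        (_root_.planeWave x ξ))
      simpa using this

end HalfSpace

/-! ### Absorbing the exponential weights -/

section ExponentialWeights

variable {V : Type*} [NormedAddCommGroup V] [InnerProductSpace ℝ V] [FiniteDimensional ℝ V]
  [MeasurableSpace V] [BorelSpace V]

theorem exp_abs_add_sub_eq (a s t : ℝ) {h : ℝ → ℂ} (h1 : ∀ s, 0 < s → h s = 1)
    (h0 : ∀ s, s ≤ 0 → h s = 0) (z : ℂ) :
    (Real.exp (a * (|s + t| - |s| - |t|)) : ℂ) * z =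
      h s * (h t * z) + (1 + -1 * h s) * ((1 + -1 * h t) * z) +
      h (s + t) * (h s * ((1 + -1 * h t) * (Real.exp (-(2 * a * |t|)) : ℂ) * z)) +
      (1 + -1 * h (s + t)) * (h s * (Real.exp (-(2 * a * |s|)) : ℂ) * ((1 + -1 * h t) * z)) +
      h (s + t) * ((1 + -1 * h s) * (Real.exp (-(2 * a * |s|)) : ℂ) * (h t * z)) +
      (1 + -1 * h (s + t)) * ((1 + -1 * h s) * (h t * (Real.exp (-(2 * a * |t|)) : ℂ) * z)) := by
  rcases lt_or_ge 0 s with hs | hs <;> rcases lt_or_ge 0 t with ht | ht <;>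
    rcases lt_or_ge 0 (s + t) with hst | hst
  · rw [h1 s hs, h1 t ht, h1 _ hst, abs_of_pos hs, abs_of_pos ht, abs_of_pos hst]
    ring_nf
    simp
  · linarith
  · rw [h1 s hs, h0 t ht, h1 _ hst, abs_of_pos hs, abs_of_nonpos ht, abs_of_pos hst]
    ring_nf
  · rw [h1 s hs, h0 t ht, h0 _ hst, abs_of_pos hs, abs_of_nonpos ht, abs_of_nonpos hst]
    ring_nf
  · rw [h0 s hs, h1 t ht, h1 _ hst, abs_of_nonpos hs, abs_of_pos ht, abs_of_pos hst]
    ring_nf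
  · rw [h0 s hs, h1 t ht, h0 _ hst, abs_of_nonpos hs, abs_of_pos ht, abs_of_nonpos hst]
    ring_nf
  · linarith
  · rw [h0 s hs, h0 t ht, h0 _ hst, abs_of_nonpos hs, abs_of_nonpos ht, abs_of_nonpos hst]
    ring_nf
    simp

theorem BilinMultiplier.exists_exp_abs_inner_mul {p : ℝ} (hp : 1 < p) : ∃ B : ℝ≥0∞, B ≠ ⊤ ∧
    ∀ (a : ℝ) (v : V) (C : ℝ≥0∞) (σ : V → V → ℂ), 0 ≤ a → BilinMultiplier p C σ →
      BilinMultiplier p (B * C) fun ξ η =>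
        (Real.exp (a * (|⟪v, ξ + η⟫| - |⟪v, ξ⟫| - |⟪v, η⟫|)) : ℂ) * σ ξ η := by
  obtain ⟨K, hK, hH⟩ := LpMultiplier.halfSpace (V := V) hp
  set L : ℝ≥0∞ := 1 + K
  have hL : L ≠ ⊤ := ENNReal.add_ne_top.2 ⟨ENNReal.one_ne_top, hK⟩
  refine ⟨2 * L ^ 2 + 4 * L ^ 3, by finiteness, fun a v C σ ha hσ => ?_⟩
  have hh : LpMultiplier p L fun ξ => halfSpace v ξ := (hH v).mono le_add_self
  have hc : LpMultiplier p L fun ξ => 1 + -1 * halfSpace v ξ :=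
    ((LpMultiplier.one p).add hp ((hH v).const_mul (-1))).mono (by simp [L])
  have hE := LpMultiplier.exp_neg_mul_abs_inner hp (mul_nonneg zero_le_two ha) v
  have hhE := (hh.mul hE).mono (mul_one L).le
  have hcE := (hc.mul hE).mono (mul_one L).le
  have key := ((((((hσ.mul_right hh).mul_left hh).add hp ((hσ.mul_right hc).mul_left hc)).add hp
    (((hσ.mul_right hcE).mul_left hh).mul_outer hh)).add hp
    (((hσ.mul_right hc).mul_left hhE).mul_outer hc)).add hp
    (((hσ.mul_right hh).mul_left hcE).mul_outer hh)).add hp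
    (((hσ.mul_right hhE).mul_left hc).mul_outer hc)
  have e : ∀ ξ η : V, _ := fun ξ η => exp_abs_add_sub_eq a ⟪v, ξ⟫ ⟪v, η⟫
    (h := fun s => if 0 < s then 1 else 0) (fun s hs => if_pos hs)
    (fun s hs => if_neg hs.not_gt) (σ ξ η)
  simp only [inner_add_right]
  simp only [halfSpace, inner_add_right] at key
  simp only [e]
  refine key.mono (le_of_eq ?_)
  ring

theorem BilinMultiplier.exists_exp_sum_abs_inner_mul {p : ℝ} (hp : 1 < p) {ι : Type*}
    (v : ι → V) (s : Finset ι) : ∃ B : ℝ≥0∞, B ≠ ⊤ ∧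
    ∀ (a : ℝ) (C : ℝ≥0∞) (σ : V → V → ℂ), 0 ≤ a → BilinMultiplier p C σ →
      BilinMultiplier p (B * C) fun ξ η =>
        (Real.exp (a * ∑ i ∈ s, (|⟪v i, ξ + η⟫| - |⟪v i, ξ⟫| - |⟪v i, η⟫|)) : ℂ) * σ ξ η := by
  classical
  obtain ⟨B, hB, h⟩ := exists_exp_abs_inner_mul (V := V) hp
  induction s using Finset.induction_on with
  | empty => exact ⟨1, by simp, fun a C σ _ hσ => by simpa using hσ⟩
  | insert i s hi ih =>
    obtain ⟨D, hD, ih⟩ := ih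
    refine ⟨B * D, ENNReal.mul_ne_top hB hD, fun a C σ ha hσ => ?_⟩
    have := h a (v i) _ _ ha (ih a C σ ha hσ)
    simp only [Finset.sum_insert hi, mul_add, Real.exp_add, Complex.ofReal_mul, mul_assoc]
    simpa only [mul_assoc] using this

end ExponentialWeights

section Gevrey

variable {d : ℕ}

/-- The Gevrey weight `e ^ (a ‖ξ‖₁) (1 + ‖ξ‖) ^ β`. -/
noncomputable def gevWeight (d : ℕ) (a β : ℝ) (ξ : EuclideanSpace ℝ (Fin d)) : ℝ :=
  Real.exp (a * ∑ i, |ξ i|) * (1 + ‖ξ‖) ^ β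

theorem continuous_gevWeight (a β : ℝ) : Continuous (gevWeight d a β) := by
  unfold gevWeight
  refine (by fun_prop : Continuous fun ξ : EuclideanSpace ℝ (Fin d) =>
    Real.exp (a * ∑ i, |ξ i|)).mul ?_
  exact Continuous.rpow_const (by fun_prop) fun ξ => Or.inl (by positivity)

theorem one_le_gevWeight {a β : ℝ} (ha : 0 ≤ a) (hβ : 0 ≤ β) (ξ : EuclideanSpace ℝ (Fin d)) :
    1 ≤ gevWeight d a β ξ :=
  one_le_mul_of_one_le_of_one_le (Real.one_le_exp (by positivity))
    (Real.one_le_rpow (by linarith [norm_nonneg ξ]) hβ)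

theorem locBdd_gevWeight (a β : ℝ) : LocBdd fun ξ => (gevWeight d a β ξ : ℂ) := fun R => by
  obtain ⟨B, hB⟩ := (isCompact_closedBall (0 : EuclideanSpace ℝ (Fin d)) R).exists_bound_of_continuousOn
    (continuous_gevWeight a β).continuousOn
  exact ⟨B, fun ξ hξ => by simpa using hB ξ (by simpa using hξ)⟩

theorem gevH_eq_synth (a β : ℝ) (h : EuclideanSpace ℝ (Fin d) → ℂ) :
    gevH d a β h = synth fun ξ => (gevWeight d a β ξ : ℂ) * 𝓕 h ξ := by
  ext x
  simp only [gevH, synth, gevWeight, planeWave, mul_assoc]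

variable {V : Type*} [NormedAddCommGroup V] [InnerProductSpace ℝ V] [FiniteDimensional ℝ V]
  [MeasurableSpace V] [BorelSpace V]

theorem bandLimited_fourier (f : SchwartzMap V ℂ) (hf : HasCompactSupport (𝓕 ⇑f)) :
    BandLimited (𝓕 ⇑f) where
  meas := by
    rw [← SchwartzMap.fourier_coe]
    exact (𝓕 f).continuous.measurable
  bdd := by
    rw [← SchwartzMap.fourier_coe] at hf ⊢
    exact (𝓕 f).continuous.bounded_above_of_compact_support hf
  supp := by
    obtain ⟨R, hR⟩ := hf.isCompact.isBounded.subset_closedBall 0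
    refine ⟨R, fun ξ hξ => image_eq_zero_of_notMem_tsupport fun h => ?_⟩
    have := hR h
    rw [mem_closedBall_zero_iff] at this
    linarith

theorem fourier_mul_eq_convolution (f g : SchwartzMap V ℂ) (hf : HasCompactSupport (𝓕 ⇑f))
    (hg : HasCompactSupport (𝓕 ⇑g)) :
    𝓕 (fun x => f x * g x) = fun ζ => ∫ ξ, 𝓕 ⇑f ξ * 𝓕 ⇑g (ζ - ξ) := by
  let k : SchwartzMap V ℂ := SchwartzMap.convolution (ContinuousLinearMap.mul ℂ ℂ) (𝓕 f) (𝓕 g)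
  have hk : ⇑k = fun ζ => ∫ ξ, 𝓕 ⇑f ξ * 𝓕 ⇑g (ζ - ξ) := by
    ext ζ
    simp only [k, SchwartzMap.convolution_apply]
    rfl
  have hinv : ∀ h : SchwartzMap V ℂ, synth (𝓕 ⇑h) = h := fun h => by
    rw [← fourierInv_eq_synth, ← SchwartzMap.fourier_coe, ← SchwartzMap.fourierInv_coe]
    simp
  have e : (fun x => f x * g x) = 𝓕⁻ ⇑k := by
    ext x
    rw [fourierInv_eq_synth, hk,
      synth_convolution (bandLimited_fourier f hf) (bandLimited_fourier g hg), hinv, hinv]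
  rw [e, ← hk, ← SchwartzMap.fourierInv_coe, ← SchwartzMap.fourier_coe]
  simp

theorem gevH_mul_eq_bisynth {a β : ℝ} (ha : 0 ≤ a) (hβ : 0 ≤ β)
    (f g : SchwartzMap (EuclideanSpace ℝ (Fin d)) ℂ) (hf : HasCompactSupport (𝓕 ⇑f))
    (hg : HasCompactSupport (𝓕 ⇑g)) :
    gevH d a β (fun x => f x * g x) =
      bisynth (fun ξ η => (gevWeight d a β (ξ + η) : ℂ) *
        ((gevWeight d a β ξ : ℂ)⁻¹ * (gevWeight d a β η : ℂ)⁻¹))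
        (fun ξ => (gevWeight d a β ξ : ℂ) * 𝓕 ⇑f ξ)
        (fun ξ => (gevWeight d a β ξ : ℂ) * 𝓕 ⇑g ξ) := by
  have hw := (continuous_gevWeight (d := d) a β).measurable
  have hwc : Measurable fun ξ => (gevWeight d a β ξ : ℂ) := by fun_prop
  have hpos := fun ξ : EuclideanSpace ℝ (Fin d) => one_le_gevWeight ha hβ ξ
  rw [bisynth_eq_synth (σ := fun ξ η => (gevWeight d a β ξ : ℂ)⁻¹ * (gevWeight d a β η : ℂ)⁻¹)
    (m := fun ξ => (gevWeight d a β ξ : ℂ)) _ _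
    ((bandLimited_fourier f hf).mul hwc (locBdd_gevWeight a β))
    ((bandLimited_fourier g hg).mul hwc (locBdd_gevWeight a β)) hwc (locBdd_gevWeight a β),
    gevH_eq_synth, fourier_mul_eq_convolution f g hf hg]
  · congr 1
    ext ζ
    refine congrArg _ (integral_congr_ae (ae_of_all _ fun ξ => ?_))
    dsimp only
    have h1 : (gevWeight d a β ξ : ℂ) ≠ 0 := by
      exact_mod_cast (zero_lt_one.trans_le (hpos ξ)).ne'
    have h2 : (gevWeight d a β (ζ - ξ) : ℂ) ≠ 0 := by
      exact_mod_cast (zero_lt_one.trans_le (hpos (ζ - ξ))).ne'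
    field_simp
  · exact (by fun_prop : Measurable fun z : EuclideanSpace ℝ (Fin d) × EuclideanSpace ℝ (Fin d) =>
      (gevWeight d a β z.1 : ℂ)⁻¹ * (gevWeight d a β z.2 : ℂ)⁻¹)
  · refine fun R => ⟨1, fun ξ η _ _ => ?_⟩
    have hi : ∀ ξ : EuclideanSpace ℝ (Fin d), ‖(gevWeight d a β ξ : ℂ)⁻¹‖ ≤ 1 := fun ξ => by
      rw [norm_inv, Complex.norm_real, Real.norm_of_nonneg (zero_le_one.trans (hpos ξ))]
      exact inv_le_one_of_one_le₀ (hpos ξ)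
    rw [norm_mul]
    exact mul_le_one₀ (hi ξ) (norm_nonneg _) (hi η)

theorem gevWeight_symbol_eq (a β : ℝ) (ξ η : EuclideanSpace ℝ (Fin d)) :
    (gevWeight d a β (ξ + η) : ℂ) * ((gevWeight d a β ξ : ℂ)⁻¹ * (gevWeight d a β η : ℂ)⁻¹) =
      (Real.exp (a * ∑ i, (|⟪EuclideanSpace.single i (1 : ℝ), ξ + η⟫| -
        |⟪EuclideanSpace.single i (1 : ℝ), ξ⟫| - |⟪EuclideanSpace.single i (1 : ℝ), η⟫|)) : ℂ) *
        (bessel (-β) (ξ + η) * (bessel β ξ * bessel β η)) := by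
  simp only [gevWeight, bessel, EuclideanSpace.inner_single_left, map_one, one_mul,
    Finset.sum_sub_distrib, mul_sub, Real.exp_sub, neg_neg]
  rw [Real.rpow_neg (by positivity), Real.rpow_neg (by positivity)]
  push_cast
  field_simp

theorem exists_bilinMultiplier_gevWeight {p β : ℝ} (hp : 1 < p) (hβ : d / p < β) :
    ∃ C : ℝ≥0∞, C ≠ ⊤ ∧ ∀ a : ℝ, 0 ≤ a →
      BilinMultiplier p C fun ξ η : EuclideanSpace ℝ (Fin d) => (gevWeight d a β (ξ + η) : ℂ) *
        ((gevWeight d a β ξ : ℂ)⁻¹ * (gevWeight d a β η : ℂ)⁻¹) := by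
  obtain ⟨C, hC, h⟩ := IsBilinMultiplier.bessel_add_mul_bessel (V := EuclideanSpace ℝ (Fin d))
    (p := p) (β := β) hp (by simpa using hβ)
  obtain ⟨B, hB, h'⟩ := BilinMultiplier.exists_exp_sum_abs_inner_mul
    (V := EuclideanSpace ℝ (Fin d)) hp (fun i => EuclideanSpace.single i (1 : ℝ)) Finset.univ
  refine ⟨B * C, ENNReal.mul_ne_top hB hC, fun a ha => ?_⟩
  simp only [gevWeight_symbol_eq]
  exact h' a C _ ha h

end Gevrey

/-- Lemma 4.1, Banach algebra property of inhomogeneous Gevrey spaces: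
for `1 < p < ∞` and `β > d/p` there is `C` independent of `a ≥ 0` such that for all
Schwartz `f, g` with compactly supported Fourier transforms:
`‖H_{a,β}(fg)‖_{L^p} ≤ C ‖H_{a,β}f‖_{L^p} ‖H_{a,β}g‖_{L^p}`. -/
theorem stmt12 (d : ℕ) (hd : 1 ≤ d) (p β : ℝ) (hp : 1 < p) (hβ : d / p < β) :
    ∃ C : ℝ, 0 < C ∧
      ∀ a : ℝ, 0 ≤ a →
        ∀ f g : SchwartzMap (EuclideanSpace ℝ (Fin d)) ℂ,
          HasCompactSupport (𝓕 ⇑f) → HasCompactSupport (𝓕 ⇑g) →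
          eLpNorm (gevH d a β fun x => f x * g x) (ENNReal.ofReal p) volume ≤
            ENNReal.ofReal C *
              (eLpNorm (gevH d a β ⇑f) (ENNReal.ofReal p) volume *
                eLpNorm (gevH d a β ⇑g) (ENNReal.ofReal p) volume) := by
  obtain ⟨C, hC, h⟩ := exists_bilinMultiplier_gevWeight hp hβ
  have hβ0 : 0 ≤ β := (by positivity : (0 : ℝ) ≤ d / p).trans hβ.le
  refine ⟨C.toReal + 1, by positivity, fun a ha f g hf hg => ?_⟩
  have hw : Measurable fun ξ => (gevWeight d a β ξ : ℂ) :=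
    Complex.measurable_ofReal.comp (continuous_gevWeight a β).measurable
  rw [gevH_mul_eq_bisynth ha hβ0 f g hf hg, gevH_eq_synth, gevH_eq_synth]
  refine ((h a ha).bound _ _ ((bandLimited_fourier f hf).mul hw (locBdd_gevWeight a β))
    ((bandLimited_fourier g hg).mul hw (locBdd_gevWeight a β))).trans ?_
  gcongr
  exact ENNReal.le_ofReal_iff_toReal_le hC (by positivity) |>.2 (by linarith)
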